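/- Fix an integer r ≥ 2 and a collectable r-pattern P, and let M_n be a uniformly random ordered r-matching of size n. Then there exists a constant b_P > 0 such that L_P(M_n)/n^{1/r} converges in probability to b_P as n → ∞. Moreover, if Q is another collectable r-pattern with the same type as P, then b_Q = b_P. -/

import Mathlib

/-- An ordered `r`-matching of size `n`: a partition of `{1,…,r*n}` into `n`
edges, each of size `r`. -/
def IsOrderedMatching (r n : ℕ) (M : Finset (Finset ℕ)) : Prop :=
  M.card = n ∧ (∀ e ∈ M, e.card = r) ∧
    (∀ e ∈ M, ∀ f ∈ M, e ≠ f → Disjoint e f) ∧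
    M.biUnion id = Finset.Icc 1 (r * n)

/-- Two edges `e, f` form the pattern `P`: there is a strictly increasing map
on `e ∪ f` sending the pair `{e, f}` to the pair of edges of `P`. -/
def FormsPattern (e f : Finset ℕ) (P : Finset (Finset ℕ)) : Prop :=
  ∃ φ : ℕ → ℕ, StrictMonoOn φ (↑(e ∪ f) : Set ℕ) ∧
    ({e.image φ, f.image φ} : Finset (Finset ℕ)) = P

/-- An `r`-pattern: an ordered `r`-matching of size `2` (on `{1,…,2r}`). -/
def IsPattern (r : ℕ) (P : Finset (Finset ℕ)) : Prop :=
  IsOrderedMatching r 2 P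

/-- A collection of edges in which every pair of distinct edges forms `P`. -/
def IsPatternClique (P S : Finset (Finset ℕ)) : Prop :=
  ∀ e ∈ S, ∀ f ∈ S, e ≠ f → FormsPattern e f P

/-- `L_P(M)`: the maximum size of a sub-matching of `M` which is a `P`-clique. -/
noncomputable def cliqueSize (P M : Finset (Finset ℕ)) : ℕ :=
  sSup {k | ∃ S ⊆ M, IsPatternClique P S ∧ S.card = k}

/-- `L(M) = max_P L_P(M)`, the maximum over all `r`-patterns `P`. -/
noncomputable def Lmax (r : ℕ) (M : Finset (Finset ℕ)) : ℕ :=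
  sSup {k | ∃ P, IsPattern r P ∧ cliqueSize P M = k}

/-- The number of ordered `r`-matchings of size `n` (on `{1,…,r*n}`). -/
noncomputable def totalMatchings (r n : ℕ) : ℕ :=
  Nat.card {M : Finset (Finset ℕ) // IsOrderedMatching r n M}

/-- The number of ordered `r`-matchings `M` of size `n` for which
`L_P(M)/n^(1/r)` deviates from `b` by at least `ε`. -/
noncomputable def deviantMatchings (r : ℕ) (P : Finset (Finset ℕ)) (b ε : ℝ) (n : ℕ) : ℕ :=
  Nat.card {M : Finset (Finset ℕ) // IsOrderedMatching r n M ∧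
    ε ≤ |(cliqueSize P M : ℝ) / (n : ℝ) ^ ((1 : ℝ) / (r : ℝ)) - b|}

/-- For a uniformly random ordered `r`-matching `M_n` of size `n`, the random
variable `L_P(M_n)/n^(1/r)` converges in probability to `b` as `n → ∞`: for
every `ε > 0`, the proportion of ordered `r`-matchings of size `n` with
`|L_P(M)/n^(1/r) - b| ≥ ε` tends to `0`. -/
def CliqueSizeConvergesTo (r : ℕ) (P : Finset (Finset ℕ)) (b : ℝ) : Prop :=
  ∀ ε : ℝ, 0 < ε →
    Filter.Tendsto (fun n => (deviantMatchings r P b ε n : ℝ) / (totalMatchings r n : ℝ))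
      Filter.atTop (nhds 0)

/-- An `r`-pattern `P` is collectable if there exist `P`-cliques of every
size. -/
def IsCollectable (r : ℕ) (P : Finset (Finset ℕ)) : Prop :=
  ∀ m : ℕ, ∃ M, IsOrderedMatching r m M ∧ IsPatternClique P M

/-- `c : ℕ → ℕ` (restricted to `{0,…,ℓ}`) lists the cut points of a block
partition of the `r`-pattern `P`: the blocks are the intervals
`(c i, c (i+1)]`, each consisting of a run of `d` vertices of one edge of `P`
followed by a run of `d` vertices of the other edge. -/
def IsBlockPartition (r : ℕ) (P : Finset (Finset ℕ)) (ℓ : ℕ) (c : ℕ → ℕ) : Prop :=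
  1 ≤ ℓ ∧ c 0 = 0 ∧ c ℓ = 2 * r ∧ (∀ i < ℓ, c i < c (i + 1)) ∧
    ∃ A B : Finset ℕ, A ≠ B ∧ P = {A, B} ∧
      ∀ i < ℓ, ∃ d : ℕ, 1 ≤ d ∧ c (i + 1) = c i + 2 * d ∧
        (((∀ x, c i < x → x ≤ c i + d → x ∈ A) ∧
            (∀ x, c i + d < x → x ≤ c (i + 1) → x ∈ B)) ∨
          ((∀ x, c i < x → x ≤ c i + d → x ∈ B) ∧
            (∀ x, c i + d < x → x ≤ c (i + 1) → x ∈ A)))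

/-- Two `r`-patterns have the same type: they admit block partitions whose
multisets of half-block-sizes (partitions of `r`) coincide. -/
def SameType (r : ℕ) (P Q : Finset (Finset ℕ)) : Prop :=
  ∃ ℓ : ℕ, ∃ c c' : ℕ → ℕ, IsBlockPartition r P ℓ c ∧ IsBlockPartition r Q ℓ c' ∧
    Multiset.map (fun i => (c (i + 1) - c i) / 2) (Multiset.range ℓ) =
      Multiset.map (fun i => (c' (i + 1) - c' i) / 2) (Multiset.range ℓ)

namespace RandomMatching
open Finset

/-- The expectation of `φ` when the coordinates are independent with weights `μ`. -/
noncomputable def Ex {ι E : Type*} [Fintype ι] [DecidableEq ι] [Fintype E]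
    (μ : E → ℝ) (φ : (ι → E) → ℝ) : ℝ :=
  ∑ x : ι → E, (∏ i, μ (x i)) * φ x

/-- `μ` is a probability weight on a finite type. -/
structure IsProb {E : Type*} [Fintype E] (μ : E → ℝ) : Prop where
  nonneg : ∀ e, 0 ≤ μ e
  sum_eq_one : ∑ e, μ e = 1

open Classical in
/-- The probability of `A` when the coordinates are independent with weights `μ`. -/
noncomputable def Pr {ι E : Type*} [Fintype ι] [DecidableEq ι] [Fintype E]
    (μ : E → ℝ) (A : (ι → E) → Prop) : ℝ :=
  Ex μ (fun x => if A x then 1 else 0)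

theorem IsProb.prod_nonneg {ι E : Type*} [Fintype ι] [Fintype E] {μ : E → ℝ}
    (hμ : IsProb μ) (x : ι → E) : 0 ≤ ∏ i, μ (x i) :=
  Finset.prod_nonneg fun i _ => hμ.nonneg (x i)

section Expectation
variable {ι κ E F : Type*} [Fintype ι] [DecidableEq ι] [Fintype κ] [DecidableEq κ]
  [Fintype E] [Fintype F] {μ : E → ℝ} {ν : F → ℝ}

theorem Ex_add (φ ψ : (ι → E) → ℝ) : Ex μ (fun x => φ x + ψ x) = Ex μ φ + Ex μ ψ := by
  simp [Ex, mul_add, sum_add_distrib]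

theorem Ex_sub (φ ψ : (ι → E) → ℝ) : Ex μ (fun x => φ x - ψ x) = Ex μ φ - Ex μ ψ := by
  simp [Ex, mul_sub, sum_sub_distrib]

theorem Ex_const_mul (c : ℝ) (φ : (ι → E) → ℝ) : Ex μ (fun x => c * φ x) = c * Ex μ φ := by
  simp only [Ex, mul_sum]
  exact sum_congr rfl fun x _ => by ring

theorem Ex_sum {α : Type*} (s : Finset α) (φ : α → (ι → E) → ℝ) :
    Ex μ (fun x => ∑ a ∈ s, φ a x) = ∑ a ∈ s, Ex μ (φ a) := by
  simp only [Ex, mul_sum]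
  exact sum_comm

theorem IsProb.sum_prod_eq_one (hμ : IsProb μ) : ∑ x : ι → E, ∏ i, μ (x i) = 1 := by
  rw [← Fintype.piFinset_univ, Finset.sum_prod_piFinset]
  simp [hμ.sum_eq_one]

theorem Ex_const (hμ : IsProb μ) (c : ℝ) : Ex μ (fun _ : ι → E => c) = c := by
  simp [Ex, ← sum_mul, hμ.sum_prod_eq_one]

theorem Ex_mono (hμ : IsProb μ) {φ ψ : (ι → E) → ℝ} (h : ∀ x, φ x ≤ ψ x) : Ex μ φ ≤ Ex μ ψ :=
  sum_le_sum fun x _ => mul_le_mul_of_nonneg_left (h x) (hμ.prod_nonneg x)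

theorem Ex_nonneg (hμ : IsProb μ) {φ : (ι → E) → ℝ} (h : ∀ x, 0 ≤ φ x) : 0 ≤ Ex μ φ :=
  sum_nonneg fun x _ => mul_nonneg (hμ.prod_nonneg x) (h x)

theorem Pr_mono (hμ : IsProb μ) {A B : (ι → E) → Prop} (h : ∀ x, A x → B x) :
    Pr μ A ≤ Pr μ B := by
  refine Ex_mono hμ fun x => ?_
  by_cases hA : A x
  · simp [hA, h x hA]
  · simp only [hA, if_false]; split_ifs <;> norm_num

theorem Pr_le_one (hμ : IsProb μ) (A : (ι → E) → Prop) : Pr μ A ≤ 1 := by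
  rw [← Ex_const (ι := ι) hμ 1]
  exact Ex_mono hμ fun x => by split_ifs <;> norm_num

theorem Pr_exists_le (hμ : IsProb μ) {α : Type*} (s : Finset α) (A : α → (ι → E) → Prop) :
    Pr μ (fun x => ∃ a ∈ s, A a x) ≤ ∑ a ∈ s, Pr μ (A a) := by
  classical
  unfold Pr
  rw [← Ex_sum]
  refine Ex_mono hμ fun x => ?_
  have h0 : ∀ a ∈ s, (0 : ℝ) ≤ if A a x then 1 else 0 := fun a _ => by split_ifs <;> norm_num
  split_ifs with h
  · obtain ⟨a, ha, hA⟩ := h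
    refine le_trans ?_ (single_le_sum h0 ha)
    simp [hA]
  · exact sum_nonneg h0

theorem Pr_or_le (hμ : IsProb μ) (A B : (ι → E) → Prop) :
    Pr μ (fun x => A x ∨ B x) ≤ Pr μ A + Pr μ B := by
  unfold Pr
  rw [← Ex_add]
  refine Ex_mono hμ fun x => ?_
  by_cases hA : A x <;> by_cases hB : B x <;> simp [hA, hB]

theorem Pr_not (hμ : IsProb μ) (A : (ι → E) → Prop) :
    Pr μ (fun x => ¬ A x) = 1 - Pr μ A := by
  unfold Pr
  have h1 := Ex_const (ι := ι) hμ 1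
  rw [eq_sub_iff_add_eq, ← Ex_add]
  refine Eq.trans ?_ h1
  congr 1
  funext x
  by_cases hA : A x
  · simp only [hA, not_true, if_false, if_true, zero_add]
  · simp only [hA, not_false_iff, if_false, if_true, add_zero]

theorem chebyshev (hμ : IsProb μ) (φ : (ι → E) → ℝ) (m : ℝ) {t : ℝ} (ht : 0 < t) :
    Pr μ (fun x => t ≤ |φ x - m|) ≤ Ex μ (fun x => (φ x - m) ^ 2) / t ^ 2 := by
  rw [le_div_iff₀ (by positivity), mul_comm]
  unfold Pr
  rw [← Ex_const_mul]
  refine Ex_mono hμ fun x => ?_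
  split_ifs with h
  · rw [mul_one, ← sq_abs (φ x - m)]
    gcongr
  · simp only [mul_zero]; positivity

/-- Change of variables along a coordinatewise map. -/
theorem Ex_map [DecidableEq F] (h : E → F)
    (hν : ∀ y, ∑ e with h e = y, μ e = ν y) (φ : (ι → F) → ℝ) :
    Ex μ (fun x => φ (h ∘ x)) = Ex ν φ := by
  classical
  unfold Ex
  rw [← sum_fiberwise_of_maps_to (s := univ) (t := univ) (g := fun x : ι → E => h ∘ x)
    (fun _ _ => mem_univ _)]
  refine sum_congr rfl fun y _ => ?_
  have : (univ.filter fun x : ι → E => h ∘ x = y)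
      = Fintype.piFinset fun i => univ.filter fun e => h e = y i := by
    ext x; simp [funext_iff]
  rw [this, sum_congr rfl (g := fun x => (∏ i, μ (x i)) * φ y), ← sum_mul,
    ← prod_univ_sum (fun i => univ.filter fun e => h e = y i) fun _ e => μ e]
  · simp [hν]
  · intro x hx
    rw [← this] at hx
    simp only [mem_filter, mem_univ, true_and] at hx
    simp only [hx]

/-- Marginals of a product weight. -/
theorem Ex_comp_injective (hμ : IsProb μ) {j : κ → ι} (hj : Function.Injective j)
    (φ : (κ → E) → ℝ) : Ex μ (fun x : ι → E => φ (x ∘ j)) = Ex μ φ := by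
  classical
  unfold Ex
  rw [← sum_fiberwise_of_maps_to (s := univ) (t := univ) (g := fun x : ι → E => x ∘ j)
    (fun _ _ => mem_univ _)]
  refine sum_congr rfl fun y _ => ?_
  have : (univ.filter fun x : ι → E => x ∘ j = y)
      = Fintype.piFinset fun i => univ.filter fun e => ∀ k, j k = i → e = y k := by
    ext x
    simp only [mem_filter, mem_univ, true_and, funext_iff, Fintype.mem_piFinset,
      Function.comp_apply]
    exact ⟨fun h i k hk => hk ▸ h k, fun h k => h _ k rfl⟩
  rw [this, sum_congr rfl (g := fun x => (∏ i, μ (x i)) * φ y), ← sum_mul,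
    ← prod_univ_sum (fun i => univ.filter fun e => ∀ k, j k = i → e = y k) fun _ e => μ e]
  · congr 1
    rw [← Finset.prod_subset (s₁ := univ.image j) (subset_univ _),
      prod_image (fun a _ b _ h => hj h)]
    · refine prod_congr rfl fun k _ => ?_
      rw [sum_eq_single_of_mem (y k)]
      · simp only [mem_filter, mem_univ, true_and]
        intro k' hk'; rw [hj hk']
      · intro b hb hne
        simp only [mem_filter, mem_univ, true_and] at hb
        exact absurd (hb k rfl) hne
    · intro i _ hi
      rw [filter_true_of_mem, hμ.sum_eq_one]
      intro e _ k hk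
      exact absurd (mem_image.2 ⟨k, mem_univ _, hk⟩) hi
  · intro x hx
    rw [← this] at hx
    simp only [mem_filter, mem_univ, true_and] at hx
    simp only [hx]

theorem Ex_prod (φ : (ι → E × F) → ℝ) :
    Ex (fun z : E × F => μ z.1 * ν z.2) φ
      = Ex μ (fun t => Ex ν fun y => φ fun i => (t i, y i)) := by
  unfold Ex
  rw [← (Equiv.arrowProdEquivProdArrow ι (fun _ => E) (fun _ => F)).symm.sum_comp,
    Fintype.sum_prod_type]
  refine sum_congr rfl fun t _ => ?_
  rw [mul_sum]
  refine sum_congr rfl fun y _ => ?_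
  simp [Equiv.arrowProdEquivProdArrow, prod_mul_distrib, mul_assoc]

theorem Ex_succ {n : ℕ} (φ : (Fin (n + 1) → E) → ℝ) :
    Ex μ φ = ∑ a, μ a * Ex μ (fun y : Fin n → E => φ (Fin.cons a y)) := by
  unfold Ex
  rw [← (Fin.consEquiv fun _ => E).sum_comp, Fintype.sum_prod_type]
  refine sum_congr rfl fun a _ => ?_
  rw [mul_sum]
  refine sum_congr rfl fun y _ => ?_
  simp [Fin.consEquiv, Fin.prod_univ_succ, mul_assoc]

theorem sq_Ex_le (hμ : IsProb μ) (φ : (ι → E) → ℝ) : Ex μ φ ^ 2 ≤ Ex μ (fun x => φ x ^ 2) := by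
  have h : 0 ≤ Ex μ (fun x => (φ x - Ex μ φ) ^ 2) := Ex_nonneg hμ fun x => sq_nonneg _
  have e : (fun x => (φ x - Ex μ φ) ^ 2)
      = fun x => φ x ^ 2 - 2 * Ex μ φ * φ x + Ex μ φ ^ 2 := by
    funext x; ring
  rw [e, Ex_add, Ex_sub, Ex_const_mul, Ex_const hμ] at h
  nlinarith

theorem Ex_sq_sub (hμ : IsProb μ) (φ : (ι → E) → ℝ) (m : ℝ) :
    Ex μ (fun x => (φ x - m) ^ 2) = Ex μ (fun x => φ x ^ 2) - 2 * m * Ex μ φ + m ^ 2 := by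
  have e : (fun x => (φ x - m) ^ 2) = fun x => φ x ^ 2 - 2 * m * φ x + m ^ 2 := by
    funext x; ring
  rw [e, Ex_add, Ex_sub, Ex_const_mul, Ex_const hμ]

/-- The Efron–Stein inequality: the variance is at most the sum of the mean square distances
to functions `ψ i` that do not depend on the coordinate `i`. -/
theorem efron_stein (hμ : IsProb μ) {n : ℕ} (φ : (Fin n → E) → ℝ) (ψ : Fin n → (Fin n → E) → ℝ)
    (hψ : ∀ i x a, ψ i (Function.update x i a) = ψ i x) :
    Ex μ (fun x => φ x ^ 2) - Ex μ φ ^ 2 ≤ ∑ i, Ex μ (fun x => (φ x - ψ i x) ^ 2) := by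
  induction n with
  | zero => simp [Ex]
  | succ n ih =>
    have h0 : ∀ a a' (y : Fin n → E), ψ 0 (Fin.cons a y) = ψ 0 (Fin.cons a' y) := by
      intro a a' y
      rw [← hψ 0 (Fin.cons a' y) a, Fin.update_cons_zero]
    obtain ⟨e0⟩ : Nonempty E := by
      by_contra h
      rw [not_nonempty_iff] at h
      simpa using hμ.sum_eq_one
    set g : E → ℝ := fun a => Ex μ (fun y : Fin n → E => φ (Fin.cons a y)) with hg
    set m : ℝ := Ex μ (fun y : Fin n → E => ψ 0 (Fin.cons e0 y)) with hm
    have hS : ∀ a, Ex μ (fun y : Fin n → E => φ (Fin.cons a y) ^ 2) - g a ^ 2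
        ≤ ∑ i : Fin n, Ex μ (fun y : Fin n → E => (φ (Fin.cons a y) - ψ i.succ (Fin.cons a y)) ^ 2) := by
      intro a
      refine ih (fun y => φ (Fin.cons a y)) (fun i y => ψ i.succ (Fin.cons a y)) ?_
      intro i y b
      rw [Fin.cons_update, hψ]
    have hF : ∀ a, (g a - m) ^ 2
        ≤ Ex μ (fun y : Fin n → E => (φ (Fin.cons a y) - ψ 0 (Fin.cons a y)) ^ 2) := by
      intro a
      rw [hg, hm, ← Ex_sub]
      refine (sq_Ex_le hμ _).trans (le_of_eq ?_)
      congr 1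
      funext y
      rw [h0 a e0 y]
    have hsum : (∑ a, μ a * g a) ^ 2 ≥ ∑ a, μ a * g a ^ 2 - ∑ a, μ a * (g a - m) ^ 2 := by
      have e : ∑ a, μ a * (g a - m) ^ 2
          = ∑ a, μ a * g a ^ 2 - 2 * m * ∑ a, μ a * g a + m ^ 2 := by
        have : ∀ a, μ a * (g a - m) ^ 2
            = μ a * g a ^ 2 - 2 * m * (μ a * g a) + m ^ 2 * μ a := fun a => by ring
        simp_rw [this]
        rw [sum_add_distrib, sum_sub_distrib, ← mul_sum, ← mul_sum, hμ.sum_eq_one, mul_one]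
      nlinarith [sq_nonneg (∑ a, μ a * g a - m)]
    rw [Fin.sum_univ_succ]
    simp only [Ex_succ]
    have h1 : ∑ a, μ a * (Ex μ (fun y : Fin n → E => φ (Fin.cons a y) ^ 2) - g a ^ 2)
        ≤ ∑ i : Fin n, ∑ a, μ a * Ex μ (fun y : Fin n → E =>
          (φ (Fin.cons a y) - ψ i.succ (Fin.cons a y)) ^ 2) := by
      rw [sum_comm]
      refine sum_le_sum fun a _ => ?_
      rw [← mul_sum]
      exact mul_le_mul_of_nonneg_left (hS a) (hμ.nonneg a)
    have h2 : ∑ a, μ a * (g a - m) ^ 2 ≤ ∑ a, μ a * Ex μ (fun y : Fin n → E =>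
        (φ (Fin.cons a y) - ψ 0 (Fin.cons a y)) ^ 2) :=
      sum_le_sum fun a _ => mul_le_mul_of_nonneg_left (hF a) (hμ.nonneg a)
    simp only [mul_sub, sum_sub_distrib] at h1
    change _ - (∑ a, μ a * g a) ^ 2 ≤ _
    linarith

end Expectation
end RandomMatching

namespace RandomMatching
open Finset

/-- The points `x i` with `i ∈ S` are pairwise related by `R`. -/
def PairRel {ι E : Type*} (R : E → E → Prop) (x : ι → E) (S : Finset ι) : Prop :=
  ∀ i ∈ S, ∀ j ∈ S, i ≠ j → R (x i) (x j)

open Classical in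
/-- The largest size of a subset of `T` on which the points `x i` are pairwise related by `R`. -/
noncomputable def cl {ι E : Type*} (R : E → E → Prop) (T : Finset ι) (x : ι → E) : ℕ :=
  (T.powerset.filter (PairRel R x)).sup card

section Clique
variable {ι κ E F : Type*} {R : E → E → Prop} {T : Finset ι} {x : ι → E}

theorem le_cl {S : Finset ι} (hS : S ⊆ T) (h : PairRel R x S) :
    S.card ≤ cl R T x := by
  classical
  exact le_sup (f := card) (mem_filter.2 ⟨mem_powerset.2 hS, h⟩)

theorem exists_cl (R : E → E → Prop) (T : Finset ι) (x : ι → E) :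
    ∃ S ⊆ T, PairRel R x S ∧ S.card = cl R T x := by
  classical
  obtain ⟨S, hS, h⟩ := exists_mem_eq_sup
    (T.powerset.filter (PairRel R x)) ⟨∅, by simp [PairRel]⟩ card
  rw [mem_filter, mem_powerset] at hS
  exact ⟨S, hS.1, hS.2, h.symm⟩

theorem cl_le_card : cl R T x ≤ T.card := by
  obtain ⟨S, hS, -, h⟩ := exists_cl R T x
  exact h ▸ card_le_card hS

theorem cl_mono {R' : F → F → Prop} {T' : Finset ι} {x' : ι → F} (hT : T ⊆ T')
    (h : ∀ i ∈ T, ∀ j ∈ T, i ≠ j → R (x i) (x j) → R' (x' i) (x' j)) :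
    cl R T x ≤ cl R' T' x' := by
  obtain ⟨S, hS, hR, hc⟩ := exists_cl R T x
  exact hc ▸ le_cl (hS.trans hT) fun i hi j hj hij => h i (hS hi) j (hS hj) hij (hR i hi j hj hij)

theorem cl_congr {x' : ι → E} (h : ∀ i ∈ T, x i = x' i) : cl R T x = cl R T x' := by
  apply le_antisymm <;> refine cl_mono subset_rfl fun i hi j hj _ hR => ?_
  · rwa [← h i hi, ← h j hj]
  · rwa [h i hi, h j hj]

theorem cl_map (j : κ ↪ ι) (T : Finset κ) : cl R (T.map j) x = cl R T (x ∘ j) := by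
  classical
  apply le_antisymm
  · obtain ⟨S, hS, hR, hc⟩ := exists_cl R (T.map j) x
    obtain ⟨U, hU, rfl⟩ := subset_map_iff.1 hS
    rw [← hc, card_map]
    refine le_cl hU fun a ha b hb hab => ?_
    exact hR _ (mem_map_of_mem _ ha) _ (mem_map_of_mem _ hb) (j.injective.ne hab)
  · obtain ⟨S, hS, hR, hc⟩ := exists_cl R T (x ∘ j)
    rw [← hc, ← card_map j]
    refine le_cl (map_subset_map.2 hS) ?_
    intro a' ha' b' hb' hab
    obtain ⟨a, ha, rfl⟩ := mem_map.1 ha'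
    obtain ⟨b, hb, rfl⟩ := mem_map.1 hb'
    exact hR a ha b hb fun h => hab (h ▸ rfl)

theorem cl_le_erase_add_one [DecidableEq ι] (i : ι) : cl R T x ≤ cl R (T.erase i) x + 1 := by
  obtain ⟨S, hS, hR, hc⟩ := exists_cl R T x
  rw [← hc]
  refine (Nat.sub_le_iff_le_add.1 (pred_card_le_card_erase (a := i))).trans
    (Nat.add_le_add_right (le_cl (S := S.erase i) ?_ ?_) 1)
  · exact erase_subset_erase i hS
  · exact fun a ha b hb => hR a (mem_of_mem_erase ha) b (mem_of_mem_erase hb)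

theorem sum_sq_cl_sub_erase_le [Fintype ι] [DecidableEq ι] (R : E → E → Prop) (x : ι → E) :
    ∑ i, ((cl R univ x : ℝ) - cl R (univ.erase i) x) ^ 2 ≤ cl R univ x := by
  obtain ⟨S, hS, hR, hc⟩ := exists_cl R univ x
  calc ∑ i, ((cl R univ x : ℝ) - cl R (univ.erase i) x) ^ 2
      ≤ ∑ i, if i ∈ S then (1 : ℝ) else 0 := by
        refine sum_le_sum fun i _ => ?_
        have h1 : cl R (univ.erase i) x ≤ cl R univ x := cl_mono (erase_subset _ _) (by simp)
        have h2 : cl R univ x ≤ cl R (univ.erase i) x + 1 := cl_le_erase_add_one i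
        split_ifs with hi
        · have h1' : (cl R (univ.erase i) x : ℝ) ≤ cl R univ x := by exact_mod_cast h1
          have h2' : (cl R univ x : ℝ) ≤ cl R (univ.erase i) x + 1 := by exact_mod_cast h2
          nlinarith
        · have h3 : S.card ≤ cl R (univ.erase i) x :=
            le_cl (fun j hj => mem_erase.2 ⟨fun h => hi (h ▸ hj), mem_univ _⟩) hR
          rw [le_antisymm h1 (hc ▸ h3)]
          simp
    _ = cl R univ x := by rw [← hc]; simp

variable [Fintype E] {μ : E → ℝ}

theorem variance_cl_le (hμ : IsProb μ) (R : E → E → Prop) (n : ℕ) :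
    Ex μ (fun x : Fin n → E => ((cl R univ x : ℝ) - Ex μ (fun x : Fin n → E => (cl R univ x : ℝ))) ^ 2)
      ≤ Ex μ (fun x : Fin n → E => (cl R univ x : ℝ)) := by
  have h := efron_stein hμ (fun x : Fin n → E => (cl R univ x : ℝ))
    (fun i x => (cl R (univ.erase i) x : ℝ)) (by
      intro i x a
      rw [cl_congr]
      intro j hj
      rw [Function.update_of_ne (ne_of_mem_erase hj)])
  rw [← Ex_sum] at h
  rw [Ex_sq_sub hμ]
  have := h.trans (Ex_mono hμ fun x => sum_sq_cl_sub_erase_le R x)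
  nlinarith

theorem cl_deviation (hμ : IsProb μ) (R : E → E → Prop) (n : ℕ) {t : ℝ} (ht : 0 < t) :
    Pr μ (fun x : Fin n → E =>
      t ≤ |(cl R univ x : ℝ) - Ex μ (fun x : Fin n → E => (cl R univ x : ℝ))|)
      ≤ Ex μ (fun x : Fin n → E => (cl R univ x : ℝ)) / t ^ 2 :=
  (chebyshev hμ _ _ ht).trans
    (div_le_div_of_nonneg_right (variance_cl_le hμ R n) (by positivity))

end Clique

/-- The uniform weight. -/
noncomputable def unif (E : Type*) [Fintype E] : E → ℝ := fun _ => (Fintype.card E : ℝ)⁻¹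

theorem unif_isProb (E : Type*) [Fintype E] [Nonempty E] : IsProb (unif E) :=
  ⟨fun _ => by unfold unif; positivity, by simp [unif]⟩

/-- The Bernoulli weight of parameter `p`. -/
noncomputable def bern (p : ℝ) : Bool → ℝ := fun b => if b then p else 1 - p

theorem bern_isProb {p : ℝ} (h0 : 0 ≤ p) (h1 : p ≤ 1) : IsProb (bern p) :=
  ⟨fun b => by cases b <;> simp [bern, h0, h1], by simp [bern]⟩

open Classical in
/-- Under `ψ`, the points in the event `G` become independent points of weight `ν`. -/
def Thins {E F : Type*} [Fintype E] (μ : E → ℝ) (ν : F → ℝ) (G : E → Prop) (ψ : E → F)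
    (p : ℝ) : Prop :=
  ∀ y, ∑ e with G e ∧ ψ e = y, μ e = p * ν y

section Thinning
variable {ι E F : Type*} [Fintype ι] [DecidableEq ι] [Fintype E] [Fintype F]
  {μ : E → ℝ} {ν : F → ℝ} {G : E → Prop} {ψ : E → F} {p : ℝ}

open Classical in
theorem Thins.eq_sum (hν : IsProb ν) (h : Thins μ ν G ψ p) : p = ∑ e with G e, μ e := by
  have : ∑ y, ∑ e with G e ∧ ψ e = y, μ e = p := by
    rw [sum_congr rfl fun y _ => h y, ← mul_sum, hν.sum_eq_one, mul_one]
  rw [← this, ← sum_fiberwise (univ.filter G) ψ]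
  simp only [filter_filter]

theorem Thins.nonneg (hμ : IsProb μ) (hν : IsProb ν) (h : Thins μ ν G ψ p) : 0 ≤ p := by
  classical
  rw [h.eq_sum hν]
  exact sum_nonneg fun e _ => hμ.nonneg e

theorem Thins.le_one (hμ : IsProb μ) (hν : IsProb ν) (h : Thins μ ν G ψ p) : p ≤ 1 := by
  classical
  rw [h.eq_sum hν, ← hμ.sum_eq_one]
  exact sum_le_sum_of_subset_of_nonneg (filter_subset _ _) fun e _ _ => hμ.nonneg e

open Classical in
theorem Thins.Ex_eq (hμ : IsProb μ) (hν : IsProb ν) (h : Thins μ ν G ψ p)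
    (Φ : Finset ι → (ι → F) → ℝ)
    (hΦ : ∀ T y y', (∀ i ∈ T, y i = y' i) → Φ T y = Φ T y') :
    Ex μ (fun x : ι → E => Φ (univ.filter fun i => G (x i)) (ψ ∘ x))
      = Ex (bern p) (fun t : ι → Bool => Ex ν fun y => Φ (univ.filter fun i => t i = true) y) := by
  obtain ⟨y0⟩ : Nonempty F := by
    by_contra h
    rw [not_nonempty_iff] at h
    simpa using hν.sum_eq_one
  let ν' : Option F → ℝ := fun o => o.elim (1 - p) fun y => p * ν y
  let Ψ : (ι → Option F) → ℝ := fun z =>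
    Φ (univ.filter fun i => (z i).isSome) (fun i => (z i).getD y0)
  have e1 := Ex_map (ι := ι) (μ := μ) (ν := ν') (fun e => if G e then some (ψ e) else none) (by
    rintro (_ | y)
    · have : ∀ e, (if G e then some (ψ e) else none) = none ↔ ¬ G e := by
        intro e; split_ifs <;> simp [*]
      simp only [this, ν', Option.elim]
      rw [h.eq_sum hν, ← hμ.sum_eq_one, ← sum_filter_add_sum_filter_not univ G]
      ring
    · have : ∀ e, (if G e then some (ψ e) else none) = some y ↔ G e ∧ ψ e = y := by
        intro e; split_ifs <;> simp [*]
      simp only [this, ν', Option.elim]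
      exact h y) Ψ
  have e2 := Ex_map (ι := ι) (μ := fun z : Bool × F => bern p z.1 * ν z.2) (ν := ν')
    (fun z => if z.1 then some z.2 else none) (by
    rintro (_ | y)
    · rw [sum_filter, Fintype.sum_prod_type]
      simp [ν', bern, ← mul_sum, hν.sum_eq_one]
    · rw [sum_filter, Fintype.sum_prod_type]
      simp [ν', bern]) Ψ
  rw [← e2, Ex_prod] at e1
  convert e1 using 2 with x
  · funext x
    have : (univ.filter fun i => G (x i)) = univ.filter fun i =>
        (((fun e => if G e then some (ψ e) else none) ∘ x) i).isSome := by
      ext i; simp only [mem_filter, mem_univ, true_and, Function.comp]; split_ifs <;> simp [*]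
    simp only [Ψ]
    rw [← this]
    refine hΦ _ _ _ fun i hi => ?_
    simp only [mem_filter, mem_univ, true_and] at hi
    simp [hi]
  · funext t
    congr 1
    funext y
    have : (univ.filter fun i => t i = true) = univ.filter fun i =>
        (((fun z : Bool × F => if z.1 then some z.2 else none) ∘ fun i => (t i, y i)) i).isSome := by
      ext i; simp only [mem_filter, mem_univ, true_and, Function.comp]; split_ifs <;> simp [*]
    simp only [Ψ]
    rw [← this]
    refine hΦ _ _ _ fun i hi => ?_
    simp only [mem_filter, mem_univ, true_and] at hi
    simp [hi]

/-- Concentration of a binomial variable. -/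
theorem binomial_deviation {p : ℝ} (h0 : 0 ≤ p) (h1 : p ≤ 1) (n : ℕ) {t : ℝ} (ht : 0 < t) :
    Pr (bern p) (fun b : Fin n → Bool =>
      t ≤ |((univ.filter fun i => b i = true).card : ℝ) - n * p|) ≤ n * p / t ^ 2 := by
  have hb := bern_isProb h0 h1
  set φ : (Fin n → Bool) → ℝ := fun b => ((univ.filter fun i => b i = true).card : ℝ) with hφ
  have hone : ∀ i : Fin n, Ex (bern p) (fun b : Fin n → Bool => if b i = true then (1 : ℝ) else 0)
      = p := by
    intro i
    have := Ex_comp_injective (κ := Fin 1) (j := fun _ => i) hb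
      (Function.injective_of_subsingleton _) (fun b => if b 0 = true then (1 : ℝ) else 0)
    simp only [Function.comp] at this
    rw [this, Ex_succ]
    simp [Ex, bern]
  have hφs : φ = fun b => ∑ i, if b i = true then (1 : ℝ) else 0 := by
    funext b; simp [hφ]
  have hmean : Ex (bern p) φ = n * p := by
    rw [hφs, Ex_sum]; simp [hone]
  have hvar := efron_stein hb φ (fun i b => φ b - if b i = true then (1 : ℝ) else 0) (by
    intro i b a
    simp only [hφs]
    rw [← add_sum_erase _ _ (mem_univ i), ← add_sum_erase (a := i) univ
      (fun j => if b j = true then (1 : ℝ) else 0) (mem_univ i)]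
    simp only [add_sub_cancel_left]
    refine sum_congr rfl fun j hj => ?_
    rw [Function.update_of_ne (ne_of_mem_erase hj)])
  have hs : ∀ i : Fin n, Ex (bern p) (fun b => (φ b - (φ b - if b i = true then (1 : ℝ) else 0)) ^ 2)
      = p := by
    intro i
    refine Eq.trans ?_ (hone i)
    congr 1
    funext b
    split_ifs <;> ring
  rw [sum_congr rfl fun i _ => hs i] at hvar
  refine (chebyshev hb φ (n * p) ht).trans (div_le_div_of_nonneg_right ?_ (by positivity))
  rw [Ex_sq_sub hb, hmean]
  rw [hmean] at hvar
  simp at hvar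
  nlinarith

end Thinning
end RandomMatching

namespace RandomMatching
open Finset

section General
variable {ι κ E F : Type*} [Fintype ι] [DecidableEq ι] [Fintype κ] [DecidableEq κ]
  [Fintype E] [Fintype F] {μ : E → ℝ} {ν : F → ℝ} {G : E → Prop} {ψ : E → F} {p : ℝ}

theorem Pr_comp_injective (hμ : IsProb μ) {j : κ → ι} (hj : Function.Injective j)
    (A : (κ → E) → Prop) : Pr μ (fun x : ι → E => A (x ∘ j)) = Pr μ A :=
  Ex_comp_injective hμ hj fun y => open Classical in if A y then (1 : ℝ) else 0

theorem sum_unif_pi (φ : (ι → E) → ℝ) : ∑ u, unif (ι → E) u * φ u = Ex (unif E) φ := by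
  simp [Ex, unif]

theorem Ex_cl_subset_ge (hν : IsProb ν) (R : F → F → Prop) {m : ℕ} {T : Finset ι}
    (hT : m ≤ T.card) :
    Ex ν (fun y : Fin m → F => (cl R univ y : ℝ)) ≤ Ex ν (fun y : ι → F => (cl R T y : ℝ)) := by
  let j : Fin m ↪ ι := (Fin.castLEEmb hT).trans
    (T.equivFin.symm.toEmbedding.trans (Function.Embedding.subtype _))
  rw [← Ex_comp_injective hν j.injective]
  refine Ex_mono hν fun y => ?_
  rw [Nat.cast_le, ← cl_map]
  refine cl_mono ?_ (by simp)
  intro i hi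
  obtain ⟨a, -, rfl⟩ := mem_map.1 hi
  exact (T.equivFin.symm _).2

open Classical in
theorem Thins.Ex_cl_ge (hμ : IsProb μ) (hν : IsProb ν) (h : Thins μ ν G ψ p)
    (R : F → F → Prop) (m : ℕ) :
    Pr (bern p) (fun t : ι → Bool => m ≤ (univ.filter fun i => t i = true).card)
        * Ex ν (fun y : Fin m → F => (cl R univ y : ℝ))
      ≤ Ex μ (fun x : ι → E => (cl R (univ.filter fun i => G (x i)) (ψ ∘ x) : ℝ)) := by
  have hb := bern_isProb (h.nonneg hμ hν) (h.le_one hμ hν)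
  rw [h.Ex_eq hμ hν (fun T y => (cl R T y : ℝ)) fun T y y' hy => by rw [cl_congr hy], Pr,
    mul_comm, ← Ex_const_mul]
  refine Ex_mono hb fun t => ?_
  split_ifs with ht
  · rw [mul_one]
    exact Ex_cl_subset_ge hν R ht
  · rw [mul_zero]
    exact Ex_nonneg hν fun y => Nat.cast_nonneg _

theorem binomial_ge {p : ℝ} (h0 : 0 ≤ p) (h1 : p ≤ 1) (n m : ℕ) (hm : (m : ℝ) < n * p) :
    1 - n * p / (n * p - m) ^ 2 ≤
      Pr (bern p) (fun t : Fin n → Bool => m ≤ (univ.filter fun i => t i = true).card) := by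
  have hb := bern_isProb h0 h1
  have h := binomial_deviation h0 h1 n (t := n * p - m) (by linarith)
  have h2 : Pr (bern p) (fun t : Fin n → Bool =>
      ¬ m ≤ (univ.filter fun i => t i = true).card) ≤ n * p / (n * p - m) ^ 2 := by
    refine (Pr_mono hb fun t ht => ?_).trans h
    rw [not_le] at ht
    have : ((univ.filter fun i => t i = true).card : ℝ) ≤ m := by exact_mod_cast ht.le
    rw [abs_sub_comm]
    exact le_trans (by linarith) (le_abs_self _)
  rw [Pr_not hb] at h2
  linarith

open Classical in
theorem thins_unif [Nonempty E] [Nonempty F] {q : ℕ}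
    (h : ∀ y, (univ.filter fun e => G e ∧ ψ e = y).card = q) :
    Thins (unif E) (unif F) G ψ (q * Fintype.card F / Fintype.card E) := by
  intro y
  simp only [unif, sum_const, h, nsmul_eq_mul]
  have : (Fintype.card F : ℝ) ≠ 0 := by positivity
  field_simp

end General

theorem card_filter_divNat {m n : ℕ} (u : Fin m) :
    (univ.filter fun z : Fin (m * n) => z.divNat = u).card = n := by
  have : (univ.filter fun z : Fin (m * n) => z.divNat = u)
      = univ.map ⟨fun v : Fin n => finProdFinEquiv (u, v), fun v w h => by simpa using h⟩ := by
    ext z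
    obtain ⟨⟨a, b⟩, rfl⟩ := finProdFinEquiv.surjective z
    have h1 : (finProdFinEquiv (a, b)).divNat = a :=
      congrArg Prod.fst (finProdFinEquiv.symm_apply_apply (a, b))
    simp only [mem_filter, mem_univ, true_and, h1, mem_map]
    constructor
    · rintro rfl
      exact ⟨b, rfl⟩
    · rintro ⟨v, hv⟩
      exact (congrArg Prod.fst (finProdFinEquiv.injective hv)).symm
  rw [this, card_map, card_univ, Fintype.card_fin]

section Chains
variable {r : ℕ} {β : Type*} (bl : Fin r → β)

/-- Inside every block, all coordinates of one point are below all coordinates of the other,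
for the same one of the two points in all blocks. -/
def Chain {K : ℕ} (x y : Fin r → Fin K) : Prop :=
  (∀ a a', bl a = bl a' → x a < y a') ∨ (∀ a a', bl a = bl a' → y a < x a')

/-- Two different points with indices in `T` share a coordinate value. -/
def Tie {ι : Type*} {K : ℕ} (T : Finset ι) (y : ι → Fin r → Fin K) : Prop :=
  ∃ i ∈ T, ∃ j ∈ T, i ≠ j ∧ ∃ a a', y i a = y j a'

/-- The mean of the largest chain among `n` independent uniform points. -/
noncomputable def chainMean (K n : ℕ) : ℝ :=
  Ex (unif (Fin r → Fin K)) fun x : Fin n → Fin r → Fin K => (cl (Chain bl) univ x : ℝ)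

variable {bl}

theorem unif_pi_isProb {K : ℕ} (hK : 0 < K) : IsProb (unif (Fin r → Fin K)) :=
  have : Nonempty (Fin r → Fin K) := ⟨fun _ => ⟨0, hK⟩⟩
  unif_isProb _

theorem Pr_tie_le {K n : ℕ} (hK : 0 < K) :
    Pr (unif (Fin r → Fin K)) (fun y : Fin n → Fin r → Fin K => Tie univ y)
      ≤ (n : ℝ) ^ 2 * r ^ 2 / K := by
  classical
  have hp := unif_pi_isProb (r := r) hK
  have : Nonempty (Fin K) := ⟨⟨0, hK⟩⟩
  have hpair : ∀ (i j : Fin n) (a a' : Fin r), Pr (unif (Fin r → Fin K))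
      (fun y : Fin n → Fin r → Fin K => i ≠ j ∧ y i a = y j a') ≤ (K : ℝ)⁻¹ := by
    intro i j a a'
    by_cases hij : i = j
    · simp only [hij, ne_eq, not_true, false_and]
      simp [Pr, Ex]
    · have hinj : Function.Injective (![i, j] : Fin 2 → Fin n) := by
        intro u v; fin_cases u <;> fin_cases v <;> simp [hij, Ne.symm hij]
      have h := Pr_comp_injective hp hinj (fun z => z 0 a = z 1 a')
      simp only [Function.comp, Matrix.cons_val_zero, Matrix.cons_val_one] at h
      simp only [ne_eq, hij, not_false_iff, true_and]
      rw [h, Pr, Ex_succ]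
      simp only [Ex_succ (n := 0)]
      have key : ∀ c : Fin K, Ex (unif (Fin K)) (fun v : Fin r → Fin K =>
          if c = v a' then (1 : ℝ) else 0) = (K : ℝ)⁻¹ := by
        intro c
        have := Ex_comp_injective (κ := Fin 1) (j := fun _ => a') (unif_isProb (Fin K))
          (Function.injective_of_subsingleton _) (fun b => if c = b 0 then (1 : ℝ) else 0)
        simp only [Function.comp] at this
        rw [this, Ex_succ]
        simp [Ex, unif]
      refine le_of_eq ?_
      calc _ = ∑ u : Fin r → Fin K, unif (Fin r → Fin K) u * (K : ℝ)⁻¹ := by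
            refine sum_congr rfl fun u _ => ?_
            congr 1
            rw [← key (u a), ← sum_unif_pi]
            refine sum_congr rfl fun v _ => ?_
            congr 1
            simp [Ex]
        _ = (K : ℝ)⁻¹ := by rw [← sum_mul, hp.sum_eq_one, one_mul]
  calc _ ≤ Pr (unif (Fin r → Fin K)) (fun y : Fin n → Fin r → Fin K =>
        ∃ q ∈ (univ : Finset ((Fin n × Fin n) × Fin r × Fin r)),
          q.1.1 ≠ q.1.2 ∧ y q.1.1 q.2.1 = y q.1.2 q.2.2) := by
        refine Pr_mono hp ?_
        rintro y ⟨i, -, j, -, hij, a, a', h⟩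
        exact ⟨((i, j), (a, a')), mem_univ _, hij, h⟩
    _ ≤ _ := Pr_exists_le hp _ _
    _ ≤ ∑ q : (Fin n × Fin n) × Fin r × Fin r, (K : ℝ)⁻¹ :=
        sum_le_sum fun q _ => hpair _ _ _ _
    _ = _ := by
        simp only [sum_const, card_univ, Fintype.card_prod, Fintype.card_fin, nsmul_eq_mul]
        push_cast
        ring

theorem chainMean_nonneg {K n : ℕ} (hK : 0 < K) : 0 ≤ chainMean bl K n :=
  Ex_nonneg (unif_pi_isProb hK) fun _ => Nat.cast_nonneg _

theorem chainMean_le {K n : ℕ} (hK : 0 < K) : chainMean bl K n ≤ n := by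
  rw [← Ex_const (ι := Fin n) (unif_pi_isProb (r := r) hK) (n : ℝ)]
  refine Ex_mono (unif_pi_isProb hK) fun x => ?_
  exact_mod_cast (cl_le_card.trans (by simp) : cl (Chain bl) univ x ≤ n)

theorem Ex_divNat {K K' n : ℕ} (hK : 0 < K) (hK' : 0 < K')
    (φ : (Fin n → Fin r → Fin K) → ℝ) :
    Ex (unif (Fin r → Fin (K * K'))) (fun x : Fin n → Fin r → Fin (K * K') =>
        φ fun i a => (x i a).divNat)
      = Ex (unif (Fin r → Fin K)) φ := by
  classical
  refine Ex_map (fun (u : Fin r → Fin (K * K')) a => (u a).divNat) (fun y => ?_) φ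
  have : (univ.filter fun u : Fin r → Fin (K * K') => (fun a => (u a).divNat) = y)
      = Fintype.piFinset fun a => univ.filter fun z : Fin (K * K') => z.divNat = y a := by
    ext u; simp [funext_iff]
  simp only [unif, sum_const, this, Fintype.card_piFinset, card_filter_divNat]
  simp only [prod_const, card_univ, Fintype.card_fin, Fintype.card_pi, nsmul_eq_mul]
  push_cast
  rw [mul_pow]
  field_simp

theorem divNat_le_divNat {K K' : ℕ} {z w : Fin (K * K')} (h : z ≤ w) : z.divNat ≤ w.divNat := by
  rw [Fin.le_def]
  exact Nat.div_le_div_right h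

theorem lt_of_divNat_lt {K K' : ℕ} {z w : Fin (K * K')} (h : z.divNat < w.divNat) : z < w := by
  by_contra hc
  exact absurd (divNat_le_divNat (not_lt.1 hc)) (not_le.2 h)

theorem chainMean_le_mul {K K' n : ℕ} (hK : 0 < K) (hK' : 0 < K') :
    chainMean bl K n ≤ chainMean bl (K * K') n := by
  rw [chainMean, ← Ex_divNat hK hK']
  refine Ex_mono (unif_pi_isProb (Nat.mul_pos hK hK')) fun x => ?_
  rw [Nat.cast_le]
  refine cl_mono subset_rfl fun i _ j _ _ h => ?_
  exact h.imp (fun h a a' e => lt_of_divNat_lt (h a a' e))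
    (fun h a a' e => lt_of_divNat_lt (h a a' e))

theorem chainMean_mul_le {K K' n : ℕ} (hK : 0 < K) (hK' : 0 < K') :
    chainMean bl (K * K') n ≤ chainMean bl K n + n * ((n : ℝ) ^ 2 * r ^ 2 / K) := by
  classical
  refine le_trans ?_ (add_le_add_right
    (mul_le_mul_of_nonneg_left (Pr_tie_le (r := r) (n := n) hK) (Nat.cast_nonneg n)) _)
  rw [chainMean, chainMean, Pr, ← Ex_const_mul, ← Ex_divNat hK hK', ← Ex_divNat (r := r) hK hK',
    ← Ex_add]
  refine Ex_mono (unif_pi_isProb (Nat.mul_pos hK hK')) fun x => ?_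
  split_ifs with ht
  · have : (cl (Chain bl) univ x : ℝ) ≤ n := by
      exact_mod_cast (cl_le_card.trans (by simp) : cl (Chain bl) univ x ≤ n)
    have h0 : (0 : ℝ) ≤ cl (Chain bl) univ (fun i a => (x i a).divNat) := Nat.cast_nonneg _
    linarith
  · rw [mul_zero, add_zero, Nat.cast_le]
    refine cl_mono subset_rfl fun i _ j _ hij h => ?_
    have hne : ∀ a a', (x i a).divNat ≠ (x j a').divNat := fun a a' e =>
      ht ⟨i, mem_univ _, j, mem_univ _, hij, a, a', e⟩
    exact h.imp
      (fun h a a' e => lt_of_le_of_ne (divNat_le_divNat (h a a' e).le) (hne _ _))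
      (fun h a a' e => lt_of_le_of_ne (divNat_le_divNat (h a a' e).le) (hne _ _).symm)

open Classical in
theorem sum_cl_cells_le [Nonempty (Fin r)] {k K n : ℕ} (x : Fin n → Fin r → Fin (k * K)) :
    ∑ s : Fin k, cl (Chain bl) (univ.filter fun i => ∀ a, (x i a).divNat = s)
      ((fun (u : Fin r → Fin (k * K)) a => (u a).modNat) ∘ x) ≤ cl (Chain bl) univ x := by
  have hS := fun s : Fin k => exists_cl (Chain bl)
    (univ.filter fun i => ∀ a, (x i a).divNat = s) ((fun (u : Fin r → Fin (k * K)) a => (u a).modNat) ∘ x)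
  choose S hST hSR hSc using hS
  have hcell : ∀ s, ∀ i ∈ S s, ∀ a, (x i a).divNat = s := fun s i hi a =>
    (mem_filter.1 (hST s hi)).2 a
  have hdisj : ∀ s t, s ≠ t → Disjoint (S s) (S t) := by
    intro s t hst
    rw [disjoint_left]
    intro i hi hi'
    obtain ⟨a⟩ := ‹Nonempty (Fin r)›
    exact hst ((hcell s i hi a).symm.trans (hcell t i hi' a))
  have hcard : ∑ s, cl (Chain bl) (univ.filter fun i => ∀ a, (x i a).divNat = s)
      ((fun (u : Fin r → Fin (k * K)) a => (u a).modNat) ∘ x) = (univ.biUnion S).card := by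
    rw [card_biUnion fun s _ t _ h => hdisj s t h]
    exact sum_congr rfl fun s _ => (hSc s).symm
  rw [hcard]
  refine le_cl (subset_univ _) fun i hi j hj hij => ?_
  obtain ⟨s, -, hi⟩ := mem_biUnion.1 hi
  obtain ⟨t, -, hj⟩ := mem_biUnion.1 hj
  rcases lt_trichotomy s t with h | h | h
  · exact Or.inl fun a a' _ => lt_of_divNat_lt (by rwa [hcell s i hi, hcell t j hj])
  · subst h
    have hlt : ∀ z w : Fin (k * K), z.divNat = w.divNat → z.modNat < w.modNat → z < w := by
      intro z w h1 h2
      rw [Fin.lt_def] at h2 ⊢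
      have h1' : (z : ℕ) / K = w / K := congrArg Fin.val h1
      have h2' : (z : ℕ) % K < w % K := h2
      rw [← Nat.div_add_mod (z : ℕ) K, ← Nat.div_add_mod (w : ℕ) K, h1']
      omega
    exact (hSR s i hi j hj hij).imp
      (fun h a a' e => hlt _ _ (by rw [hcell s i hi, hcell s j hj]) (h a a' e))
      (fun h a a' e => hlt _ _ (by rw [hcell s i hi, hcell s j hj]) (h a a' e))
  · exact Or.inr fun a a' _ => lt_of_divNat_lt (by rwa [hcell s i hi, hcell t j hj])

theorem chainMean_superadditive [Nonempty (Fin r)] {k K n m : ℕ} (hk : 0 < k) (hK : 0 < K)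
    (hm : (m : ℝ) < n * ((k : ℝ) ^ r)⁻¹) :
    k * ((1 - n * ((k : ℝ) ^ r)⁻¹ / (n * ((k : ℝ) ^ r)⁻¹ - m) ^ 2) * chainMean bl K m)
      ≤ chainMean bl (k * K) n := by
  classical
  have hp := unif_pi_isProb (r := r) (Nat.mul_pos hk hK)
  have hp' := unif_pi_isProb (r := r) hK
  have hth : ∀ s : Fin k, Thins (unif (Fin r → Fin (k * K))) (unif (Fin r → Fin K))
      (fun u => ∀ a, (u a).divNat = s) (fun u a => (u a).modNat) ((k : ℝ) ^ r)⁻¹ := by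
    intro s
    have : Nonempty (Fin r → Fin (k * K)) := ⟨fun _ => ⟨0, Nat.mul_pos hk hK⟩⟩
    have : Nonempty (Fin r → Fin K) := ⟨fun _ => ⟨0, hK⟩⟩
    have hcard : ∀ y : Fin r → Fin K, (univ.filter fun u : Fin r → Fin (k * K) =>
        (∀ a, (u a).divNat = s) ∧ (fun a => (u a).modNat) = y).card = 1 := by
      intro y
      rw [card_eq_one]
      refine ⟨fun a => finProdFinEquiv (s, y a), ?_⟩
      ext u
      simp only [mem_filter, mem_univ, true_and, mem_singleton]
      constructor
      · rintro ⟨h1, h2⟩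
        funext a
        rw [← finProdFinEquiv.apply_symm_apply (u a)]
        congr 1
        exact Prod.ext (h1 a) (congrFun h2 a)
      · rintro rfl
        have h1 : ∀ b : Fin K, finProdFinEquiv.symm (finProdFinEquiv (s, b)) = (s, b) :=
          fun b => finProdFinEquiv.symm_apply_apply (s, b)
        exact ⟨fun a => congrArg Prod.fst (h1 (y a)), funext fun a => congrArg Prod.snd (h1 (y a))⟩
    have h := thins_unif (E := Fin r → Fin (k * K)) (F := Fin r → Fin K)
      (G := fun u => ∀ a, (u a).divNat = s) (ψ := fun u a => (u a).modNat) (q := 1)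
      fun y => by convert hcard y
    have he : ((1 : ℕ) : ℝ) * Fintype.card (Fin r → Fin K) / Fintype.card (Fin r → Fin (k * K))
        = ((k : ℝ) ^ r)⁻¹ := by
      simp only [Fintype.card_pi, Fintype.card_fin, prod_const, card_univ]
      push_cast
      rw [mul_pow]
      field_simp
    rwa [he] at h
  have hq0 := (hth ⟨0, hk⟩).nonneg hp hp'
  have hq1 := (hth ⟨0, hk⟩).le_one hp hp'
  calc _ ≤ ∑ s : Fin k, Ex (unif (Fin r → Fin (k * K))) (fun x : Fin n → Fin r → Fin (k * K) =>
        (cl (Chain bl) (univ.filter fun i => ∀ a, (x i a).divNat = s)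
          ((fun u a => (u a).modNat) ∘ x) : ℝ)) := by
        have hsum : ∀ a : ℝ, (k : ℝ) * a = ∑ _s : Fin k, a := fun a => by simp
        rw [hsum]
        refine sum_le_sum fun s _ => ?_
        have h := (hth s).Ex_cl_ge (ι := Fin n) hp hp' (Chain bl) m
        refine le_trans (le_trans ?_ h) (le_of_eq (by congr! 8))
        refine mul_le_mul_of_nonneg_right ?_ (chainMean_nonneg hK)
        refine (binomial_ge hq0 hq1 n m hm).trans (le_of_eq ?_)
        congr!
    _ ≤ chainMean bl (k * K) n := by
        rw [chainMean, ← Ex_sum]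
        refine Ex_mono hp fun x => ?_
        rw [← Nat.cast_sum, Nat.cast_le]
        exact sum_cl_cells_le x

end Chains
end RandomMatching

namespace RandomMatching
open Finset

theorem exists_enumeration {ι : Type*} (S : Finset ι) (f : ι → ℤ) (hf : Set.InjOn f S) :
    ∃ j : Fin S.card → ι, (∀ p, j p ∈ S) ∧ StrictMono (f ∘ j) := by
  classical
  have hc : (S.image f).card = S.card := card_image_of_injOn hf
  have h : ∀ p : Fin S.card, ∃ i ∈ S, f i = (S.image f).orderEmbOfFin hc p := fun p =>
    mem_image.1 (orderEmbOfFin_mem _ hc p)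
  choose j hj hj' using h
  refine ⟨j, hj, fun p q hpq => ?_⟩
  simp only [Function.comp, hj']
  exact (orderEmbOfFin _ hc).strictMono hpq

/-- The sequence is strictly increasing or strictly decreasing, according to the sign. -/
def SignMono {k N : ℕ} (s : Bool) (z : Fin k → Fin N) : Prop :=
  if s then StrictMono z else StrictAnti z

open Classical in
theorem card_signMono_le {k N : ℕ} (s : Bool) (A : Finset (Fin N)) :
    (univ.filter fun z : Fin k → Fin N => SignMono s z ∧ ∀ p, z p ∈ A).card ≤ A.card.choose k := by
  rw [← card_powersetCard]
  refine card_le_card_of_injOn (fun z => univ.image z) (fun z hz => ?_) ?_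
  · obtain ⟨-, hz, hA⟩ := mem_filter.1 hz
    have hinj : Function.Injective z := by
      unfold SignMono at hz
      split_ifs at hz
      exacts [hz.injective, hz.injective]
    rw [mem_coe, mem_powersetCard, card_image_of_injective _ hinj, card_univ, Fintype.card_fin]
    exact ⟨by simpa [image_subset_iff] using hA, rfl⟩
  · intro z hz w hw hzw
    obtain ⟨-, hz, -⟩ := mem_filter.1 hz
    obtain ⟨-, hw, -⟩ := mem_filter.1 hw
    have hr : Set.range z = Set.range w := by
      have := congrArg (fun S : Finset (Fin N) => (S : Set (Fin N))) hzw
      simpa using this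
    unfold SignMono at hz hw
    split_ifs at hz hw
    · exact (StrictMono.range_inj hz hw).1 hr
    · exact (StrictAnti.range_inj hz hw).1 hr

theorem Pr_unif {ι E : Type*} [Fintype ι] [DecidableEq ι] [Fintype E] (A : (ι → E) → Prop)
    [DecidablePred A] :
    Pr (unif E) A = (univ.filter A).card / (Fintype.card E : ℝ) ^ Fintype.card ι := by
  rw [Pr, Ex]
  simp only [unif, prod_const, card_univ]
  rw [← mul_sum, inv_pow, mul_comm, ← div_eq_mul_inv, card_filter, Nat.cast_sum]
  congr 1
  refine sum_congr rfl fun x _ => ?_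
  by_cases hA : A x <;> simp [hA]

theorem pow_div_factorial_pow_le {r k : ℕ} {W : ℝ} (hr : r ≠ 0) (hW0 : 0 ≤ W)
    (hk : (4 * Real.exp 1) ^ r * W ≤ (k : ℝ) ^ r) :
    W ^ k / (k.factorial : ℝ) ^ r ≤ (1 / 4 : ℝ) ^ k := by
  have h1 : (k : ℝ) ^ k ≤ Real.exp 1 ^ k * k.factorial := by
    have h := Real.pow_div_factorial_le_exp (k : ℝ) (Nat.cast_nonneg k) k
    rw [div_le_iff₀ (by positivity)] at h
    rwa [Real.exp_one_pow]
  rw [div_le_iff₀ (by positivity)]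
  have h2 : (4 * Real.exp 1) ^ (r * k) * W ^ k ≤ Real.exp 1 ^ (r * k) * (k.factorial : ℝ) ^ r := by
    calc _ = ((4 * Real.exp 1) ^ r * W) ^ k := by rw [mul_pow _ W, pow_mul]
      _ ≤ ((k : ℝ) ^ r) ^ k := by gcongr
      _ = ((k : ℝ) ^ k) ^ r := by rw [← pow_mul, ← pow_mul, mul_comm]
      _ ≤ (Real.exp 1 ^ k * k.factorial) ^ r := by gcongr
      _ = _ := by rw [mul_pow, ← pow_mul, mul_comm k r]
  rw [mul_pow, mul_right_comm, mul_comm] at h2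
  have h3 : (4 : ℝ) ^ (r * k) * W ^ k ≤ (k.factorial : ℝ) ^ r :=
    le_of_mul_le_mul_left h2 (by positivity)
  have h4 : (4 : ℝ) ^ k ≤ 4 ^ (r * k) :=
    pow_le_pow_right₀ (by norm_num) (Nat.le_mul_of_pos_left k (Nat.pos_of_ne_zero hr))
  rw [div_pow, one_pow, one_div, ← div_eq_inv_mul, le_div_iff₀ (by positivity)]
  calc W ^ k * 4 ^ k ≤ W ^ k * 4 ^ (r * k) := by gcongr
    _ = 4 ^ (r * k) * W ^ k := mul_comm _ _
    _ ≤ _ := h3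

section Dominance
variable {r : ℕ}

/-- One of the points is coordinatewise below the other, up to the given signs. -/
def Dom (s : Fin r → Bool) {N : ℕ} (x y : Fin r → Fin N) : Prop :=
  (∀ a, if s a then x a < y a else y a < x a) ∨ (∀ a, if s a then y a < x a else x a < y a)

open Classical in
theorem Pr_signMono_le {k N : ℕ} (s : Fin r → Bool) (A : Fin r → Finset (Fin N)) :
    Pr (unif (Fin r → Fin N)) (fun y : Fin k → Fin r → Fin N =>
      ∀ a, SignMono (s a) (fun p => y p a) ∧ ∀ p, y p a ∈ A a)
      ≤ (∏ a, ((A a).card / N : ℝ)) ^ k / (k.factorial : ℝ) ^ r := by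
  rw [Pr_unif]
  have hcard : ((univ.filter fun y : Fin k → Fin r → Fin N =>
      ∀ a, SignMono (s a) (fun p => y p a) ∧ ∀ p, y p a ∈ A a).card : ℝ)
      ≤ ∏ a, (((A a).card : ℝ) ^ k / k.factorial) := by
    have h1 : (univ.filter fun y : Fin k → Fin r → Fin N =>
        ∀ a, SignMono (s a) (fun p => y p a) ∧ ∀ p, y p a ∈ A a).card
        ≤ (Fintype.piFinset fun a => univ.filter fun z : Fin k → Fin N =>
            SignMono (s a) z ∧ ∀ p, z p ∈ A a).card := by
      refine card_le_card_of_injOn (fun y a p => y p a) (fun y hy => ?_) ?_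
      · rw [mem_coe, Fintype.mem_piFinset]
        exact fun a => mem_filter.2 ⟨mem_univ _, (mem_filter.1 hy).2 a⟩
      · intro y _ y' _ h
        funext p a
        exact congrFun (congrFun h a) p
    rw [Fintype.card_piFinset] at h1
    refine (Nat.cast_le.2 h1).trans ?_
    rw [Nat.cast_prod]
    refine prod_le_prod (fun _ _ => Nat.cast_nonneg _) fun a _ => ?_
    exact (Nat.cast_le.2 (card_signMono_le (s a) (A a))).trans (Nat.choose_le_pow_div k _)
  refine (div_le_div_of_nonneg_right hcard (by positivity)).trans (le_of_eq ?_)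
  simp only [prod_div_distrib, prod_pow, prod_const, card_univ, Fintype.card_fin, Fintype.card_pi]
  push_cast
  rw [div_pow, ← pow_mul, div_right_comm]

open Classical in
theorem Pr_dom_le_factorial [Nonempty (Fin r)] {n k N : ℕ} (hN : 0 < N) (s : Fin r → Bool)
    (A : Fin r → Finset (Fin N)) :
    Pr (unif (Fin r → Fin N)) (fun x : Fin n → Fin r → Fin N =>
      k ≤ cl (Dom s) (univ.filter fun i => ∀ a, x i a ∈ A a) x)
      ≤ (n * ∏ a, ((A a).card / N : ℝ)) ^ k / (k.factorial : ℝ) ^ r := by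
  have hp := unif_pi_isProb (r := r) hN
  obtain ⟨a₀⟩ := ‹Nonempty (Fin r)›
  calc _ ≤ Pr (unif (Fin r → Fin N)) (fun x : Fin n → Fin r → Fin N =>
        ∃ j ∈ univ.filter (fun j : Fin k → Fin n => Function.Injective j),
          ∀ a, SignMono (s a) (fun p => (x ∘ j) p a) ∧ ∀ p, (x ∘ j) p a ∈ A a) := by
        refine Pr_mono hp fun x hx => ?_
        obtain ⟨S', hS', hR', hc'⟩ := exists_cl (Dom s)
          (univ.filter fun i => ∀ a, x i a ∈ A a) x
        rw [← hc'] at hx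
        obtain ⟨S, hS, hc⟩ := exists_subset_card_eq hx
        have hR : ∀ i ∈ S, ∀ i' ∈ S, i ≠ i' → Dom s (x i) (x i') := fun i hi i' hi' =>
          hR' i (hS hi) i' (hS hi')
        let f : Fin n → ℤ := fun i => if s a₀ then (x i a₀ : ℤ) else -(x i a₀ : ℤ)
        have hf : ∀ i ∈ S, ∀ i' ∈ S, i ≠ i' → f i ≤ f i' →
            ∀ a, if s a then x i a < x i' a else x i' a < x i a := by
          intro i hi i' hi' hne hlt
          refine (hR i hi i' hi' hne).resolve_right fun h => ?_
          have h := h a₀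
          simp only [f] at hlt
          split_ifs at h hlt <;> omega
        have hinj : Set.InjOn f S := by
          intro i hi i' hi' he
          by_contra hne
          have h1 := hf i hi i' hi' hne he.le a₀
          have h2 := hf i' hi' i hi (Ne.symm hne) he.ge a₀
          split_ifs at h1 h2 <;> omega
        obtain ⟨j, hj, hmono⟩ := exists_enumeration S f hinj
        subst hc
        refine ⟨j, by simpa using hmono.injective.of_comp, fun a => ⟨?_, fun p => ?_⟩⟩
        · have key : ∀ p q, p < q → if s a then x (j p) a < x (j q) a else x (j q) a < x (j p) a :=
            fun p q hpq => hf _ (hj p) _ (hj q) (hmono.injective.of_comp.ne hpq.ne)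
              (hmono hpq).le a
          unfold SignMono
          split_ifs with h
          · exact fun p q hpq => by simpa [h] using key p q hpq
          · exact fun p q hpq => by simpa [h] using key p q hpq
        · exact (mem_filter.1 (hS' (hS (hj p)))).2 a
    _ ≤ ∑ j ∈ univ.filter (fun j : Fin k → Fin n => Function.Injective j), _ :=
        Pr_exists_le hp _ _
    _ ≤ ∑ j ∈ univ.filter (fun j : Fin k → Fin n => Function.Injective j),
          (∏ a, ((A a).card / N : ℝ)) ^ k / (k.factorial : ℝ) ^ r := by
        refine sum_le_sum fun j hj => ?_
        rw [Pr_comp_injective hp (mem_filter.1 hj).2 (fun y : Fin k → Fin r → Fin N =>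
          ∀ a, SignMono (s a) (fun p => y p a) ∧ ∀ p, y p a ∈ A a)]
        exact Pr_signMono_le s A
    _ ≤ (n : ℝ) ^ k * ((∏ a, ((A a).card / N : ℝ)) ^ k / (k.factorial : ℝ) ^ r) := by
        rw [sum_const, nsmul_eq_mul]
        refine mul_le_mul_of_nonneg_right ?_ (by positivity)
        have : (univ.filter (fun j : Fin k → Fin n => Function.Injective j)).card ≤ n ^ k :=
          (card_filter_le _ _).trans (by simp)
        exact_mod_cast this
    _ = _ := by rw [mul_pow, mul_div_assoc]

open Classical in
theorem Pr_dom_le [Nonempty (Fin r)] {n k N : ℕ} (hN : 0 < N) (s : Fin r → Bool)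
    (A : Fin r → Finset (Fin N))
    (hk : (4 * Real.exp 1) ^ r * (n * ∏ a, ((A a).card / N : ℝ)) ≤ (k : ℝ) ^ r) :
    Pr (unif (Fin r → Fin N)) (fun x : Fin n → Fin r → Fin N =>
      k ≤ cl (Dom s) (univ.filter fun i => ∀ a, x i a ∈ A a) x) ≤ (1 / 4 : ℝ) ^ k := by
  refine (Pr_dom_le_factorial hN s A).trans ?_
  have hr : r ≠ 0 := by
    rintro rfl
    exact isEmptyElim (Classical.arbitrary (Fin 0))
  exact pow_div_factorial_pow_le hr (mul_nonneg (Nat.cast_nonneg n)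
    (prod_nonneg fun a _ => div_nonneg (Nat.cast_nonneg _) (Nat.cast_nonneg _))) hk

theorem Chain.dom {β : Type*} {bl : Fin r → β} {N : ℕ} {x y : Fin r → Fin N}
    (h : Chain bl x y) : Dom (fun _ => true) x y :=
  h.imp (fun h a => by simpa using h a a rfl) (fun h a => by simpa using h a a rfl)

/-- The constant in the crude upper bound for the mean length of a chain. -/
noncomputable def crude : ℝ := 2 * (4 * Real.exp 1 + 1) + 6

theorem crude_pos : 0 < crude := by unfold crude; positivity

theorem chainMean_le_rpow [Nonempty (Fin r)] {β : Type*} {bl : Fin r → β} {K n : ℕ} (hK : 0 < K) :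
    chainMean bl K n ≤ crude * (n : ℝ) ^ (1 / r : ℝ) := by
  classical
  have hr : r ≠ 0 := by
    rintro rfl
    exact isEmptyElim (Classical.arbitrary (Fin 0))
  rcases Nat.eq_zero_or_pos n with rfl | hn
  · refine (chainMean_le hK).trans ?_
    have := crude_pos
    rw [Nat.cast_zero]
    positivity
  have hp := unif_pi_isProb (r := r) hK
  set μ := chainMean bl K n with hμ
  have hn1 : (1 : ℝ) ≤ (n : ℝ) ^ (1 / r : ℝ) :=
    Real.one_le_rpow (by exact_mod_cast hn) (by positivity)
  set k := ⌈4 * Real.exp 1 * (n : ℝ) ^ (1 / r : ℝ)⌉₊ with hk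
  have hk1 : 4 * Real.exp 1 * (n : ℝ) ^ (1 / r : ℝ) ≤ k := Nat.le_ceil _
  have hk2 : (k : ℝ) < 4 * Real.exp 1 * (n : ℝ) ^ (1 / r : ℝ) + 1 :=
    Nat.ceil_lt_add_one (by positivity)
  have hkpos : k ≠ 0 := by
    have : (0 : ℝ) < k := lt_of_lt_of_le (by positivity) hk1
    exact_mod_cast this.ne'
  by_contra hcon
  rw [not_le] at hcon
  have hμk : 2 * (k : ℝ) + 6 < μ := by
    refine lt_of_le_of_lt ?_ hcon
    unfold crude
    nlinarith
  have h1 : Pr (unif (Fin r → Fin K)) (fun x : Fin n → Fin r → Fin K =>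
      k ≤ cl (Chain bl) univ x) ≤ 1 / 4 := by
    calc _ ≤ Pr (unif (Fin r → Fin K)) (fun x : Fin n → Fin r → Fin K =>
          k ≤ cl (Dom fun _ => true)
            (univ.filter fun i => ∀ a, x i a ∈ (univ : Finset (Fin K))) x) := by
          refine Pr_mono hp fun x hx => hx.trans ?_
          exact cl_mono (fun i _ => by simp) fun i _ j _ _ h => h.dom
      _ ≤ (1 / 4) ^ k := by
          refine Pr_dom_le hK _ _ ?_
          have : (K : ℝ) ≠ 0 := by positivity
          simp only [card_univ, Fintype.card_fin, div_self this, prod_const_one, mul_one]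
          refine le_trans (le_of_eq ?_) (pow_le_pow_left₀ (by positivity) hk1 r)
          rw [mul_pow _ ((n : ℝ) ^ (1 / r : ℝ)), ← Real.rpow_natCast ((n : ℝ) ^ (1 / r : ℝ)),
            ← Real.rpow_mul (by positivity), one_div_mul_cancel (by exact_mod_cast hr),
            Real.rpow_one]
      _ ≤ 1 / 4 := pow_le_of_le_one (by norm_num) (by norm_num) hkpos
  have h2 := cl_deviation hp (Chain bl) n (t := μ / 2) (by linarith)
  have h3 : Pr (unif (Fin r → Fin K)) (fun x : Fin n → Fin r → Fin K =>
      k ≤ cl (Chain bl) univ x ∨ μ / 2 ≤ |(cl (Chain bl) univ x : ℝ) - μ|) = 1 := by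
    rw [← Ex_const (ι := Fin n) hp 1, Pr]
    congr 1
    funext x
    rw [if_pos]
    rw [or_iff_not_imp_left, not_le]
    intro h
    have : (cl (Chain bl) univ x : ℝ) < k := by exact_mod_cast h
    rw [abs_sub_comm]
    exact le_trans (by linarith) (le_abs_self _)
  have h4 := Pr_or_le hp (fun x : Fin n → Fin r → Fin K => k ≤ cl (Chain bl) univ x)
    (fun x => μ / 2 ≤ |(cl (Chain bl) univ x : ℝ) - μ|)
  rw [h3] at h4
  have h5 : μ / (μ / 2) ^ 2 = 4 / μ := by
    have : μ ≠ 0 := by linarith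
    field_simp
    norm_num
  have h6 : Pr (unif (Fin r → Fin K)) (fun x : Fin n → Fin r → Fin K =>
      μ / 2 ≤ |(cl (Chain bl) univ x : ℝ) - μ|) ≤ 4 / μ := h5 ▸ h2
  have h7 : 4 / μ < 3 / 4 := by
    rw [div_lt_iff₀ (by linarith)]
    linarith
  linarith

end Dominance
end RandomMatching

namespace RandomMatching
open Finset Filter Topology

theorem rpow_inv_pow {r : ℕ} (hr : r ≠ 0) {t : ℝ} (ht : 0 ≤ t) : (t ^ (1 / r : ℝ)) ^ r = t := by
  rw [one_div, Real.rpow_inv_natCast_pow ht hr]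

theorem le_of_superadditive {r : ℕ} (hr : r ≠ 0) {F : ℕ → ℝ} (h0 : ∀ n, 0 ≤ F n)
    (hsup : ∀ k n m : ℕ, 0 < k → (m : ℝ) < n * ((k : ℝ) ^ r)⁻¹ →
      k * ((1 - n * ((k : ℝ) ^ r)⁻¹ / (n * ((k : ℝ) ^ r)⁻¹ - m) ^ 2) * F m) ≤ F n)
    {m n : ℕ} {δ : ℝ} (hm : 0 < m) (hδ : 0 < δ) (hq : 0 ≤ 1 - (1 + δ) / (δ ^ 2 * m))
    (hn : (1 + δ) * m ≤ n) :
    ((n / ((1 + δ) * m)) ^ (1 / r : ℝ) - 1) * ((1 - (1 + δ) / (δ ^ 2 * m)) * F m) ≤ F n := by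
  have hm' : (0 : ℝ) < m := by exact_mod_cast hm
  set t : ℝ := (n / ((1 + δ) * m)) ^ (1 / r : ℝ) with ht
  have hb : 1 ≤ (n : ℝ) / ((1 + δ) * m) := by
    rw [le_div_iff₀ (by positivity)]
    linarith
  have ht1 : 1 ≤ t := Real.one_le_rpow hb (by positivity)
  have htr : t ^ r = n / ((1 + δ) * m) := rpow_inv_pow hr (by linarith)
  set k := ⌊t⌋₊ with hk
  have hkt : (k : ℝ) ≤ t := Nat.floor_le (by linarith)
  have hkt' : t - 1 < k := by linarith [Nat.lt_floor_add_one t]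
  have hk0 : 0 < k := Nat.floor_pos.2 ht1
  have hkr : (0 : ℝ) < (k : ℝ) ^ r := by positivity
  set l : ℝ := n * ((k : ℝ) ^ r)⁻¹ with hl
  have hlm : (1 + δ) * m ≤ l := by
    rw [hl, ← div_eq_mul_inv, le_div_iff₀ hkr]
    calc (1 + δ) * m * (k : ℝ) ^ r ≤ (1 + δ) * m * t ^ r := by gcongr
      _ = n := by rw [htr]; field_simp
  have hlm' : (m : ℝ) < l := by nlinarith
  have hfrac : l / (l - m) ^ 2 ≤ (1 + δ) / (δ ^ 2 * m) := by
    have hd : 0 < l - m := by linarith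
    rw [div_le_div_iff₀ (by positivity) (by positivity)]
    have h1 : δ * m ≤ l - m := by linarith
    have h2 : (δ * m) ^ 2 ≤ (l - m) ^ 2 := by gcongr
    have h3 : (δ * m) * (δ * m * (l - m)) ≤ (l - m) * (δ * m * (l - m)) := by gcongr
    have h4 : m * (l * (δ ^ 2 * m)) ≤ m * ((1 + δ) * (l - m) ^ 2) := by nlinarith
    exact le_of_mul_le_mul_left h4 hm'
  refine le_trans ?_ (hsup k n m hk0 hlm')
  have hF := h0 m
  have hqF : 0 ≤ (1 - (1 + δ) / (δ ^ 2 * m)) * F m := mul_nonneg hq hF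
  refine mul_le_mul hkt'.le ?_ hqF (Nat.cast_nonneg k)
  exact mul_le_mul_of_nonneg_right (by linarith) hF

theorem exists_tendsto_of_superadditive {r : ℕ} (hr : r ≠ 0) {F : ℕ → ℝ} {C : ℝ}
    (h0 : ∀ n, 0 ≤ F n) (h1 : 0 < F 1) (hC : ∀ n : ℕ, F n ≤ C * (n : ℝ) ^ (1 / r : ℝ))
    (hsup : ∀ k n m : ℕ, 0 < k → (m : ℝ) < n * ((k : ℝ) ^ r)⁻¹ →
      k * ((1 - n * ((k : ℝ) ^ r)⁻¹ / (n * ((k : ℝ) ^ r)⁻¹ - m) ^ 2) * F m) ≤ F n) :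
    ∃ c, 0 < c ∧ Tendsto (fun n : ℕ => F n / (n : ℝ) ^ (1 / r : ℝ)) atTop (𝓝 c) := by
  have hr' : (0 : ℝ) < 1 / r := by positivity
  let G : ℕ → ℝ → ℝ := fun m δ => ((1 + δ) ^ (1 / r : ℝ))⁻¹ *
    ((1 - (1 + δ) / (δ ^ 2 * m)) * (F m / (m : ℝ) ^ (1 / r : ℝ)))
  let S : Set ℝ := {g | ∃ m : ℕ, ∃ δ : ℝ, 0 < m ∧ 0 < δ ∧ 0 ≤ 1 - (1 + δ) / (δ ^ 2 * m) ∧ g = G m δ}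
  have hpow : ∀ m : ℕ, 0 < m → (0 : ℝ) < (m : ℝ) ^ (1 / r : ℝ) := fun m hm =>
    Real.rpow_pos_of_pos (by exact_mod_cast hm) _
  have hu0 : ∀ m : ℕ, 0 ≤ F m / (m : ℝ) ^ (1 / r : ℝ) := fun m =>
    div_nonneg (h0 m) (by positivity)
  have huC : ∀ m : ℕ, 0 < m → F m / (m : ℝ) ^ (1 / r : ℝ) ≤ C := fun m hm => by
    rw [div_le_iff₀ (hpow m hm)]
    exact hC m
  have hC0 : 0 ≤ C := (hu0 1).trans (huC 1 one_pos)
  have hbdd : BddAbove S := by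
    refine ⟨C, ?_⟩
    rintro _ ⟨m, δ, hm, hδ, hq, rfl⟩
    have hA : ((1 + δ) ^ (1 / r : ℝ))⁻¹ ≤ 1 :=
      inv_le_one_of_one_le₀ (Real.one_le_rpow (by linarith) hr'.le)
    have hq1 : 1 - (1 + δ) / (δ ^ 2 * m) ≤ 1 := by
      have : 0 ≤ (1 + δ) / (δ ^ 2 * m) := by positivity
      linarith
    calc G m δ ≤ 1 * (1 * C) := by
          have := huC m hm
          have := hu0 m
          simp only [G]
          gcongr
      _ = C := by ring
  have hmem : G 1 3 ∈ S := ⟨1, 3, one_pos, by norm_num, by norm_num, rfl⟩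
  set c := sSup S with hc
  have hcpos : 0 < c := by
    refine lt_of_lt_of_le ?_ (le_csSup hbdd hmem)
    have : 0 < F 1 / ((1 : ℕ) : ℝ) ^ (1 / r : ℝ) := div_pos h1 (hpow 1 one_pos)
    simp only [G]
    refine mul_pos (by positivity) (mul_pos (by norm_num) this)
  have htend : Tendsto (fun n : ℕ => (n : ℝ) ^ (1 / r : ℝ)) atTop atTop :=
    (tendsto_rpow_atTop hr').comp tendsto_natCast_atTop_atTop
  refine ⟨c, hcpos, tendsto_order.2 ⟨fun l hl => ?_, fun l hl => ?_⟩⟩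
  · obtain ⟨_, ⟨m, δ, hm, hδ, hq, rfl⟩, hlG⟩ := exists_lt_of_lt_csSup ⟨_, hmem⟩ hl
    have hlim : Tendsto (fun n : ℕ => G m δ -
        ((1 - (1 + δ) / (δ ^ 2 * m)) * F m) / (n : ℝ) ^ (1 / r : ℝ)) atTop (𝓝 (G m δ - 0)) :=
      tendsto_const_nhds.sub (tendsto_const_nhds.div_atTop htend)
    rw [sub_zero] at hlim
    filter_upwards [hlim.eventually (lt_mem_nhds hlG), eventually_gt_atTop 0,
      eventually_ge_atTop ⌈(1 + δ) * m⌉₊] with n hn hn0 hn1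
    refine hn.trans_le ?_
    rw [le_div_iff₀ (hpow n hn0)]
    refine le_trans (le_of_eq ?_) (le_of_superadditive hr h0 hsup hm hδ hq (Nat.ceil_le.1 hn1))
    have hm0 := hpow m hm
    have hn0' := hpow n hn0
    have hd : 0 < (1 + δ) ^ (1 / r : ℝ) := Real.rpow_pos_of_pos (by linarith) _
    rw [Real.div_rpow (by positivity) (by positivity),
      Real.mul_rpow (by positivity) (by positivity)]
    simp only [G]
    field_simp
  · have hδ : ∀ᶠ δ in 𝓝[>] (0 : ℝ), c < ((1 + δ) ^ (1 / r : ℝ))⁻¹ * l := by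
      have hcont : ContinuousAt (fun δ : ℝ => ((1 + δ) ^ (1 / r : ℝ))⁻¹ * l) 0 := by
        refine ContinuousAt.mul (ContinuousAt.inv₀ ?_ (by simp)) continuousAt_const
        exact ContinuousAt.rpow (by fun_prop) continuousAt_const (Or.inl (by norm_num))
      have := hcont.tendsto
      simp only [add_zero, Real.one_rpow, inv_one, one_mul] at this
      exact (this.mono_left nhdsWithin_le_nhds).eventually (lt_mem_nhds hl)
    obtain ⟨δ, hδl, hδ0⟩ := (hδ.and self_mem_nhdsWithin).exists
    have hδ0 : 0 < δ := hδ0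
    have hlim : Tendsto (fun m : ℕ => (1 + δ) / (δ ^ 2 * m)) atTop (𝓝 0) :=
      tendsto_const_nhds.div_atTop
        (tendsto_natCast_atTop_atTop.const_mul_atTop (by positivity))
    have hlim2 : Tendsto (fun m : ℕ => ((1 + δ) ^ (1 / r : ℝ))⁻¹ *
        ((1 - (1 + δ) / (δ ^ 2 * m)) * l)) atTop (𝓝 (((1 + δ) ^ (1 / r : ℝ))⁻¹ * ((1 - 0) * l))) :=
      ((hlim.const_sub 1).mul_const l).const_mul _
    rw [sub_zero, one_mul] at hlim2
    filter_upwards [hlim2.eventually (lt_mem_nhds hδl), hlim.eventually (gt_mem_nhds one_pos),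
      eventually_gt_atTop 0] with m hm1 hm2 hm0
    have hG : G m δ ≤ c := le_csSup hbdd ⟨m, δ, hm0, hδ0, by linarith, rfl⟩
    have h := hG.trans_lt hm1
    have hA : 0 < ((1 + δ) ^ (1 / r : ℝ))⁻¹ :=
      inv_pos.2 (Real.rpow_pos_of_pos (by linarith) _)
    exact lt_of_mul_lt_mul_left (lt_of_mul_lt_mul_left h hA.le) (by linarith)

section Limit
variable {r : ℕ} {β : Type*} (bl : Fin r → β)

/-- The limit of the mean size of a largest chain as the grid gets finer. -/
noncomputable def chainLim (n : ℕ) : ℝ := ⨆ K : ℕ, chainMean bl (K + 1) n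

variable {bl}

theorem bddAbove_chainMean (n : ℕ) : BddAbove (Set.range fun K : ℕ => chainMean bl (K + 1) n) :=
  ⟨n, by rintro _ ⟨K, rfl⟩; exact chainMean_le K.succ_pos⟩

theorem chainMean_le_chainLim {K n : ℕ} (hK : 0 < K) : chainMean bl K n ≤ chainLim bl n := by
  obtain ⟨K, rfl⟩ := Nat.exists_eq_succ_of_ne_zero hK.ne'
  exact le_ciSup (bddAbove_chainMean n) K

theorem chainLim_le {K n : ℕ} (hK : 0 < K) :
    chainLim bl n ≤ chainMean bl K n + n * ((n : ℝ) ^ 2 * r ^ 2 / K) :=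
  ciSup_le fun K' => (chainMean_le_mul (K' := K) K'.succ_pos hK).trans
    (by rw [mul_comm]; exact chainMean_mul_le hK K'.succ_pos)

theorem chainLim_nonneg (n : ℕ) : 0 ≤ chainLim bl n :=
  (chainMean_nonneg one_pos).trans (chainMean_le_chainLim one_pos)

theorem chainLim_one_pos : 0 < chainLim bl 1 := by
  refine lt_of_lt_of_le one_pos (le_trans ?_ (chainMean_le_chainLim one_pos))
  rw [chainMean, ← Ex_const (ι := Fin 1) (unif_pi_isProb (r := r) one_pos) 1]
  refine Ex_mono (unif_pi_isProb one_pos) fun x => ?_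
  rw [Nat.one_le_cast]
  refine le_trans (le_of_eq ?_) (le_cl (subset_refl univ) fun i _ j _ h =>
    absurd (Subsingleton.elim i j) h)
  simp

theorem chainLim_le_rpow [Nonempty (Fin r)] (n : ℕ) :
    chainLim bl n ≤ crude * (n : ℝ) ^ (1 / r : ℝ) :=
  ciSup_le fun K => chainMean_le_rpow K.succ_pos

theorem chainLim_superadditive [Nonempty (Fin r)] {k n m : ℕ} (hk : 0 < k)
    (hm : (m : ℝ) < n * ((k : ℝ) ^ r)⁻¹) :
    k * ((1 - n * ((k : ℝ) ^ r)⁻¹ / (n * ((k : ℝ) ^ r)⁻¹ - m) ^ 2) * chainLim bl m)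
      ≤ chainLim bl n := by
  rcases le_total (1 - n * ((k : ℝ) ^ r)⁻¹ / (n * ((k : ℝ) ^ r)⁻¹ - m) ^ 2) 0 with h | h
  · refine le_trans ?_ (chainLim_nonneg n)
    exact mul_nonpos_of_nonneg_of_nonpos (Nat.cast_nonneg k)
      (mul_nonpos_of_nonpos_of_nonneg h (chainLim_nonneg m))
  · rw [chainLim, Real.mul_iSup_of_nonneg h, Real.mul_iSup_of_nonneg (Nat.cast_nonneg k)]
    exact ciSup_le fun K => (chainMean_superadditive hk K.succ_pos hm).trans
      (chainMean_le_chainLim (Nat.mul_pos hk K.succ_pos))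

theorem exists_chainLim_tendsto [Nonempty (Fin r)] (bl : Fin r → β) :
    ∃ c, 0 < c ∧ Tendsto (fun n : ℕ => chainLim bl n / (n : ℝ) ^ (1 / r : ℝ)) atTop (𝓝 c) := by
  have hr : r ≠ 0 := by
    rintro rfl
    exact isEmptyElim (Classical.arbitrary (Fin 0))
  exact exists_tendsto_of_superadditive hr chainLim_nonneg chainLim_one_pos chainLim_le_rpow
    fun k n m => chainLim_superadditive

end Limit
end RandomMatching

namespace RandomMatching
open Finset Filter Topology

theorem abs_rpow_sub_rpow_le {a x y : ℝ} (hx : 0 ≤ x) (hy : 0 ≤ y) (ha : 0 ≤ a) (ha1 : a ≤ 1) :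
    |x ^ a - y ^ a| ≤ |x - y| ^ a := by
  wlog h : y ≤ x generalizing x y
  · rw [abs_sub_comm, abs_sub_comm x y]
    exact this hy hx (le_of_not_ge h)
  have h1 : y ^ a ≤ x ^ a := Real.rpow_le_rpow hy h ha
  rw [abs_of_nonneg (by linarith), abs_of_nonneg (by linarith)]
  have h2 := Real.rpow_add_le_add_rpow (sub_nonneg.2 h) hy ha ha1
  rw [sub_add_cancel] at h2
  linarith

theorem tendsto_natCast_rpow {r : ℕ} (hr : r ≠ 0) :
    Tendsto (fun n : ℕ => (n : ℝ) ^ (1 / r : ℝ)) atTop atTop :=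
  (tendsto_rpow_atTop (by positivity)).comp tendsto_natCast_atTop_atTop

section ChainLimit
variable {r : ℕ} {β : Type*} {bl : Fin r → β} {c : ℝ}

theorem chainLim_uniform [Nonempty (Fin r)] (hr : r ≠ 0) (hc0 : 0 ≤ c)
    (hc : Tendsto (fun n : ℕ => chainLim bl n / (n : ℝ) ^ (1 / r : ℝ)) atTop (𝓝 c))
    {ε : ℝ} (hε : 0 < ε) : ∀ᶠ n : ℕ in atTop, ∀ m ≤ n,
      |chainLim bl m - c * (m : ℝ) ^ (1 / r : ℝ)| ≤ ε * (n : ℝ) ^ (1 / r : ℝ) := by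
  obtain ⟨M, hM⟩ := eventually_atTop.1
    ((Metric.tendsto_nhds.1 hc ε hε).and (eventually_gt_atTop 0))
  filter_upwards [(tendsto_natCast_rpow hr).eventually_ge_atTop
    ((crude + c) * (M : ℝ) ^ (1 / r : ℝ) / ε)] with n hn m hmn
  rcases le_total M m with h | h
  · obtain ⟨h1, h2⟩ := hM m h
    have hpos : (0 : ℝ) < (m : ℝ) ^ (1 / r : ℝ) := Real.rpow_pos_of_pos (by exact_mod_cast h2) _
    have h3 : |chainLim bl m - c * (m : ℝ) ^ (1 / r : ℝ)| ≤ ε * (m : ℝ) ^ (1 / r : ℝ) := by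
      rw [Real.dist_eq] at h1
      have : chainLim bl m - c * (m : ℝ) ^ (1 / r : ℝ)
          = (chainLim bl m / (m : ℝ) ^ (1 / r : ℝ) - c) * (m : ℝ) ^ (1 / r : ℝ) := by
        field_simp
      rw [this, abs_mul, abs_of_pos hpos]
      gcongr
    refine h3.trans ?_
    gcongr
  · rw [div_le_iff₀ hε, mul_comm _ ε] at hn
    refine le_trans ?_ hn
    have h1 := chainLim_nonneg (bl := bl) m
    have h2 := chainLim_le_rpow (bl := bl) m
    have h3 : (0 : ℝ) ≤ c * (m : ℝ) ^ (1 / r : ℝ) := by positivity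
    have h4 : (m : ℝ) ^ (1 / r : ℝ) ≤ (M : ℝ) ^ (1 / r : ℝ) := by gcongr
    have h5 := crude_pos
    have h6 : (crude + c) * (m : ℝ) ^ (1 / r : ℝ) ≤ (crude + c) * (M : ℝ) ^ (1 / r : ℝ) := by
      gcongr
    rw [abs_le]
    have h7 : 0 ≤ crude * (m : ℝ) ^ (1 / r : ℝ) := by positivity
    constructor <;> nlinarith

theorem Pr_chain_deviation [Nonempty (Fin r)] (hr : r ≠ 0) (hc0 : 0 ≤ c)
    (hc : Tendsto (fun n : ℕ => chainLim bl n / (n : ℝ) ^ (1 / r : ℝ)) atTop (𝓝 c))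
    {ε : ℝ} (hε : 0 < ε) : ∀ᶠ n : ℕ in atTop, ∀ᶠ K : ℕ in atTop, ∀ m ≤ n,
      Pr (unif (Fin r → Fin K)) (fun y : Fin m → Fin r → Fin K =>
        ε * (n : ℝ) ^ (1 / r : ℝ) ≤ |(cl (Chain bl) univ y : ℝ) - c * (m : ℝ) ^ (1 / r : ℝ)|
          ∨ Tie univ y) ≤ ε := by
  filter_upwards [chainLim_uniform (bl := bl) hr hc0 hc (ε := ε / 4) (by positivity),
    (tendsto_natCast_rpow hr).eventually_ge_atTop (8 * crude / ε ^ 3),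
    eventually_gt_atTop 0] with n hF hn hn0
  have hn0' : (0 : ℝ) < n := by exact_mod_cast hn0
  set N : ℝ := (n : ℝ) ^ (1 / r : ℝ) with hN
  have hNpos : 0 < N := Real.rpow_pos_of_pos hn0' _
  filter_upwards [tendsto_natCast_atTop_atTop.eventually_ge_atTop
      ((n : ℝ) * ((n : ℝ) ^ 2 * r ^ 2) / (ε / 4 * N)),
    tendsto_natCast_atTop_atTop.eventually_ge_atTop (((n : ℝ) ^ 2 * r ^ 2) / (ε / 2)),
    eventually_gt_atTop 0] with K hK1 hK2 hK m hmn
  have hp := unif_pi_isProb (r := r) hK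
  have hK' : (0 : ℝ) < K := by exact_mod_cast hK
  have hmn' : (m : ℝ) ≤ n := by exact_mod_cast hmn
  have hmN : (m : ℝ) ^ (1 / r : ℝ) ≤ N := by rw [hN]; gcongr
  have htie : Pr (unif (Fin r → Fin K)) (fun y : Fin m → Fin r → Fin K => Tie univ y) ≤ ε / 2 := by
    refine (Pr_tie_le hK).trans ?_
    rw [div_le_iff₀ (by positivity)] at hK2
    rw [div_le_iff₀ hK']
    calc (m : ℝ) ^ 2 * r ^ 2 ≤ (n : ℝ) ^ 2 * r ^ 2 := by gcongr
      _ ≤ _ := by linarith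
  set mean := chainMean bl K m with hmean
  have hgap1 : mean ≤ chainLim bl m := chainMean_le_chainLim hK
  have hgap2 : chainLim bl m ≤ mean + ε / 4 * N := by
    refine (chainLim_le hK).trans ?_
    refine add_le_add_right ?_ _
    rw [← mul_div_assoc, div_le_iff₀ hK']
    rw [div_le_iff₀ (by positivity)] at hK1
    calc (m : ℝ) * ((m : ℝ) ^ 2 * r ^ 2) ≤ (n : ℝ) * ((n : ℝ) ^ 2 * r ^ 2) := by gcongr
      _ ≤ _ := by linarith
  have hFm := hF m hmn
  have hdev := cl_deviation hp (Chain bl) m (t := ε / 2 * N) (by positivity)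
  have hdev2 : mean / (ε / 2 * N) ^ 2 ≤ ε / 2 := by
    have h1 : mean ≤ crude * N :=
      (chainMean_le_rpow hK).trans (mul_le_mul_of_nonneg_left hmN crude_pos.le)
    rw [div_le_iff₀ (by positivity)] at hn ⊢
    have : crude * N ≤ (N * ε ^ 3 / 8) * N := by gcongr; linarith
    nlinarith
  refine (Pr_or_le hp _ _).trans ?_
  have h3 : Pr (unif (Fin r → Fin K)) (fun y : Fin m → Fin r → Fin K =>
      ε * N ≤ |(cl (Chain bl) univ y : ℝ) - c * (m : ℝ) ^ (1 / r : ℝ)|) ≤ ε / 2 := by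
    refine le_trans (Pr_mono hp fun y hy => ?_) (hdev.trans hdev2)
    change ε / 2 * N ≤ |(cl (Chain bl) univ y : ℝ) - mean|
    have h4 : |(cl (Chain bl) univ y : ℝ) - c * (m : ℝ) ^ (1 / r : ℝ)|
        ≤ |(cl (Chain bl) univ y : ℝ) - mean| + |mean - c * (m : ℝ) ^ (1 / r : ℝ)| :=
      abs_sub_le _ _ _
    have h5 : |mean - c * (m : ℝ) ^ (1 / r : ℝ)| ≤ ε / 2 * N := by
      rw [abs_le] at hFm ⊢
      constructor <;> linarith
    linarith
  linarith

theorem Tie_map {ι κ : Type*} {K : ℕ} (j : κ ↪ ι) (T : Finset κ) (y : ι → Fin r → Fin K) :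
    Tie (T.map j) y ↔ Tie T (y ∘ j) := by
  constructor
  · rintro ⟨i', hi', k', hk', hne, a, b, h⟩
    obtain ⟨i, hi, rfl⟩ := Finset.mem_map.1 hi'
    obtain ⟨k, hk, rfl⟩ := Finset.mem_map.1 hk'
    exact ⟨i, hi, k, hk, fun e => hne (e ▸ rfl), a, b, h⟩
  · rintro ⟨i, hi, k, hk, hne, a, b, h⟩
    exact ⟨_, mem_map_of_mem j hi, _, mem_map_of_mem j hk, j.injective.ne hne, a, b, h⟩

theorem Tie_congr {ι : Type*} {K : ℕ} {T : Finset ι} {y y' : ι → Fin r → Fin K}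
    (h : ∀ i ∈ T, y i = y' i) : Tie T y ↔ Tie T y' := by
  constructor
  · rintro ⟨i, hi, k, hk, hne, a, b, e⟩
    exact ⟨i, hi, k, hk, hne, a, b, by rw [← h i hi, ← h k hk, e]⟩
  · rintro ⟨i, hi, k, hk, hne, a, b, e⟩
    exact ⟨i, hi, k, hk, hne, a, b, by rw [h i hi, h k hk, e]⟩

/-- The largest chain on `T` is far from its typical size `v`, or a tie occurs. -/
def ChainBad (bl : Fin r → β) {ι : Type*} {K : ℕ} (t v : ℝ) (T : Finset ι)
    (y : ι → Fin r → Fin K) : Prop :=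
  t ≤ |(cl (Chain bl) T y : ℝ) - v| ∨ Tie T y

open Classical in
theorem Pr_thinned_chain_deviation [Nonempty (Fin r)] (hr : r ≠ 0) (hc0 : 0 ≤ c)
    (hc : Tendsto (fun n : ℕ => chainLim bl n / (n : ℝ) ^ (1 / r : ℝ)) atTop (𝓝 c))
    {p : ℝ} (hp0 : 0 ≤ p) (hp1 : p ≤ 1)
    {ε : ℝ} (hε : 0 < ε) : ∀ᶠ n : ℕ in atTop, ∀ᶠ K : ℕ in atTop,
      ∀ (E : Type) [Fintype E] (μ : E → ℝ) (G : E → Prop) (ψ : E → Fin r → Fin K),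
        IsProb μ → Thins μ (unif (Fin r → Fin K)) G ψ p →
        Pr μ (fun x : Fin n → E => ChainBad bl (ε * (n : ℝ) ^ (1 / r : ℝ))
          (c * (p * n) ^ (1 / r : ℝ)) (univ.filter fun i => G (x i)) (ψ ∘ x)) ≤ ε := by
  have hr1 : (1 / r : ℝ) ≤ 1 := by
    rw [div_le_one (by positivity)]
    exact_mod_cast Nat.one_le_iff_ne_zero.2 hr
  obtain ⟨δ, hδ, hδε⟩ : ∃ δ : ℝ, 0 < δ ∧ c * δ ^ (1 / r : ℝ) ≤ ε / 2 := by
    refine ⟨(ε / (2 * (c + 1))) ^ r, by positivity, ?_⟩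
    rw [one_div, Real.pow_rpow_inv_natCast (by positivity) hr]
    rw [← mul_div_assoc, div_le_div_iff₀ (by positivity) (by positivity)]
    nlinarith
  filter_upwards [Pr_chain_deviation (bl := bl) hr hc0 hc (ε := ε / 2) (by positivity),
    tendsto_natCast_atTop_atTop.eventually_ge_atTop (2 / (ε * δ ^ 2)),
    eventually_gt_atTop 0] with n hn hn1 hn0
  have hn0' : (0 : ℝ) < n := by exact_mod_cast hn0
  filter_upwards [hn, eventually_gt_atTop 0] with K hK hK0 E _ μ G ψ hμ hth
  have hν := unif_pi_isProb (r := r) hK0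
  have hb := bern_isProb hp0 hp1
  have key := hth.Ex_eq (ι := Fin n) hμ hν (fun T y => if ChainBad bl (ε * (n : ℝ) ^ (1 / r : ℝ))
    (c * (p * n) ^ (1 / r : ℝ)) T y then (1 : ℝ) else 0) (fun T y y' h => by
      have e : ChainBad bl (ε * (n : ℝ) ^ (1 / r : ℝ)) (c * (p * n) ^ (1 / r : ℝ)) T y
          ↔ ChainBad bl (ε * (n : ℝ) ^ (1 / r : ℝ)) (c * (p * n) ^ (1 / r : ℝ)) T y' := by
        rw [ChainBad, ChainBad, cl_congr h, Tie_congr h]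
      by_cases h' : ChainBad bl (ε * (n : ℝ) ^ (1 / r : ℝ)) (c * (p * n) ^ (1 / r : ℝ)) T y
      · simp only [h', e.1 h', if_true]
      · simp only [h', mt e.2 h', if_false])
  rw [Pr]
  refine (le_of_eq key).trans ?_
  have hinner : ∀ t : Fin n → Bool, |((univ.filter fun i => t i = true).card : ℝ) - n * p| < δ * n →
      Pr (unif (Fin r → Fin K)) (fun y : Fin n → Fin r → Fin K =>
        ChainBad bl (ε * (n : ℝ) ^ (1 / r : ℝ)) (c * (p * n) ^ (1 / r : ℝ))
          (univ.filter fun i => t i = true) y) ≤ ε / 2 := by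
    intro t ht
    set T := univ.filter fun i => t i = true with hT
    let j : Fin T.card ↪ Fin n := T.equivFin.symm.toEmbedding.trans (Function.Embedding.subtype _)
    have hj : univ.map j = T := by
      ext i
      simp only [Finset.mem_map, mem_univ, true_and, j]
      constructor
      · rintro ⟨a, rfl⟩
        exact (T.equivFin.symm a).2
      · exact fun hi => ⟨T.equivFin ⟨i, hi⟩, by simp⟩
    have hTn : T.card ≤ n := (card_le_univ _).trans (by simp)
    refine le_trans ?_ (hK T.card hTn)
    rw [← Pr_comp_injective hν j.injective]
    refine Pr_mono hν fun y hy => ?_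
    rw [ChainBad, ← hj, cl_map, Tie_map] at hy
    refine hy.imp_left fun h => ?_
    have h1 : |(cl (Chain bl) univ (y ∘ j) : ℝ) - c * (p * n) ^ (1 / r : ℝ)|
        ≤ |(cl (Chain bl) univ (y ∘ j) : ℝ) - c * (T.card : ℝ) ^ (1 / r : ℝ)|
          + |c * (T.card : ℝ) ^ (1 / r : ℝ) - c * (p * n) ^ (1 / r : ℝ)| := abs_sub_le _ _ _
    have h2 : |c * (T.card : ℝ) ^ (1 / r : ℝ) - c * (p * n) ^ (1 / r : ℝ)|
        ≤ ε / 2 * (n : ℝ) ^ (1 / r : ℝ) := by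
      rw [← mul_sub, abs_mul, abs_of_nonneg hc0]
      calc _ ≤ c * |(T.card : ℝ) - p * n| ^ (1 / r : ℝ) := by
            gcongr
            exact abs_rpow_sub_rpow_le (by positivity) (by positivity) (by positivity) hr1
        _ ≤ c * (δ * n) ^ (1 / r : ℝ) := by
            gcongr
            rw [mul_comm p]
            exact ht.le
        _ = c * δ ^ (1 / r : ℝ) * (n : ℝ) ^ (1 / r : ℝ) := by
            rw [Real.mul_rpow hδ.le hn0'.le, mul_assoc]
        _ ≤ _ := by gcongr
    linarith
  calc _ ≤ Ex (bern p) (fun t : Fin n → Bool => ε / 2 +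
        if δ * n ≤ |((univ.filter fun i => t i = true).card : ℝ) - n * p| then (1 : ℝ) else 0) := by
        refine Ex_mono hb fun t => ?_
        split_ifs with h
        · exact (Pr_le_one hν _).trans (by linarith)
        · rw [add_zero]
          exact hinner t (not_le.1 h)
    _ = ε / 2 + Pr (bern p) (fun t : Fin n → Bool =>
          δ * n ≤ |((univ.filter fun i => t i = true).card : ℝ) - n * p|) := by
        rw [Ex_add, Ex_const hb, Pr]
    _ ≤ ε / 2 + n * p / (δ * n) ^ 2 := by
        gcongr
        exact binomial_deviation hp0 hp1 n (by positivity)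
    _ ≤ ε := by
        have : n * p / (δ * n) ^ 2 ≤ ε / 2 := by
          rw [div_le_iff₀ (by positivity)] at hn1 ⊢
          have h1 : n * p ≤ n := by nlinarith
          nlinarith
        linarith

end ChainLimit
end RandomMatching

namespace RandomMatching
open Finset

/-- The relation `<` or `>`, according to the sign. -/
def SLt {α : Type*} [LT α] (s : Bool) (a b : α) : Prop := if s then a < b else b < a

theorem exists_equipartition {N K a : ℕ} (hK : 0 < K) (Z : Finset (Fin N)) (hZ : Z.card = K * a)
    (s : Bool) : ∃ ρ : Fin N → Fin K,
      (∀ z ∈ Z, ∀ w ∈ Z, ρ z < ρ w → SLt s z w) ∧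
      (∀ z ∈ Z, ∀ w ∈ Z, ρ z ≠ ρ w → SLt s z w → ρ z < ρ w) ∧
      ∀ y, (Z.filter fun z => ρ z = y).card = a := by
  classical
  let e := Z.orderIsoOfFin hZ
  let f : Fin K → Fin K := fun y => if s then y else y.rev
  have hf : Function.Involutive f := by
    intro y
    simp only [f]
    split_ifs <;> simp
  let ρ : Fin N → Fin K := fun z => if hz : z ∈ Z then f (e.symm ⟨z, hz⟩).divNat else ⟨0, hK⟩
  have hρ : ∀ z (hz : z ∈ Z), ρ z = f (e.symm ⟨z, hz⟩).divNat := fun z hz => by simp [ρ, hz]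
  have hlt : ∀ z w : Z, (e.symm z).divNat < (e.symm w).divNat → z < w := fun z w h =>
    e.symm.lt_iff_lt.1 (lt_of_divNat_lt h)
  have hle : ∀ z w : Z, z < w → (e.symm z).divNat ≤ (e.symm w).divNat := fun z w h =>
    divNat_le_divNat (e.symm.lt_iff_lt.2 h).le
  refine ⟨ρ, fun z hz w hw h => ?_, fun z hz w hw hne h => ?_, fun y => ?_⟩
  · rw [hρ z hz, hρ w hw] at h
    simp only [f] at h
    unfold SLt
    split_ifs at h ⊢
    · exact hlt ⟨z, hz⟩ ⟨w, hw⟩ h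
    · exact hlt ⟨w, hw⟩ ⟨z, hz⟩ (Fin.rev_lt_rev.1 h)
  · refine lt_of_le_of_ne ?_ hne
    rw [hρ z hz, hρ w hw]
    simp only [f]
    unfold SLt at h
    split_ifs at h ⊢
    · exact hle ⟨z, hz⟩ ⟨w, hw⟩ h
    · exact Fin.rev_le_rev.2 (hle ⟨w, hw⟩ ⟨z, hz⟩ h)
  · rw [← card_filter_divNat (n := a) (f y)]
    symm
    refine card_bij (fun u _ => (e u : Fin N)) (fun u hu => ?_) (fun u _ v _ h => ?_) fun z hz => ?_
    · rw [mem_filter]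
      refine ⟨(e u).2, ?_⟩
      rw [hρ _ (e u).2, Subtype.coe_eta, e.symm_apply_apply, (mem_filter.1 hu).2, hf]
    · exact e.injective (Subtype.ext h)
    · obtain ⟨hz, hy⟩ := mem_filter.1 hz
      refine ⟨e.symm ⟨z, hz⟩, ?_, by simp⟩
      rw [hρ z hz] at hy
      rw [mem_filter, ← hy, hf]
      exact ⟨mem_univ _, rfl⟩

section Colouring
variable {r g : ℕ} {β : Type*} [DecidableEq β] (bl : Fin r → β) (s : β → Bool)
  (κ : Fin g → Option β)

/-- The entries of `v` are, up to order, the block labels. -/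
def Good (v : Fin r → Option β) : Prop :=
  ∃ σ : Equiv.Perm (Fin r), ∀ i, v (σ i) = some (bl i)

/-- The colours of the cells of the coordinates of a point. -/
def colours {K : ℕ} (x : Fin r → Fin (g * K)) : Fin r → Option β :=
  fun i => κ (x i).divNat

/-- The point `x` lies before `y` inside every colour class, up to the signs. -/
def Before {K : ℕ} (x y : Fin r → Fin (g * K)) : Prop :=
  ∀ p q b, colours κ x p = some b → colours κ y q = some b → SLt (s b) (x p) (y q)

/-- The number of cells of a given colour. -/
def cellCount (b : β) : ℕ := (univ.filter fun u => κ u = some b).card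

open Classical in
/-- The probability that the colours of a uniform point are the block labels up to order. -/
noncomputable def goodProb [Fintype β] : ℝ :=
  (univ.filter fun v : Fin r → Option β => Good bl v).card * ∏ i, (cellCount κ (bl i) / g : ℝ)

variable {bl s κ}

theorem card_colour_class {K : ℕ} (b : β) :
    (univ.filter fun z : Fin (g * K) => κ z.divNat = some b).card = K * cellCount κ b := by
  rw [card_eq_sum_card_fiberwise (f := Fin.divNat) (t := univ.filter fun u => κ u = some b)
    fun z hz => by simpa using hz]
  rw [sum_congr rfl (g := fun _ => K), sum_const, smul_eq_mul, mul_comm, cellCount]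
  intro u hu
  refine Eq.trans ?_ (card_filter_divNat (n := K) u)
  rw [filter_filter]
  refine congrArg card (filter_congr fun z _ => and_iff_right_of_imp ?_)
  rintro rfl
  exact (mem_filter.1 hu).2

theorem exists_thinning [Fintype β] {K : ℕ} (hg : 0 < g) (hK : 0 < K) :
    ∃ ψ : (Fin r → Fin (g * K)) → Fin r → Fin K,
      Thins (unif (Fin r → Fin (g * K))) (unif (Fin r → Fin K)) (fun x => Good bl (colours κ x)) ψ
        (goodProb bl κ) ∧
      (∀ x y, Good bl (colours κ x) → Good bl (colours κ y) → Chain bl (ψ x) (ψ y) →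
        Before s κ x y ∨ Before s κ y x) ∧
      (∀ x y, Good bl (colours κ x) → Good bl (colours κ y) → (∀ a a', ψ x a ≠ ψ y a') →
        Before s κ x y ∨ Before s κ y x → Chain bl (ψ x) (ψ y)) := by
  classical
  have hρ := fun b => exists_equipartition (K := K) hK
    (univ.filter fun z : Fin (g * K) => κ z.divNat = some b) (card_colour_class b) (s b)
  simp only [mem_filter, mem_univ, true_and, filter_filter] at hρ
  choose ρ hρ1 hρ2 hρ3 using hρ
  let σ : (Fin r → Option β) → Equiv.Perm (Fin r) := fun v =>
    if h : Good bl v then h.choose else 1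
  have hσ : ∀ v, Good bl v → ∀ i, v (σ v i) = some (bl i) := fun v h => by
    simp only [σ, h, dif_pos]
    exact h.choose_spec
  let ψ : (Fin r → Fin (g * K)) → Fin r → Fin K := fun x i =>
    ρ (bl i) (x (σ (colours κ x) i))
  have hsurj : ∀ x : Fin r → Fin (g * K), Good bl (colours κ x) → ∀ p b, colours κ x p = some b →
      ∃ i, bl i = b ∧ σ (colours κ x) i = p := by
    intro x hx p b hb
    refine ⟨(σ (colours κ x)).symm p, ?_, by simp⟩
    have h := hσ _ hx ((σ (colours κ x)).symm p)
    rw [Equiv.apply_symm_apply, hb] at h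
    exact (Option.some.inj h).symm
  refine ⟨ψ, ?_, ?_, ?_⟩
  · have hcount : ∀ y : Fin r → Fin K,
        (univ.filter fun x : Fin r → Fin (g * K) => Good bl (colours κ x) ∧ ψ x = y).card
        = (univ.filter fun v : Fin r → Option β => Good bl v).card * ∏ i, cellCount κ (bl i) := by
      intro y
      rw [card_eq_sum_card_fiberwise (f := colours κ) (t := univ.filter fun v => Good bl v)
        fun x hx => by simpa using (mem_filter.1 hx).2.1]
      refine sum_const_nat fun v hv => ?_
      have hv := (mem_filter.1 hv).2
      have : (univ.filter fun x : Fin r → Fin (g * K) => Good bl (colours κ x) ∧ ψ x = y).filter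
            (fun x => colours κ x = v)
          = Fintype.piFinset fun a => univ.filter fun z : Fin (g * K) =>
              κ z.divNat = some (bl ((σ v).symm a)) ∧
                ρ (bl ((σ v).symm a)) z = y ((σ v).symm a) := by
        ext x
        simp only [mem_filter, mem_univ, true_and, Fintype.mem_piFinset]
        constructor
        · rintro ⟨⟨_, rfl⟩, rfl⟩ a
          have h := hσ _ hv ((σ (colours κ x)).symm a)
          rw [Equiv.apply_symm_apply] at h
          exact ⟨h, by simp [ψ]⟩
        · intro h
          have hc : colours κ x = v := by
            funext a
            have h2 := hσ v hv ((σ v).symm a)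
            rw [Equiv.apply_symm_apply] at h2
            rw [h2]
            exact (h a).1
          refine ⟨⟨hc ▸ hv, ?_⟩, hc⟩
          funext i
          simp only [ψ, hc]
          simpa using (h (σ v i)).2
      rw [this, Fintype.card_piFinset, ← Equiv.prod_comp (σ v)]
      refine prod_congr rfl fun i _ => ?_
      rw [Equiv.symm_apply_apply]
      exact hρ3 _ _
    have : Nonempty (Fin r → Fin (g * K)) := ⟨fun _ => ⟨0, Nat.mul_pos hg hK⟩⟩
    have : Nonempty (Fin r → Fin K) := ⟨fun _ => ⟨0, hK⟩⟩
    have h := thins_unif (E := Fin r → Fin (g * K)) (F := Fin r → Fin K)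
      (G := fun x => Good bl (colours κ x)) (ψ := ψ) fun y => by convert hcount y
    have he : (((univ.filter fun v : Fin r → Option β => Good bl v).card *
          ∏ i, cellCount κ (bl i) : ℕ) : ℝ) * Fintype.card (Fin r → Fin K)
          / Fintype.card (Fin r → Fin (g * K)) = goodProb bl κ := by
      simp only [Fintype.card_pi, Fintype.card_fin, prod_const, card_univ, goodProb,
        prod_div_distrib]
      push_cast
      rw [mul_pow]
      have h1 : (g : ℝ) ≠ 0 := by positivity
      have h2 : (K : ℝ) ≠ 0 := by positivity
      field_simp
    rwa [he] at h
  · have key : ∀ x y, Good bl (colours κ x) → Good bl (colours κ y) →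
        (∀ a a', bl a = bl a' → ψ x a < ψ y a') → Before s κ x y := by
      intro x y hx hy h p q b hp hq
      obtain ⟨i, hi, rfl⟩ := hsurj x hx p b hp
      obtain ⟨j, hj, rfl⟩ := hsurj y hy q b hq
      have h1 := h i j (hi.trans hj.symm)
      simp only [ψ, hi, hj] at h1
      exact hρ1 b _ hp _ hq h1
    intro x y hx hy h
    exact h.imp (key x y hx hy) (key y x hy hx)
  · have key : ∀ x y, Good bl (colours κ x) → Good bl (colours κ y) →
        (∀ a a', ψ x a ≠ ψ y a') → Before s κ x y → ∀ a a', bl a = bl a' → ψ x a < ψ y a' := by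
      intro x y hx hy hne h a a' e
      have h1 := hσ _ hx a
      have h2 := hσ _ hy a'
      have h3 := hne a a'
      rw [← e] at h2
      simp only [ψ, ← e] at h3 ⊢
      exact hρ2 _ _ h1 _ h2 h3 (h _ _ _ h1 h2)
    intro x y hx hy hne h
    refine h.imp (key x y hx hy hne) fun h a a' e => ?_
    exact key y x hy hx (fun a a' => (hne a' a).symm) h a a' e

theorem goodProb_nonneg [Fintype β] : 0 ≤ goodProb bl κ := by
  unfold goodProb
  positivity

theorem goodProb_le_one [Fintype β] (hg : 0 < g) : goodProb bl κ ≤ 1 := by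
  obtain ⟨ψ, h, -⟩ := exists_thinning (bl := bl) (κ := κ) (s := fun _ => true) hg one_pos
  exact h.le_one (unif_pi_isProb (by simpa using hg)) (unif_pi_isProb one_pos)

end Colouring
end RandomMatching

namespace RandomMatching
open Finset

section Patterns
variable {r : ℕ} {β : Type*} [LinearOrder β] (bl : Fin r → β) (s : β → Bool)

/-- The interleaving of two increasing sequences prescribed by the block labels and signs. -/
def Interleaved {α : Type*} [LT α] (w w' : Fin r → α) : Prop :=
  ∀ p q, w p < w' q ↔ bl p < bl q ∨ bl p = bl q ∧ s (bl p) = true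

/-- The increasing rearrangements of two points are interleaved, in one of the two orders. -/
def Pat {N : ℕ} (x y : Fin r → Fin N) : Prop :=
  Interleaved bl s (x ∘ Tuple.sort x) (y ∘ Tuple.sort y) ∨
    Interleaved bl s (y ∘ Tuple.sort y) (x ∘ Tuple.sort x)

/-- Cells with smaller labels come first. -/
def ColourMono {g : ℕ} (κ : Fin g → Option β) : Prop :=
  ∀ u u' b b', u ≤ u' → κ u = some b → κ u' = some b' → b ≤ b'

variable {bl s}

theorem colours_sort (hbl : Monotone bl) {g K : ℕ} {κ : Fin g → Option β} (hκ : ColourMono κ)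
    {x : Fin r → Fin (g * K)} (hx : Good bl (colours κ x)) (p : Fin r) :
    colours κ x (Tuple.sort x p) = some (bl p) := by
  obtain ⟨σ, hσ⟩ := hx
  have h1 : ∀ p, colours κ x p = some (bl (σ.symm p)) := fun p => by
    rw [← hσ, Equiv.apply_symm_apply]
  have hm : Monotone (bl ∘ ((Tuple.sort x).trans σ.symm)) := fun p q hpq =>
    hκ _ _ _ _ (divNat_le_divNat (Tuple.monotone_sort x hpq)) (h1 _) (h1 _)
  have h2 := Tuple.unique_monotone (f := bl) (σ := (Tuple.sort x).trans σ.symm)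
    (τ := Equiv.refl _) hm hbl
  rw [h1]
  exact congrArg some (congrFun h2 p)

theorem Before.interleaved (hbl : Monotone bl) {g K : ℕ} {κ : Fin g → Option β}
    (hκ : ColourMono κ) {x y : Fin r → Fin (g * K)} (hx : Good bl (colours κ x))
    (hy : Good bl (colours κ y)) (h : Before s κ x y) :
    Interleaved bl s (x ∘ Tuple.sort x) (y ∘ Tuple.sort y) := by
  intro p q
  have hp := colours_sort hbl hκ hx p
  have hq := colours_sort hbl hκ hy q
  simp only [Function.comp_apply]
  rcases lt_trichotomy (bl p) (bl q) with hlt | heq | hgt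
  · refine iff_of_true (lt_of_not_ge fun hle => ?_) (Or.inl hlt)
    exact hlt.not_ge (hκ _ _ _ _ (divNat_le_divNat hle) hq hp)
  · have := h _ _ _ hp (heq ▸ hq)
    simp only [heq, lt_irrefl, false_or, true_and]
    unfold SLt at this
    rw [heq] at this
    split_ifs at this with hs
    · exact iff_of_true this hs
    · exact iff_of_false this.not_gt (by simpa using hs)
  · refine iff_of_false (fun hlt => ?_) (by rintro (h | h); exacts [h.not_gt hgt, hgt.ne' h.1])
    exact hgt.not_ge (hκ _ _ _ _ (divNat_le_divNat hlt.le) hp hq)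

theorem Pat.dom {N : ℕ} {x y : Fin r → Fin N} (h : Pat bl s x y)
    (hne : ∀ a a', x a ≠ y a') (hsort : Tuple.sort x = Tuple.sort y) :
    Dom (fun a => s (bl ((Tuple.sort x).symm a))) x y := by
  have key : ∀ {w w' : Fin r → Fin N}, (∀ a a', w a ≠ w' a') → Tuple.sort w = Tuple.sort w' →
      Interleaved bl s (w ∘ Tuple.sort w) (w' ∘ Tuple.sort w') →
      ∀ a, if s (bl ((Tuple.sort w).symm a)) then w a < w' a else w' a < w a := by
    intro w w' hne hsort h a
    have h1 := h ((Tuple.sort w).symm a) ((Tuple.sort w).symm a)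
    rw [← hsort] at h1
    simp only [Function.comp_apply, Equiv.apply_symm_apply, lt_irrefl, true_and, false_or] at h1
    split_ifs with hs
    · exact h1.2 hs
    · exact lt_of_le_of_ne (not_lt.1 fun hlt => hs (h1.1 hlt)) (hne a a).symm
  rcases h with h | h
  · exact Or.inl (key hne hsort h)
  · refine Or.inr fun a => ?_
    have := key (fun a a' => (hne a' a).symm) hsort.symm h a
    rwa [← hsort] at this

/-- All coordinates of all points are different. -/
def AllDistinct {ι : Type*} {N : ℕ} (x : ι → Fin r → Fin N) : Prop :=
  ∀ i j a a', x i a = x j a' → i = j ∧ a = a'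

theorem cl_pat_le_sum {ι : Type*} {N : ℕ} {x : ι → Fin r → Fin N} (hx : AllDistinct x)
    (T : Finset ι) : cl (Pat bl s) T x ≤
      ∑ σ : Equiv.Perm (Fin r), cl (Dom fun a => s (bl (σ.symm a))) T x := by
  classical
  obtain ⟨S, hS, hp, hc⟩ := exists_cl (Pat bl s) T x
  rw [← hc, card_eq_sum_card_fiberwise (f := fun i => Tuple.sort (x i)) (t := univ)
    fun _ _ => mem_univ _]
  refine sum_le_sum fun σ _ => le_cl ((filter_subset _ _).trans hS) ?_
  intro i hi j hj hij
  obtain ⟨hiS, rfl⟩ := mem_filter.1 hi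
  obtain ⟨hjS, hs⟩ := mem_filter.1 hj
  exact (hp i hiS j hjS hij).dom (fun a a' e => hij (hx i j a a' e).1) hs.symm

/-- The block label of a coordinate of a point. -/
def label {N : ℕ} (bl : Fin r → β) (x : Fin r → Fin N) (a : Fin r) : β :=
  bl ((Tuple.sort x).symm a)

theorem Pat.le_of_label_lt {N : ℕ} {x y : Fin r → Fin N} (h : Pat bl s x y) {a a' : Fin r}
    (hl : label bl x a < label bl y a') : x a ≤ y a' := by
  rcases h with h | h
  · have h1 := (h ((Tuple.sort x).symm a) ((Tuple.sort y).symm a')).2 (Or.inl hl)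
    simpa using h1.le
  · by_contra hlt
    have h1 := (h ((Tuple.sort y).symm a') ((Tuple.sort x).symm a)).1 (by simpa using hlt)
    rcases h1 with h1 | h1
    · exact h1.not_gt hl
    · exact hl.ne' h1.1

theorem le_of_label_lt (hbl : Monotone bl) {N : ℕ} {x : Fin r → Fin N} {a a' : Fin r}
    (hl : label bl x a < label bl x a') : x a ≤ x a' := by
  have := Tuple.monotone_sort x (hbl.reflect_lt hl).le
  simpa using this

theorem Interleaved.before {g K : ℕ} {κ : Fin g → Option β} {x y : Fin r → Fin (g * K)}
    (h : Interleaved bl s (x ∘ Tuple.sort x) (y ∘ Tuple.sort y)) (hne : ∀ a a', x a ≠ y a')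
    (hx : ∀ a, colours κ x a = some (label bl x a))
    (hy : ∀ a, colours κ y a = some (label bl y a)) : Before s κ x y := by
  intro p q b hp hq
  rw [hx] at hp
  rw [hy] at hq
  have hp := Option.some.inj hp
  have hq := Option.some.inj hq
  have h1 := h ((Tuple.sort x).symm p) ((Tuple.sort y).symm q)
  unfold label at hp hq
  simp only [Function.comp_apply, Equiv.apply_symm_apply, hp, hq, lt_irrefl, false_or,
    true_and] at h1
  unfold SLt
  split_ifs with hs
  · exact h1.2 hs
  · exact lt_of_le_of_ne (not_lt.1 fun hlt => hs (h1.1 hlt)) (hne p q).symm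

open Classical in
theorem exists_colouring (hbl : Monotone bl) [Fintype β] {ι : Type*} {g K : ℕ}
    {x : ι → Fin r → Fin (g * K)} (S : Finset ι)
    (hS : PairRel (Pat bl s) x S) : ∃ (κ : Fin g → Option β) (U : Finset (Fin g)),
      U.card ≤ Fintype.card β ∧ ∀ i ∈ S, (∀ a, (x i a).divNat ∉ U) →
        ∀ a, colours κ (x i) a = some (label bl (x i) a) := by
  have hsep : ∀ i ∈ S, ∀ j ∈ S, ∀ a a', label bl (x i) a < label bl (x j) a' →
      x i a ≤ x j a' := by
    intro i hi j hj a a' hl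
    by_cases hij : i = j
    · subst hij
      exact le_of_label_lt hbl hl
    · exact (hS i hi j hj hij).le_of_label_lt hl
  let occ : Fin g → β → Prop := fun u b =>
    ∃ i ∈ S, ∃ a, (x i a).divNat = u ∧ label bl (x i) a = b
  have hocc : ∀ u u' b b', u < u' → occ u b → occ u' b' → b ≤ b' := by
    rintro u u' b b' huu ⟨i, hi, a, rfl, rfl⟩ ⟨j, hj, a', rfl, rfl⟩
    by_contra hlt
    exact (lt_of_divNat_lt huu).not_ge (hsep j hj i hi a' a (not_le.1 hlt))
  let U : Finset (Fin g) := univ.filter fun u => ∃ b b', b < b' ∧ occ u b ∧ occ u b'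
  refine ⟨fun u => if h : ∃ b, occ u b then some h.choose else none, U, ?_, ?_⟩
  · have hU : ∀ u : U, ∃ b b', b < b' ∧ occ u b ∧ occ u b' := fun u => (mem_filter.1 u.2).2
    choose f f' hff hf hf' using hU
    have hmono : StrictMono f := fun u v huv => (hff u).trans_le (hocc u v _ _ huv (hf' u) (hf v))
    simpa using Fintype.card_le_of_injective f hmono.injective
  · intro i hi hU a
    have h : ∃ b, occ (x i a).divNat b := ⟨_, i, hi, a, rfl, rfl⟩
    simp only [colours, h, dif_pos]
    refine congrArg some ?_
    by_contra hne
    refine hU a (mem_filter.2 ⟨mem_univ _, ?_⟩)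
    rcases lt_or_gt_of_ne hne with hlt | hlt
    · exact ⟨_, _, hlt, h.choose_spec, i, hi, a, rfl, rfl⟩
    · exact ⟨_, _, hlt, ⟨i, hi, a, rfl, rfl⟩, h.choose_spec⟩

open Classical in
theorem cl_pat_le (hbl : Monotone bl) [Fintype β] {ι : Type*} [Fintype ι] {g K m : ℕ}
    {ψ : (Fin g → Option β) → (Fin r → Fin (g * K)) → Fin r → Fin K}
    (hψ : ∀ κ x y, Good bl (colours κ x) → Good bl (colours κ y) → (∀ a a', ψ κ x a ≠ ψ κ y a') →
        Before s κ x y ∨ Before s κ y x → Chain bl (ψ κ x) (ψ κ y))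
    {x : ι → Fin r → Fin (g * K)} (hx : AllDistinct x)
    (htie : ∀ κ, ¬ Tie (univ.filter fun i => Good bl (colours κ (x i))) (ψ κ ∘ x))
    (hm : ∀ u a, cl (Pat bl s) (univ.filter fun i => (x i a).divNat = u) x ≤ m) :
    ∃ κ, cl (Pat bl s) univ x ≤
      cl (Chain bl) (univ.filter fun i => Good bl (colours κ (x i))) (ψ κ ∘ x)
        + Fintype.card β * (r * m) := by
  obtain ⟨S, -, hS, hc⟩ := exists_cl (Pat bl s) univ x
  obtain ⟨κ, U, hU, hκ⟩ := exists_colouring hbl S hS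
  refine ⟨κ, ?_⟩
  rw [← hc, ← card_filter_add_card_filter_not (s := S) (fun i => ∀ a, (x i a).divNat ∉ U)]
  have hgood : ∀ i ∈ S, (∀ a, (x i a).divNat ∉ U) → Good bl (colours κ (x i)) :=
    fun i hi h => ⟨Tuple.sort (x i), fun a => by rw [hκ i hi h]; simp [label]⟩
  refine add_le_add (le_cl (fun i hi => ?_) ?_) ?_
  · exact mem_filter.2 ⟨mem_univ _, hgood i (mem_filter.1 hi).1 (mem_filter.1 hi).2⟩
  · intro i hi j hj hij
    obtain ⟨hi, hiU⟩ := mem_filter.1 hi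
    obtain ⟨hj, hjU⟩ := mem_filter.1 hj
    have hgi := hgood i hi hiU
    have hgj := hgood j hj hjU
    refine hψ κ _ _ hgi hgj (fun a a' e => htie κ ⟨i, by simpa using hgi, j, by simpa using hgj,
      hij, a, a', e⟩) ?_
    refine (hS i hi j hj hij).imp (fun h => ?_) fun h => ?_
    · exact h.before (fun a a' e => hij (hx i j a a' e).1) (hκ i hi hiU) (hκ j hj hjU)
    · exact h.before (fun a a' e => hij (hx j i a a' e).1.symm) (hκ j hj hjU) (hκ i hi hiU)
  · calc (S.filter fun i => ¬ ∀ a, (x i a).divNat ∉ U).card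
        ≤ (U.biUnion fun u => univ.biUnion fun a : Fin r =>
            S.filter fun i => (x i a).divNat = u).card := by
          refine card_le_card fun i hi => ?_
          obtain ⟨hi, h⟩ := mem_filter.1 hi
          push Not at h
          obtain ⟨a, ha⟩ := h
          simp only [mem_biUnion, mem_univ, true_and, mem_filter]
          exact ⟨_, ha, a, hi, rfl⟩
      _ ≤ U.card * (r * m) := by
          refine card_biUnion_le_card_mul _ _ _ fun u _ => ?_
          refine (card_biUnion_le_card_mul _ _ m fun a _ => ?_).trans (by simp)
          refine (le_cl (fun i hi => ?_) fun i hi j hj => ?_).trans (hm u a)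
          · exact mem_filter.2 ⟨mem_univ _, (mem_filter.1 hi).2⟩
          · exact hS i (mem_filter.1 hi).1 j (mem_filter.1 hj).1
      _ ≤ _ := Nat.mul_le_mul_right _ hU

end Patterns
end RandomMatching

namespace RandomMatching
open Finset Filter Topology

section BestColouring
variable {r : ℕ} {β : Type*} [LinearOrder β] [Fintype β]

/-- The supremum of the probabilities `goodProb` over all colourings. -/
noncomputable def bestProb (bl : Fin r → β) : ℝ :=
  ⨆ κ : Σ g : ℕ, Fin (g + 1) → Option β, goodProb bl κ.2

variable {bl : Fin r → β}

theorem bddAbove_goodProb :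
    BddAbove (Set.range fun κ : Σ g : ℕ, Fin (g + 1) → Option β => goodProb bl κ.2) :=
  ⟨1, by rintro _ ⟨κ, rfl⟩; exact goodProb_le_one κ.1.succ_pos⟩

theorem goodProb_le_bestProb {g : ℕ} (hg : 0 < g) (κ : Fin g → Option β) :
    goodProb bl κ ≤ bestProb bl := by
  obtain ⟨g, rfl⟩ := Nat.exists_eq_succ_of_ne_zero hg.ne'
  exact le_ciSup (bddAbove_goodProb (bl := bl)) ⟨g, κ⟩

theorem bestProb_pos [Nonempty (Fin r)] (bl : Fin r → β) : 0 < bestProb bl := by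
  classical
  have : Nonempty β := ⟨bl (Classical.arbitrary _)⟩
  refine lt_of_lt_of_le ?_ (goodProb_le_bestProb (Fintype.card_pos (α := β))
    fun u => some ((Fintype.equivFin β).symm u))
  refine mul_pos ?_ (prod_pos fun i _ => div_pos ?_ (by exact_mod_cast Fintype.card_pos))
  · exact_mod_cast card_pos.2 ⟨fun i => some (bl i), by simpa using ⟨1, fun i => rfl⟩⟩
  · exact_mod_cast card_pos.2 ⟨Fintype.equivFin β (bl i), by simp⟩

theorem exists_colourMono {g : ℕ} (κ : Fin g → Option β) :
    ∃ κ' : Fin g → Option β, ColourMono κ' ∧ goodProb bl κ' = goodProb bl κ := by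
  let f : Fin g → WithTop β := κ
  refine ⟨κ ∘ Tuple.sort f, fun u u' b b' h hb hb' => ?_, ?_⟩
  · have h1 : f (Tuple.sort f u) ≤ f (Tuple.sort f u') := Tuple.monotone_sort f h
    have h2 : f (Tuple.sort f u) = (b : WithTop β) := hb
    have h3 : f (Tuple.sort f u') = (b' : WithTop β) := hb'
    rw [h2, h3] at h1
    exact WithTop.coe_le_coe.1 h1
  · have : cellCount (κ ∘ Tuple.sort f) = cellCount κ := by
      funext b
      exact card_equiv (Tuple.sort f) fun u => by simp
    simp only [goodProb, this]

theorem exists_near_best {δ : ℝ} (hδ : 0 < δ) : ∃ (g : ℕ) (κ : Fin g → Option β), 0 < g ∧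
    ColourMono κ ∧ |goodProb bl κ - bestProb bl| ≤ δ := by
  have : Nonempty (Σ g : ℕ, Fin (g + 1) → Option β) := ⟨⟨0, fun _ => none⟩⟩
  obtain ⟨⟨g, κ⟩, h⟩ := exists_lt_of_lt_ciSup
    (show bestProb bl - δ < ⨆ κ : Σ g : ℕ, Fin (g + 1) → Option β, goodProb bl κ.2 from
      sub_lt_self _ hδ)
  obtain ⟨κ', hκ, he⟩ := exists_colourMono (bl := bl) κ
  refine ⟨g + 1, κ', g.succ_pos, hκ, ?_⟩
  have h1 := goodProb_le_bestProb (bl := bl) g.succ_pos κ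
  rw [abs_sub_comm, abs_of_nonneg] <;> rw [he] <;> simp only at h <;> linarith

variable {s : β → Bool} {c : ℝ}

theorem Pr_pat_le [Nonempty (Fin r)] (hr : r ≠ 0) (hbl : Monotone bl) (hc0 : 0 ≤ c)
    (hc : Tendsto (fun n : ℕ => chainLim bl n / (n : ℝ) ^ (1 / r : ℝ)) atTop (𝓝 c))
    {ε : ℝ} (hε : 0 < ε) : ∃ g : ℕ, 0 < g ∧ ∀ᶠ n : ℕ in atTop, ∀ᶠ K : ℕ in atTop,
      Pr (unif (Fin r → Fin (g * K))) (fun x : Fin n → Fin r → Fin (g * K) =>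
        (cl (Pat bl s) univ x : ℝ) ≤
          (c * bestProb bl ^ (1 / r : ℝ) - ε) * (n : ℝ) ^ (1 / r : ℝ)) ≤ ε := by
  classical
  have hr1 : (1 / r : ℝ) ≤ 1 := by
    rw [div_le_one (by positivity)]
    exact_mod_cast Nat.one_le_iff_ne_zero.2 hr
  obtain ⟨δ, hδ, hδε⟩ : ∃ δ : ℝ, 0 < δ ∧ c * δ ^ (1 / r : ℝ) ≤ ε / 2 := by
    refine ⟨(ε / (2 * (c + 1))) ^ r, by positivity, ?_⟩
    rw [one_div, Real.pow_rpow_inv_natCast (by positivity) hr]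
    rw [← mul_div_assoc, div_le_div_iff₀ (by positivity) (by positivity)]
    nlinarith
  obtain ⟨g, κ, hg, hκ, hp⟩ := exists_near_best (bl := bl) hδ
  have hp0 : 0 ≤ goodProb bl κ := goodProb_nonneg
  have hp1 : goodProb bl κ ≤ 1 := goodProb_le_one hg
  refine ⟨g, hg, ?_⟩
  filter_upwards [Pr_thinned_chain_deviation (bl := bl) hr hc0 hc hp0 hp1 (half_pos hε)] with n hn
  filter_upwards [hn, eventually_gt_atTop 0] with K hK hK0
  obtain ⟨ψ, hth, h1, -⟩ := exists_thinning (bl := bl) (κ := κ) (s := s) hg hK0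
  have hμ := unif_pi_isProb (r := r) (Nat.mul_pos hg hK0)
  refine le_trans (Pr_mono hμ fun x hx => Or.inl ?_)
    ((hK _ _ _ _ hμ hth).trans (half_le_self hε.le))
  have hle : cl (Chain bl) (univ.filter fun i => Good bl (colours κ (x i))) (ψ ∘ x)
      ≤ cl (Pat bl s) univ x := by
    refine cl_mono (subset_univ _) fun i hi j hj _ h => ?_
    have hi := (mem_filter.1 hi).2
    have hj := (mem_filter.1 hj).2
    exact (h1 _ _ hi hj h).imp (Before.interleaved hbl hκ hi hj) (Before.interleaved hbl hκ hj hi)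
  have hle : (cl (Chain bl) (univ.filter fun i => Good bl (colours κ (x i))) (ψ ∘ x) : ℝ)
      ≤ cl (Pat bl s) univ x := by exact_mod_cast hle
  have h2 : c * bestProb bl ^ (1 / r : ℝ) - ε / 2 ≤ c * goodProb bl κ ^ (1 / r : ℝ) := by
    have h3 := (abs_rpow_sub_rpow_le (a := 1 / r) hp0 (bestProb_pos bl).le (by positivity) hr1).trans
      (Real.rpow_le_rpow (abs_nonneg _) hp (by positivity))
    have h4 := mul_le_mul_of_nonneg_left ((abs_le.1 h3).1) hc0
    linarith [mul_sub c (goodProb bl κ ^ (1 / r : ℝ)) (bestProb bl ^ (1 / r : ℝ))]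
  rw [abs_sub_comm, Real.mul_rpow hp0 (Nat.cast_nonneg n)]
  refine le_trans ?_ (le_abs_self _)
  have h5 := mul_le_mul_of_nonneg_right h2
    (show (0 : ℝ) ≤ (n : ℝ) ^ (1 / r : ℝ) by positivity)
  linarith

open Classical in
theorem Pr_cell_le [Nonempty (Fin r)] {g K n k : ℕ} (hr : r ≠ 0) (hg : 0 < g) (hK : 0 < K)
    (hk : 4 * Real.exp 1 * (n / g : ℝ) ^ (1 / r : ℝ) ≤ k) (t : Fin r → Bool) (u : Fin g)
    (a : Fin r) :
    Pr (unif (Fin r → Fin (g * K))) (fun x : Fin n → Fin r → Fin (g * K) =>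
      k ≤ cl (Dom t) (univ.filter fun i => (x i a).divNat = u) x) ≤ (1 / 4 : ℝ) ^ k := by
  let A : Fin r → Finset (Fin (g * K)) := fun a' =>
    if a' = a then univ.filter fun z => z.divNat = u else univ
  have hA : ∀ y : Fin r → Fin (g * K), (∀ a', y a' ∈ A a') ↔ (y a).divNat = u := by
    intro y
    refine ⟨fun h => by simpa [A] using h a, fun h a' => ?_⟩
    by_cases e : a' = a
    · subst e
      simpa [A] using h
    · simp [A, e]
  have hprod : ∏ a', ((A a').card / (g * K : ℕ) : ℝ) = 1 / g := by
    rw [prod_eq_single a]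
    · simp only [A, if_pos, card_filter_divNat]
      push_cast
      have : (K : ℝ) ≠ 0 := by positivity
      have : (g : ℝ) ≠ 0 := by positivity
      field_simp
    · intro a' _ h
      simp only [A, h, if_false, card_univ, Fintype.card_fin]
      exact div_self (by exact_mod_cast (Nat.mul_pos hg hK).ne')
    · simp
  have h := Pr_dom_le (n := n) (k := k) (Nat.mul_pos hg hK) t A (by
    rw [hprod, mul_one_div]
    calc (4 * Real.exp 1) ^ r * (n / g : ℝ)
        = (4 * Real.exp 1 * (n / g : ℝ) ^ (1 / r : ℝ)) ^ r := by
          rw [mul_pow _ ((n / g : ℝ) ^ (1 / r : ℝ)), rpow_inv_pow hr (by positivity)]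
      _ ≤ _ := by gcongr)
  simpa only [hA] using h

theorem exists_thinnings {g K : ℕ} (hg : 0 < g) (hK : 0 < K) :
    ∃ ψ : (Fin g → Option β) → (Fin r → Fin (g * K)) → Fin r → Fin K, ∀ κ,
      Thins (unif (Fin r → Fin (g * K))) (unif (Fin r → Fin K)) (fun x => Good bl (colours κ x))
        (ψ κ) (goodProb bl κ) ∧
      ∀ x y, Good bl (colours κ x) → Good bl (colours κ y) → (∀ a a', ψ κ x a ≠ ψ κ y a') →
        Before s κ x y ∨ Before s κ y x → Chain bl (ψ κ x) (ψ κ y) := by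
  choose ψ h1 _ h2 using fun κ => exists_thinning (bl := bl) (κ := κ) (s := s) hg hK
  exact ⟨ψ, fun κ => ⟨h1 κ, h2 κ⟩⟩

theorem Pr_le_pat [Nonempty (Fin r)] (hr : r ≠ 0) (hbl : Monotone bl) (hc0 : 0 ≤ c)
    (hc : Tendsto (fun n : ℕ => chainLim bl n / (n : ℝ) ^ (1 / r : ℝ)) atTop (𝓝 c))
    {ε : ℝ} (hε : 0 < ε) : ∃ g : ℕ, 0 < g ∧ ∀ᶠ n : ℕ in atTop, ∀ᶠ K : ℕ in atTop,
      Pr (unif (Fin r → Fin (g * K))) (fun x : Fin n → Fin r → Fin (g * K) => AllDistinct x ∧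
        (c * bestProb bl ^ (1 / r : ℝ) + ε) * (n : ℝ) ^ (1 / r : ℝ) ≤
          (cl (Pat bl s) univ x : ℝ)) ≤ ε := by
  classical
  set D : ℝ := Fintype.card β * (r * Fintype.card (Equiv.Perm (Fin r))) with hD
  have hD0 : 0 ≤ D := by positivity
  obtain ⟨g, hgD, hg⟩ := (((tendsto_natCast_rpow hr).eventually_ge_atTop
    (D * (4 * Real.exp 1) / (ε / 4))).and (eventually_gt_atTop 0)).exists
  rw [div_le_iff₀ (by positivity)] at hgD
  have hg' : (0 : ℝ) < (g : ℝ) ^ (1 / r : ℝ) := by positivity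
  let M : ℝ := Fintype.card (Fin g → Option β)
  have hM : 0 ≤ M := by positivity
  let ε' : ℝ := ε / (2 * (M + 1))
  have hε' : 0 < ε' := by positivity
  have hε'2 : ε' ≤ ε / 2 := by
    refine div_le_div_of_nonneg_left hε.le (by positivity) (by linarith)
  let k : ℕ → ℕ := fun n => ⌈4 * Real.exp 1 * (n / g : ℝ) ^ (1 / r : ℝ)⌉₊
  have hkdiv : ∀ n : ℕ, (n / g : ℝ) ^ (1 / r : ℝ) = (n : ℝ) ^ (1 / r : ℝ) / (g : ℝ) ^ (1 / r : ℝ) :=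
    fun n => Real.div_rpow (by positivity) (by positivity) _
  have hk : Tendsto k atTop atTop := by
    refine tendsto_nat_ceil_atTop.comp (Tendsto.const_mul_atTop (by positivity) ?_)
    simp only [hkdiv]
    exact (tendsto_natCast_rpow hr).atTop_div_const hg'
  let P : ℝ := Fintype.card ((Fin g × Fin r) × Equiv.Perm (Fin r))
  have hsmall : ∀ᶠ n in atTop, P * (1 / 4 : ℝ) ^ k n < ε / 2 := by
    have h := ((tendsto_pow_atTop_nhds_zero_of_lt_one (r := (1 / 4 : ℝ)) (by norm_num)
      (by norm_num)).comp hk).const_mul P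
    rw [mul_zero] at h
    exact h.eventually_lt_const (by positivity)
  refine ⟨g, hg, ?_⟩
  have hall : ∀ᶠ n : ℕ in atTop, ∀ κ : Fin g → Option β, ∀ᶠ K : ℕ in atTop,
      ∀ (E : Type) [Fintype E] (μ : E → ℝ) (G : E → Prop) (ψ : E → Fin r → Fin K),
        IsProb μ → Thins μ (unif (Fin r → Fin K)) G ψ (goodProb bl κ) →
        Pr μ (fun x : Fin n → E => ChainBad bl (ε' * (n : ℝ) ^ (1 / r : ℝ))
          (c * (goodProb bl κ * n) ^ (1 / r : ℝ)) (univ.filter fun i => G (x i)) (ψ ∘ x)) ≤ ε' :=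
    eventually_all.2 fun κ => by
      simpa only using Pr_thinned_chain_deviation (bl := bl) hr hc0 hc goodProb_nonneg
        (goodProb_le_one (κ := κ) hg) hε'
  filter_upwards [hall, hsmall, (tendsto_natCast_rpow hr).eventually_ge_atTop (D / (ε / 4))]
    with n hn hnk hnD
  rw [div_le_iff₀ (by positivity)] at hnD
  filter_upwards [eventually_all.2 hn, eventually_gt_atTop 0] with K hK hK0
  obtain ⟨ψ, hψ⟩ := exists_thinnings (bl := bl) (s := s) hg hK0
  have hμ := unif_pi_isProb (r := r) (Nat.mul_pos hg hK0)
  let A : (Fin g → Option β) → (Fin n → Fin r → Fin (g * K)) → Prop := fun κ x =>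
    ChainBad bl (ε' * (n : ℝ) ^ (1 / r : ℝ)) (c * (goodProb bl κ * n) ^ (1 / r : ℝ))
      (univ.filter fun i => Good bl (colours κ (x i))) (ψ κ ∘ x)
  let B : (Fin g × Fin r) × Equiv.Perm (Fin r) → (Fin n → Fin r → Fin (g * K)) → Prop :=
    fun q x => k n ≤ cl (Dom fun a => s (bl (q.2.symm a)))
      (univ.filter fun i => (x i q.1.2).divNat = q.1.1) x
  have hA : ∀ κ, Pr (unif (Fin r → Fin (g * K))) (A κ) ≤ ε' := fun κ =>
    hK κ (Fin r → Fin (g * K)) (unif _) (fun x => Good bl (colours κ x)) (ψ κ) hμ (hψ κ).1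
  have hB : ∀ q, Pr (unif (Fin r → Fin (g * K))) (B q) ≤ (1 / 4 : ℝ) ^ k n := fun q =>
    Pr_cell_le hr hg hK0 (Nat.le_ceil _) _ _ _
  refine le_trans (Pr_mono hμ (B := fun x => (∃ κ ∈ univ, A κ x) ∨ ∃ q ∈ univ, B q x) ?_) ?_
  · rintro x ⟨hx, hxc⟩
    by_contra hcon
    push Not at hcon
    obtain ⟨hxA, hxB⟩ := hcon
    have hm : ∀ u a, cl (Pat bl s) (univ.filter fun i => (x i a).divNat = u) x ≤
        Fintype.card (Equiv.Perm (Fin r)) * k n := by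
      intro u a
      refine (cl_pat_le_sum hx _).trans ?_
      refine (sum_le_card_nsmul _ _ (k n) fun σ _ => ?_).trans (by simp [card_univ])
      have := hxB ((u, a), σ) (mem_univ _)
      exact (not_le.1 this).le
    obtain ⟨κ, hκ⟩ := cl_pat_le hbl (ψ := ψ) (fun κ => (hψ κ).2) hx
      (fun κ ht => hxA κ (mem_univ _) (Or.inr ht)) hm
    have h1 : |(cl (Chain bl) (univ.filter fun i => Good bl (colours κ (x i))) (ψ κ ∘ x) : ℝ)
        - c * (goodProb bl κ * n) ^ (1 / r : ℝ)| < ε' * (n : ℝ) ^ (1 / r : ℝ) :=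
      lt_of_not_ge fun h => hxA κ (mem_univ _) (Or.inl h)
    have h2 := (abs_lt.1 h1).2
    have h3 : (cl (Pat bl s) univ x : ℝ) ≤
        (cl (Chain bl) (univ.filter fun i => Good bl (colours κ (x i))) (ψ κ ∘ x) : ℝ)
          + D * k n := by
      refine (Nat.cast_le.2 hκ).trans (le_of_eq ?_)
      rw [hD]
      push_cast
      ring
    have hn0 : (0 : ℝ) ≤ (n : ℝ) ^ (1 / r : ℝ) := by positivity
    have h4 : D * k n ≤ ε / 2 * (n : ℝ) ^ (1 / r : ℝ) := by
      have h5 : (k n : ℝ) ≤ 4 * Real.exp 1 * (n / g : ℝ) ^ (1 / r : ℝ) + 1 :=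
        (Nat.ceil_lt_add_one (by positivity)).le
      have h6 : D * (4 * Real.exp 1 * (n / g : ℝ) ^ (1 / r : ℝ)) ≤
          ε / 4 * (n : ℝ) ^ (1 / r : ℝ) := by
        rw [hkdiv, ← mul_assoc, ← mul_div_assoc, div_le_iff₀ hg']
        nlinarith
      have h7 := mul_le_mul_of_nonneg_left h5 hD0
      linarith
    have h5 : c * (goodProb bl κ * n) ^ (1 / r : ℝ) ≤
        c * bestProb bl ^ (1 / r : ℝ) * (n : ℝ) ^ (1 / r : ℝ) := by
      rw [mul_assoc, Real.mul_rpow goodProb_nonneg (Nat.cast_nonneg n)]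
      have := goodProb_le_bestProb (bl := bl) hg κ
      have : (0 : ℝ) ≤ goodProb bl κ := goodProb_nonneg
      gcongr
    have h6 := mul_le_mul_of_nonneg_right hε'2 hn0
    linarith
  · refine (Pr_or_le hμ _ _).trans ?_
    refine (add_le_add ((Pr_exists_le hμ _ _).trans (sum_le_card_nsmul _ _ _ fun κ _ => hA κ))
      ((Pr_exists_le hμ _ _).trans (sum_le_card_nsmul _ _ _ fun q _ => hB q))).trans ?_
    rw [nsmul_eq_mul, nsmul_eq_mul, card_univ, card_univ]
    have h1 : M * ε' ≤ ε / 2 := by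
      simp only [ε']
      rw [← mul_div_assoc, div_le_div_iff₀ (by positivity) (by positivity)]
      nlinarith
    have h2 := hnk.le
    simp only [M, P] at h1 h2
    linarith

end BestColouring
end RandomMatching

namespace RandomMatching
open Finset

theorem finset_pair_eq_pair_iff {α : Type*} [DecidableEq α] {x y z w : α} :
    ({x, y} : Finset α) = {z, w} ↔ x = z ∧ y = w ∨ x = w ∧ y = z := by
  rw [← Set.pair_eq_pair_iff, ← coe_inj]
  simp

theorem eq_of_image_eq {r : ℕ} {f g : Fin r → ℕ} (hf : StrictMono f) (hg : StrictMono g)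
    (h : univ.image f = univ.image g) : f = g := by
  refine (hf.range_inj hg).1 ?_
  rw [← coe_inj] at h
  simpa using h

section Realization
variable {r : ℕ} {β : Type*} [LinearOrder β] {bl : Fin r → β} {s : β → Bool}

/-- The pattern `P` consists of two interleaved edges with the given block labels and signs. -/
def Realizes (bl : Fin r → β) (s : β → Bool) (P : Finset (Finset ℕ)) : Prop :=
  ∃ A B : Fin r → ℕ, StrictMono A ∧ StrictMono B ∧ (∀ p q, A p ≠ B q) ∧
    P = {univ.image A, univ.image B} ∧ Interleaved bl s A B

theorem formsPattern_of_interleaved {A B X Y : Fin r → ℕ} (hA : StrictMono A) (hB : StrictMono B)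
    (hAB : ∀ p q, A p ≠ B q) (hX : StrictMono X) (hY : StrictMono Y) (hXY : ∀ p q, X p ≠ Y q)
    (h : ∀ p q, X p < Y q ↔ A p < B q) :
    FormsPattern (univ.image X) (univ.image Y) {univ.image A, univ.image B} := by
  let φ : ℕ → ℕ := Function.extend X A (Function.extend Y B 0)
  have hφX : ∀ p, φ (X p) = A p := fun p => hX.injective.extend_apply _ _ _
  have hφY : ∀ q, φ (Y q) = B q := fun q => by
    have : ¬ ∃ p, X p = Y q := fun ⟨p, hp⟩ => hXY p q hp
    simp only [φ, Function.extend_apply' _ _ _ this, hY.injective.extend_apply]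
  refine ⟨φ, ?_, ?_⟩
  · intro v hv w hw hlt
    simp only [coe_union, coe_image, coe_univ, Set.image_univ, Set.mem_union, Set.mem_range] at hv hw
    obtain ⟨p, rfl⟩ | ⟨p, rfl⟩ := hv <;> obtain ⟨q, rfl⟩ | ⟨q, rfl⟩ := hw
    · rw [hφX, hφX]
      exact hA (hX.lt_iff_lt.1 hlt)
    · rw [hφX, hφY]
      exact (h p q).1 hlt
    · rw [hφX, hφY]
      exact lt_of_le_of_ne (not_lt.1 fun h1 => ((h q p).2 h1).not_gt hlt) (hAB q p).symm
    · rw [hφY, hφY]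
      exact hB (hY.lt_iff_lt.1 hlt)
  · rw [image_image, image_image]
    have h1 : φ ∘ X = A := funext hφX
    have h2 : φ ∘ Y = B := funext hφY
    rw [h1, h2]

theorem formsPattern_iff {A B X Y : Fin r → ℕ} (hA : StrictMono A) (hB : StrictMono B)
    (hAB : ∀ p q, A p ≠ B q) (hX : StrictMono X) (hY : StrictMono Y) (hXY : ∀ p q, X p ≠ Y q) :
    FormsPattern (univ.image X) (univ.image Y) {univ.image A, univ.image B} ↔
      (∀ p q, X p < Y q ↔ A p < B q) ∨ ∀ p q, Y p < X q ↔ A p < B q := by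
  constructor
  · rintro ⟨φ, hφ, he⟩
    have hmX : ∀ p, X p ∈ ((univ.image X ∪ univ.image Y : Finset ℕ) : Set ℕ) := fun p => by simp
    have hmY : ∀ p, Y p ∈ ((univ.image X ∪ univ.image Y : Finset ℕ) : Set ℕ) := fun p => by simp
    have h1 : StrictMono (φ ∘ X) := fun p q h => hφ (hmX p) (hmX q) (hX h)
    have h2 : StrictMono (φ ∘ Y) := fun p q h => hφ (hmY p) (hmY q) (hY h)
    rw [image_image, image_image, finset_pair_eq_pair_iff] at he
    rcases he with ⟨he1, he2⟩ | ⟨he1, he2⟩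
    · refine Or.inl fun p q => ?_
      rw [← eq_of_image_eq h1 hA he1, ← eq_of_image_eq h2 hB he2]
      exact (hφ.lt_iff_lt (hmX p) (hmY q)).symm
    · refine Or.inr fun p q => ?_
      rw [← eq_of_image_eq h1 hB he1, ← eq_of_image_eq h2 hA he2]
      exact (hφ.lt_iff_lt (hmY p) (hmX q)).symm
  · rintro (h | h)
    · exact formsPattern_of_interleaved hA hB hAB hX hY hXY h
    · obtain ⟨φ, h1, h2⟩ := formsPattern_of_interleaved hA hB hAB hY hX
        (fun p q => (hXY q p).symm) h
      exact ⟨φ, by rwa [union_comm], by rwa [pair_comm]⟩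

theorem Realizes.formsPattern_iff {P : Finset (Finset ℕ)} (hP : Realizes bl s P)
    {X Y : Fin r → ℕ} (hX : StrictMono X) (hY : StrictMono Y) (hXY : ∀ p q, X p ≠ Y q) :
    FormsPattern (univ.image X) (univ.image Y) P ↔
      Interleaved bl s X Y ∨ Interleaved bl s Y X := by
  obtain ⟨A, B, hA, hB, hAB, rfl, hI⟩ := hP
  simp only [RandomMatching.formsPattern_iff hA hB hAB hX hY hXY, Interleaved, hI _ _]

end Realization

section Edges
variable {r n m : ℕ}

/-- The edges of the labelled matching `y`. -/
def edges (y : Fin n × Fin r → Fin m) : Finset (Finset ℕ) :=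
  univ.image fun i => univ.image fun a => (y (i, a) : ℕ) + 1

theorem edges_comp (θ : Fin m → Fin m) : ∃ T : Finset (Finset ℕ) → Finset (Finset ℕ),
    ∀ y : Fin n × Fin r → Fin m, edges (θ ∘ y) = T (edges y) := by
  let t : ℕ → ℕ := fun v => if h : v - 1 < m then θ ⟨v - 1, h⟩ + 1 else 0
  refine ⟨fun M => M.image fun e => e.image t, fun y => ?_⟩
  simp only [edges, image_image]
  refine congrArg (image · univ) (funext fun i => ?_)
  simp only [Function.comp_apply, image_image]
  refine congrArg (image · univ) (funext fun a => ?_)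
  simp [t]

theorem edge_injective (hr : r ≠ 0) {y : Fin n × Fin r → Fin m} (hy : Function.Injective y) :
    Function.Injective fun i => univ.image fun a => (y (i, a) : ℕ) + 1 := by
  intro i j h
  have : (y (i, ⟨0, Nat.pos_of_ne_zero hr⟩) : ℕ) + 1 ∈ univ.image fun a => (y (j, a) : ℕ) + 1 := by
    rw [← show _ = univ.image _ from h]
    exact mem_image_of_mem _ (mem_univ _)
  obtain ⟨a, -, ha⟩ := mem_image.1 this
  exact (congrArg Prod.fst (hy (Fin.ext (Nat.succ_injective ha)))).symm

theorem edges_isOrderedMatching (hr : r ≠ 0) {y : Fin n × Fin r → Fin (r * n)}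
    (hy : Function.Bijective y) : IsOrderedMatching r n (edges y) := by
  refine ⟨?_, ?_, ?_, ?_⟩
  · rw [edges, card_image_of_injective _ (edge_injective hr hy.1), card_univ, Fintype.card_fin]
  · intro e he
    obtain ⟨i, -, rfl⟩ := mem_image.1 he
    rw [card_image_of_injective, card_univ, Fintype.card_fin]
    intro a b h
    exact congrArg Prod.snd (hy.1 (Fin.ext (Nat.succ_injective h)))
  · intro e he f hf hne
    obtain ⟨i, -, rfl⟩ := mem_image.1 he
    obtain ⟨j, -, rfl⟩ := mem_image.1 hf
    rw [disjoint_left]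
    intro v hv hw
    obtain ⟨a, -, rfl⟩ := mem_image.1 hv
    obtain ⟨b, -, h⟩ := mem_image.1 hw
    have hji : j = i := congrArg Prod.fst (hy.1 (Fin.ext (Nat.succ_injective h)))
    exact hne (by rw [hji])
  · ext v
    simp only [edges, mem_biUnion, mem_image, mem_univ, true_and, id, mem_Icc]
    constructor
    · rintro ⟨_, ⟨i, rfl⟩, hv⟩
      obtain ⟨a, -, rfl⟩ := mem_image.1 hv
      have := (y (i, a)).2
      omega
    · rintro ⟨h1, h2⟩
      obtain ⟨⟨i, a⟩, h⟩ := hy.2 ⟨v - 1, by omega⟩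
      refine ⟨_, ⟨i, rfl⟩, mem_image.2 ⟨a, mem_univ _, ?_⟩⟩
      rw [h]
      simp only
      omega

theorem exists_edges_eq {M : Finset (Finset ℕ)} (hM : IsOrderedMatching r n M) :
    ∃ y : Fin n × Fin r → Fin (r * n), Function.Bijective y ∧ edges y = M := by
  obtain ⟨h1, h2, h3, h4⟩ := hM
  let e : Fin n ≃ M := (M.equivFinOfCardEq h1).symm
  let f : ∀ i : Fin n, Fin r ≃ (e i : Finset ℕ) := fun i =>
    ((e i : Finset ℕ).equivFinOfCardEq (h2 _ (e i).2)).symm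
  have hmem : ∀ i a, 1 ≤ (f i a : ℕ) ∧ (f i a : ℕ) ≤ r * n := fun i a => by
    rw [← mem_Icc, ← h4, mem_biUnion]
    exact ⟨_, (e i).2, (f i a).2⟩
  let y : Fin n × Fin r → Fin (r * n) := fun q => ⟨f q.1 q.2 - 1, by have := hmem q.1 q.2; omega⟩
  have hy : ∀ i a, (y (i, a) : ℕ) + 1 = f i a := fun i a => by
    have := hmem i a
    simp only [y]
    omega
  refine ⟨y, ?_, ?_⟩
  · rw [Fintype.bijective_iff_injective_and_card]
    refine ⟨?_, by simp [mul_comm]⟩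
    rintro ⟨i, a⟩ ⟨j, b⟩ h
    have h5 : (f i a : ℕ) = f j b := by rw [← hy, ← hy, h]
    have hij : i = j := by
      by_contra hne
      have := h3 _ (e i).2 _ (e j).2 fun h => hne (e.injective (Subtype.ext h))
      exact disjoint_left.1 this (f i a).2 (h5 ▸ (f j b).2)
    subst hij
    rw [(f i).injective (Subtype.ext h5)]
  · have : ∀ i, (univ.image fun a => (y (i, a) : ℕ) + 1) = e i := fun i => by
      simp only [hy]
      ext v
      simp only [mem_image, mem_univ, true_and]
      constructor
      · rintro ⟨a, rfl⟩
        exact (f i a).2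
      · intro hv
        exact ⟨(f i).symm ⟨v, hv⟩, by simp⟩
    simp only [edges, this]
    ext v
    simp only [mem_image, mem_univ, true_and]
    constructor
    · rintro ⟨i, rfl⟩
      exact (e i).2
    · intro hv
      exact ⟨e.symm ⟨v, hv⟩, by simp⟩

end Edges
end RandomMatching

namespace RandomMatching
open Finset Filter Topology

section Ranks
variable {r n N : ℕ}

theorem card_lt_of_irrefl (x : Fin n → Fin r → Fin N) (p : Fin n × Fin r) :
    (univ.filter fun q : Fin n × Fin r => x q.1 q.2 < x p.1 p.2).card < r * n := by
  have h : (univ.filter fun q : Fin n × Fin r => x q.1 q.2 < x p.1 p.2) ⊂ univ :=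
    ssubset_univ_iff.2 fun h => by
      have := h ▸ mem_univ p
      simp at this
  simpa [mul_comm] using card_lt_card h

/-- The rank of a coordinate among all coordinates of all points. -/
def rankOf (x : Fin n → Fin r → Fin N) (p : Fin n × Fin r) : Fin (r * n) :=
  ⟨(univ.filter fun q : Fin n × Fin r => x q.1 q.2 < x p.1 p.2).card, card_lt_of_irrefl x p⟩

theorem rankOf_lt_iff {x : Fin n → Fin r → Fin N} {p q : Fin n × Fin r} :
    rankOf x p < rankOf x q ↔ x p.1 p.2 < x q.1 q.2 := by
  constructor
  · intro h
    by_contra hle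
    refine (not_le.2 h) (card_le_card fun t ht => ?_)
    rw [mem_filter] at ht ⊢
    exact ⟨ht.1, ht.2.trans_le (not_lt.1 hle)⟩
  · intro h
    refine card_lt_card ((ssubset_iff_of_subset fun t ht => ?_).2 ⟨p, ?_, ?_⟩)
    · rw [mem_filter] at ht ⊢
      exact ⟨ht.1, ht.2.trans h⟩
    · simpa using h
    · simp

theorem rankOf_bijective {x : Fin n → Fin r → Fin N} (hx : AllDistinct x) :
    Function.Bijective (rankOf x) := by
  rw [Fintype.bijective_iff_injective_and_card]
  refine ⟨fun p q h => ?_, by simp [mul_comm]⟩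
  have h1 : x p.1 p.2 = x q.1 q.2 := le_antisymm
    (not_lt.1 fun hlt => (rankOf_lt_iff.2 hlt).ne h.symm)
    (not_lt.1 fun hlt => (rankOf_lt_iff.2 hlt).ne h)
  exact Prod.ext (hx _ _ _ _ h1).1 (hx _ _ _ _ h1).2

/-- The points with their coordinates rearranged. -/
def permute (x : Fin n → Fin r → Fin N) (π : Equiv.Perm (Fin n × Fin r)) : Fin n → Fin r → Fin N :=
  fun i a => x (π (i, a)).1 (π (i, a)).2

theorem rankOf_permute (x : Fin n → Fin r → Fin N) (π : Equiv.Perm (Fin n × Fin r)) :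
    rankOf (permute x π) = rankOf x ∘ π := by
  funext p
  exact Fin.ext (card_equiv π fun q => by simp [permute])

theorem AllDistinct.permute {x : Fin n → Fin r → Fin N} (hx : AllDistinct x)
    (π : Equiv.Perm (Fin n × Fin r)) : AllDistinct (permute x π) := by
  intro i j a a' h
  have h1 := hx _ _ _ _ h
  have h2 := π.injective (Prod.ext h1.1 h1.2)
  exact ⟨congrArg Prod.fst h2, congrArg Prod.snd h2⟩

theorem permute_injective (π : Equiv.Perm (Fin n × Fin r)) :
    Function.Injective fun x : Fin n → Fin r → Fin N => RandomMatching.permute x π := by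
  intro x x' h
  funext i a
  have := congrFun (congrFun h (π.symm (i, a)).1) (π.symm (i, a)).2
  simpa [RandomMatching.permute] using this

open Classical in
theorem card_fibre_le {M M' : Finset (Finset ℕ)} (hM : IsOrderedMatching r n M)
    (hM' : IsOrderedMatching r n M') :
    (univ.filter fun x : Fin n → Fin r → Fin N => AllDistinct x ∧ edges (rankOf x) = M).card ≤
      (univ.filter fun x : Fin n → Fin r → Fin N =>
        AllDistinct x ∧ edges (rankOf x) = M').card := by
  obtain ⟨y, hy, rfl⟩ := exists_edges_eq hM
  obtain ⟨y', hy', rfl⟩ := exists_edges_eq hM'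
  let θ : Equiv.Perm (Fin (r * n)) := (Equiv.ofBijective y hy).symm.trans (Equiv.ofBijective y' hy')
  have hθ : θ ∘ y = y' := by
    funext q
    have : (Equiv.ofBijective y hy).symm (y q) = q := (Equiv.ofBijective y hy).symm_apply_apply q
    simp [θ, this]
  obtain ⟨T, hT⟩ := edges_comp (n := n) (r := r) θ
  let π : (Fin n × Fin r → Fin (r * n)) → Equiv.Perm (Fin n × Fin r) := fun ρ =>
    if h : Function.Bijective ρ then
      (Equiv.ofBijective ρ h).trans (θ.trans (Equiv.ofBijective ρ h).symm) else 1
  have hπ : ∀ ρ, Function.Bijective ρ → ρ ∘ π ρ = θ ∘ ρ := fun ρ h => by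
    funext q
    have : ∀ t, ρ ((Equiv.ofBijective ρ h).symm t) = t := (Equiv.ofBijective ρ h).apply_symm_apply
    simp only [π, dif_pos h, Function.comp_apply, Equiv.trans_apply, this, Equiv.ofBijective_apply]
  refine card_le_card_of_injOn (fun x => permute x (π (rankOf x))) (fun x hx => ?_) ?_
  · obtain ⟨hx, he⟩ := (mem_filter.1 hx).2
    refine mem_filter.2 ⟨mem_univ _, hx.permute _, ?_⟩
    rw [rankOf_permute, hπ _ (rankOf_bijective hx), hT, he, ← hT, hθ]
  · intro x hx x' hx' h
    have hx := (mem_filter.1 hx).2.1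
    have hx' := (mem_filter.1 hx').2.1
    have h1 := congrArg rankOf h
    simp only [rankOf_permute] at h1
    rw [hπ _ (rankOf_bijective hx), hπ _ (rankOf_bijective hx')] at h1
    have h2 : rankOf x = rankOf x' := funext fun q => θ.injective (congrFun h1 q)
    simp only [h2] at h
    exact permute_injective _ h

open Classical in
/-- The ordered `r`-matchings of size `n`. -/
noncomputable def matchings (r n : ℕ) : Finset (Finset (Finset ℕ)) :=
  (Icc 1 (r * n)).powerset.powerset.filter (IsOrderedMatching r n)

theorem mem_matchings {M : Finset (Finset ℕ)} : M ∈ matchings r n ↔ IsOrderedMatching r n M := by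
  classical
  rw [matchings, mem_filter, and_iff_right_iff_imp]
  intro h
  rw [mem_powerset]
  intro e he
  rw [mem_powerset, ← h.2.2.2]
  exact subset_biUnion_of_mem id he

open Classical in
theorem exists_card_distinct (hr : r ≠ 0) : ∃ q : ℕ, ∀ A : Finset (Finset ℕ) → Prop,
    (univ.filter fun x : Fin n → Fin r → Fin N => AllDistinct x ∧ A (edges (rankOf x))).card =
      ((matchings r n).filter A).card * q := by
  let F : Finset (Finset ℕ) → ℕ := fun M =>
    (univ.filter fun x : Fin n → Fin r → Fin N => AllDistinct x ∧ edges (rankOf x) = M).card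
  obtain ⟨q, hq⟩ : ∃ q, ∀ M ∈ matchings r n, F M = q := by
    rcases (matchings r n).eq_empty_or_nonempty with h | ⟨M₀, h₀⟩
    · exact ⟨0, by simp [h]⟩
    · exact ⟨F M₀, fun M hM => le_antisymm (card_fibre_le (mem_matchings.1 hM) (mem_matchings.1 h₀))
        (card_fibre_le (mem_matchings.1 h₀) (mem_matchings.1 hM))⟩
  refine ⟨q, fun A => ?_⟩
  rw [card_eq_sum_card_fiberwise (f := fun x => edges (rankOf x)) (t := (matchings r n).filter A)]
  · refine sum_const_nat fun M hM => ?_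
    obtain ⟨hM, hA⟩ := mem_filter.1 hM
    rw [← hq M hM, filter_filter]
    refine congrArg card (filter_congr fun x _ => ?_)
    constructor
    · rintro ⟨⟨h1, -⟩, h2⟩
      exact ⟨h1, h2⟩
    · rintro ⟨h1, rfl⟩
      exact ⟨⟨h1, hA⟩, rfl⟩
  · intro x hx
    obtain ⟨hx, hA⟩ := (mem_filter.1 hx).2
    exact mem_filter.2 ⟨mem_matchings.2 (edges_isOrderedMatching hr (rankOf_bijective hx)), hA⟩

open Classical in
theorem card_allDistinct : (univ.filter fun x : Fin n → Fin r → Fin N => AllDistinct x).card =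
    N.descFactorial (n * r) := by
  have : Fintype.card (Fin n × Fin r ↪ Fin N) = N.descFactorial (n * r) := by
    simp [Fintype.card_embedding_eq]
  rw [← this, ← card_univ]
  symm
  refine card_bij (fun f _ i a => f (i, a)) (fun f _ => ?_) (fun f _ f' _ h => ?_) fun x hx => ?_
  · refine mem_filter.2 ⟨mem_univ _, fun i j a a' h => ?_⟩
    have := f.injective h
    exact ⟨congrArg Prod.fst this, congrArg Prod.snd this⟩
  · ext ⟨i, a⟩
    rw [show f (i, a) = f' (i, a) from congrFun (congrFun h i) a]
  · have hx := (mem_filter.1 hx).2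
    exact ⟨⟨fun p => x p.1 p.2, fun p q h => Prod.ext (hx _ _ _ _ h).1 (hx _ _ _ _ h).2⟩,
      mem_univ _, rfl⟩

theorem eventually_pow_le_descFactorial (m : ℕ) :
    ∀ᶠ N : ℕ in atTop, (N : ℝ) ^ m ≤ 2 * N.descFactorial m := by
  have h : Tendsto (fun N : ℕ => (1 - (m : ℝ) / N) ^ m) atTop (𝓝 ((1 - 0) ^ m)) :=
    (tendsto_const_nhds.sub (tendsto_const_div_atTop_nhds_zero_nat _)).pow m
  rw [sub_zero, one_pow] at h
  filter_upwards [h.eventually_const_lt (show (1 / 2 : ℝ) < 1 by norm_num),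
    eventually_ge_atTop (m + 1)] with N hN hm
  have hN0 : (0 : ℝ) < N := by
    have : 0 < N := by omega
    exact_mod_cast this
  have h1 : ((N - m : ℕ) : ℝ) ^ m ≤ N.descFactorial m := by
    have := (Nat.pow_le_pow_left (show N - m ≤ N + 1 - m by omega) m).trans
      (Nat.pow_sub_le_descFactorial N m)
    exact_mod_cast this
  rw [Nat.cast_sub (by omega)] at h1
  have h2 : (1 - (m : ℝ) / N) ^ m * N ^ m = (N - m : ℝ) ^ m := by
    rw [← mul_pow, sub_mul, one_mul, div_mul_cancel₀ _ hN0.ne']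
  have h3 : 0 < (N : ℝ) ^ m := by positivity
  nlinarith

open Classical in
theorem card_filter_matchings_le (hr : r ≠ 0)
    (hN : (N : ℝ) ^ (n * r) ≤ 2 * N.descFactorial (n * r)) (hN0 : 0 < N)
    (A : Finset (Finset ℕ) → Prop) :
    (((matchings r n).filter A).card : ℝ) ≤ 2 * (matchings r n).card *
      Pr (unif (Fin r → Fin N))
        (fun x : Fin n → Fin r → Fin N => AllDistinct x ∧ A (edges (rankOf x))) := by
  obtain ⟨q, hq⟩ := exists_card_distinct (n := n) (N := N) hr
  have h1 := hq fun _ => True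
  simp only [and_true, filter_true, card_allDistinct] at h1
  rw [Pr_unif, hq A]
  simp only [Fintype.card_pi, Fintype.card_fin, prod_const, card_univ]
  rw [h1] at hN
  push_cast at hN ⊢
  have h2 : (0 : ℝ) < (N : ℝ) ^ (n * r) := by positivity
  rw [← pow_mul, mul_comm r n, ← mul_div_assoc, le_div_iff₀ h2]
  have h3 : (0 : ℝ) ≤ ((matchings r n).filter A).card := Nat.cast_nonneg _
  nlinarith

open Classical in
theorem matchings_pos (hr : r ≠ 0) : 0 < (matchings r n).card := by
  obtain ⟨N, hN, hN0⟩ := ((eventually_pow_le_descFactorial (n * r)).and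
    (eventually_gt_atTop 0)).exists
  obtain ⟨q, hq⟩ := exists_card_distinct (n := n) (N := N) hr
  have h1 := hq fun _ => True
  simp only [and_true, filter_true, card_allDistinct] at h1
  rw [h1] at hN
  have h2 : (0 : ℝ) < (N : ℝ) ^ (n * r) := by positivity
  refine Nat.pos_of_ne_zero fun h => ?_
  rw [h] at hN
  simp only [zero_mul, Nat.cast_zero, mul_zero] at hN
  linarith

theorem totalMatchings_eq : totalMatchings r n = (matchings r n).card :=
  Nat.subtype_card _ fun _ => mem_matchings

open Classical in
theorem deviantMatchings_eq (P : Finset (Finset ℕ)) (b ε : ℝ) : deviantMatchings r P b ε n =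
    ((matchings r n).filter fun M =>
      ε ≤ |(cliqueSize P M : ℝ) / (n : ℝ) ^ ((1 : ℝ) / (r : ℝ)) - b|).card :=
  Nat.subtype_card _ fun M => by rw [mem_filter, mem_matchings]

end Ranks
end RandomMatching

namespace RandomMatching
open Finset Filter Topology

section Convergence
variable {r n N : ℕ} {β : Type*} [LinearOrder β] {bl : Fin r → β} {s : β → Bool}
  {P : Finset (Finset ℕ)}

/-- The vertices of an edge of the random matching, in increasing order. -/
def sortedEdge (x : Fin n → Fin r → Fin N) (i : Fin n) (p : Fin r) : ℕ :=
  rankOf x (i, Tuple.sort (x i) p) + 1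

theorem sortedEdge_lt_iff {x : Fin n → Fin r → Fin N} {i j : Fin n} {p q : Fin r} :
    sortedEdge x i p < sortedEdge x j q ↔ x i (Tuple.sort (x i) p) < x j (Tuple.sort (x j) q) := by
  rw [sortedEdge, sortedEdge, Nat.succ_lt_succ_iff, Fin.val_fin_lt, rankOf_lt_iff]

theorem image_sortedEdge (x : Fin n → Fin r → Fin N) (i : Fin n) :
    univ.image (sortedEdge x i) = univ.image fun a => (rankOf x (i, a) : ℕ) + 1 := by
  ext v
  simp only [mem_image, mem_univ, true_and, sortedEdge]
  exact ⟨fun ⟨p, h⟩ => ⟨_, h⟩, fun ⟨a, h⟩ => ⟨(Tuple.sort (x i)).symm a, by simpa using h⟩⟩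

theorem formsPattern_edge_iff (hP : Realizes bl s P) {x : Fin n → Fin r → Fin N}
    (hx : AllDistinct x) {i j : Fin n} (hij : i ≠ j) :
    FormsPattern (univ.image fun a => (rankOf x (i, a) : ℕ) + 1)
      (univ.image fun a => (rankOf x (j, a) : ℕ) + 1) P ↔ Pat bl s (x i) (x j) := by
  have hmono : ∀ i, StrictMono (sortedEdge x i) := fun i p q h => by
    rw [sortedEdge_lt_iff]
    refine lt_of_le_of_ne (Tuple.monotone_sort (x i) h.le) fun he => ?_
    exact h.ne ((Tuple.sort (x i)).injective (hx _ _ _ _ he).2)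
  have hne : ∀ p q, sortedEdge x i p ≠ sortedEdge x j q := fun p q h => by
    refine hij (hx i j (Tuple.sort (x i) p) (Tuple.sort (x j) q) (le_antisymm ?_ ?_)).1
    · exact not_lt.1 fun hlt => (sortedEdge_lt_iff.2 hlt).ne h.symm
    · exact not_lt.1 fun hlt => (sortedEdge_lt_iff.2 hlt).ne h
  rw [← image_sortedEdge, ← image_sortedEdge, hP.formsPattern_iff (hmono i) (hmono j) hne]
  simp only [Pat, Interleaved, sortedEdge_lt_iff, Function.comp_apply]

theorem cliqueSize_edges (hr : r ≠ 0) (hP : Realizes bl s P) {x : Fin n → Fin r → Fin N}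
    (hx : AllDistinct x) : cliqueSize P (edges (rankOf x)) = cl (Pat bl s) univ x := by
  classical
  have hinj := edge_injective hr (rankOf_bijective hx).1
  refine IsGreatest.csSup_eq ⟨?_, ?_⟩
  · obtain ⟨S, -, hS, hc⟩ := exists_cl (Pat bl s) univ x
    refine ⟨S.image fun i => univ.image fun a => (rankOf x (i, a) : ℕ) + 1,
      image_subset_image (subset_univ _), ?_, by rw [card_image_of_injective _ hinj, hc]⟩
    intro e he f hf hne
    obtain ⟨i, hi, rfl⟩ := mem_image.1 he
    obtain ⟨j, hj, rfl⟩ := mem_image.1 hf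
    have hij : i ≠ j := fun h => hne (by rw [h])
    exact (formsPattern_edge_iff hP hx hij).2 (hS i hi j hj hij)
  · rintro k ⟨S, hS, hclique, rfl⟩
    obtain ⟨T, -, rfl⟩ := subset_image_iff.1 hS
    rw [card_image_of_injective _ hinj]
    refine le_cl (subset_univ _) fun i hi j hj hij => (formsPattern_edge_iff hP hx hij).1 ?_
    exact hclique _ (mem_image_of_mem _ hi) _ (mem_image_of_mem _ hj) (hinj.ne hij)

theorem card_deviant_le [Fintype β] {C ε δ : ℝ} (hr : r ≠ 0) (hn : n ≠ 0)
    (hP : Realizes bl s P) {g g' : ℕ} (hg : 0 < g) (hg' : 0 < g') (hδ : δ ≤ ε)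
    (h1 : ∀ᶠ K : ℕ in atTop, Pr (unif (Fin r → Fin (g * K)))
      (fun x : Fin n → Fin r → Fin (g * K) =>
        (cl (Pat bl s) univ x : ℝ) ≤ (C - δ) * (n : ℝ) ^ (1 / r : ℝ)) ≤ δ)
    (h2 : ∀ᶠ K : ℕ in atTop, Pr (unif (Fin r → Fin (g' * K)))
      (fun x : Fin n → Fin r → Fin (g' * K) => AllDistinct x ∧
        (C + δ) * (n : ℝ) ^ (1 / r : ℝ) ≤ (cl (Pat bl s) univ x : ℝ)) ≤ δ) :
    (deviantMatchings r P C ε n : ℝ) ≤ 4 * δ * totalMatchings r n := by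
  classical
  have hpos : 0 < (n : ℝ) ^ (1 / r : ℝ) := by positivity
  have key : ∀ {g : ℕ}, 0 < g → ∀ᶠ K : ℕ in atTop, 0 < g * K ∧
      ((g * K : ℕ) : ℝ) ^ (n * r) ≤ 2 * (g * K).descFactorial (n * r) := fun hg => by
    have ht : Tendsto (fun K : ℕ => _ * K) atTop atTop := tendsto_id.const_mul_atTop' hg
    filter_upwards [eventually_gt_atTop 0,
      ht.eventually (eventually_pow_le_descFactorial (n * r))] with K hK h
    exact ⟨Nat.mul_pos hg hK, h⟩
  obtain ⟨K, hK, hK0, hKd⟩ := (h1.and (key hg)).exists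
  obtain ⟨K', hK', hK0', hKd'⟩ := (h2.and (key hg')).exists
  rw [deviantMatchings_eq, totalMatchings_eq]
  have hlow := card_filter_matchings_le (n := n) hr hKd hK0 fun M =>
    (cliqueSize P M : ℝ) ≤ (C - δ) * (n : ℝ) ^ (1 / r : ℝ)
  have hhigh := card_filter_matchings_le (n := n) hr hKd' hK0' fun M =>
    (C + δ) * (n : ℝ) ^ (1 / r : ℝ) ≤ (cliqueSize P M : ℝ)
  have hsub : ((matchings r n).filter fun M =>
      ε ≤ |(cliqueSize P M : ℝ) / (n : ℝ) ^ ((1 : ℝ) / (r : ℝ)) - C|) ⊆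
      ((matchings r n).filter fun M =>
        (cliqueSize P M : ℝ) ≤ (C - δ) * (n : ℝ) ^ (1 / r : ℝ)) ∪
      ((matchings r n).filter fun M =>
        (C + δ) * (n : ℝ) ^ (1 / r : ℝ) ≤ (cliqueSize P M : ℝ)) := by
    rw [← filter_or]
    refine monotone_filter_right _ fun M _ h => ?_
    rcases le_abs.1 h with h | h
    · refine Or.inr ((le_div_iff₀ hpos).1 ?_)
      linarith
    · refine Or.inl ((div_le_iff₀ hpos).1 ?_)
      linarith
  have hcard : ((#((matchings r n).filter fun M =>
      ε ≤ |(cliqueSize P M : ℝ) / (n : ℝ) ^ ((1 : ℝ) / (r : ℝ)) - C|) : ℕ) : ℝ) ≤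
      #((matchings r n).filter fun M =>
        (cliqueSize P M : ℝ) ≤ (C - δ) * (n : ℝ) ^ (1 / r : ℝ)) +
      #((matchings r n).filter fun M =>
        (C + δ) * (n : ℝ) ^ (1 / r : ℝ) ≤ (cliqueSize P M : ℝ)) := by
    exact_mod_cast (card_le_card hsub).trans (card_union_le _ _)
  have : Nonempty (Fin (g * K)) := ⟨⟨0, hK0⟩⟩
  have : Nonempty (Fin (g' * K')) := ⟨⟨0, hK0'⟩⟩
  have hp1 := (Pr_mono (unif_isProb (Fin r → Fin (g * K)))
    (A := fun x : Fin n → Fin r → Fin (g * K) => AllDistinct x ∧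
      (cliqueSize P (edges (rankOf x)) : ℝ) ≤ (C - δ) * (n : ℝ) ^ (1 / r : ℝ))
      (B := fun x : Fin n → Fin r → Fin (g * K) =>
      (cl (Pat bl s) univ x : ℝ) ≤ (C - δ) * (n : ℝ) ^ (1 / r : ℝ)) fun x hx => by
      rw [← cliqueSize_edges hr hP hx.1]
      exact hx.2).trans hK
  have hp2 := (Pr_mono (unif_isProb (Fin r → Fin (g' * K')))
    (A := fun x : Fin n → Fin r → Fin (g' * K') => AllDistinct x ∧
      (C + δ) * (n : ℝ) ^ (1 / r : ℝ) ≤ (cliqueSize P (edges (rankOf x)) : ℝ))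
      (B := fun x : Fin n → Fin r → Fin (g' * K') =>
        AllDistinct x ∧
      (C + δ) * (n : ℝ) ^ (1 / r : ℝ) ≤ (cl (Pat bl s) univ x : ℝ)) fun x hx => by
      rw [← cliqueSize_edges hr hP hx.1]
      exact hx).trans hK'
  have hM : (0 : ℝ) ≤ 2 * #(matchings r n) := by positivity
  have h3 := hlow.trans (mul_le_mul_of_nonneg_left hp1 hM)
  have h4 := hhigh.trans (mul_le_mul_of_nonneg_left hp2 hM)
  linarith

theorem Realizes.cliqueSizeConvergesTo [Fintype β] (hr : r ≠ 0) (hP : Realizes bl s P)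
    (hbl : Monotone bl) {c : ℝ} (hc0 : 0 ≤ c)
    (hc : Tendsto (fun n : ℕ => chainLim bl n / (n : ℝ) ^ (1 / r : ℝ)) atTop (𝓝 c)) :
    CliqueSizeConvergesTo r P (c * bestProb bl ^ (1 / r : ℝ)) := by
  have : Nonempty (Fin r) := ⟨⟨0, Nat.pos_of_ne_zero hr⟩⟩
  intro ε hε
  refine Metric.tendsto_atTop'.2 fun η hη => ?_
  have hδ : 0 < min ε (η / 8) := by positivity
  obtain ⟨g, hg, h1⟩ := Pr_pat_le (s := s) hr hbl hc0 hc hδ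
  obtain ⟨g', hg', h2⟩ := Pr_le_pat (s := s) hr hbl hc0 hc hδ
  obtain ⟨n₀, hn₀⟩ := eventually_atTop.1 (h1.and h2)
  refine ⟨n₀, fun n hn => ?_⟩
  have h := card_deviant_le hr (by omega) hP hg hg' (min_le_left ε (η / 8))
    (hn₀ n hn.le).1 (hn₀ n hn.le).2
  have hM : (0 : ℝ) < totalMatchings r n := by
    rw [totalMatchings_eq]
    exact_mod_cast matchings_pos hr
  rw [Real.dist_eq, sub_zero, abs_of_nonneg (by positivity), div_lt_iff₀ hM]
  have h3 := min_le_right ε (η / 8)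
  nlinarith

theorem limit_unique (hr : r ≠ 0) {b b' : ℝ} (hb : CliqueSizeConvergesTo r P b)
    (hb' : CliqueSizeConvergesTo r P b') : b = b' := by
  classical
  by_contra hne
  have hε : 0 < |b - b'| / 2 := by
    have := abs_pos.2 (sub_ne_zero.2 hne)
    positivity
  have h := (hb _ hε).add (hb' _ hε)
  rw [add_zero] at h
  obtain ⟨n, hn⟩ := (h.eventually_lt_const zero_lt_one).exists
  have hM : 0 < totalMatchings r n := by
    rw [totalMatchings_eq]
    exact matchings_pos hr
  rw [← add_div, div_lt_one (by exact_mod_cast hM)] at hn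
  have hn' : deviantMatchings r P b (|b - b'| / 2) n + deviantMatchings r P b' (|b - b'| / 2) n <
      totalMatchings r n := by exact_mod_cast hn
  rw [deviantMatchings_eq, deviantMatchings_eq, totalMatchings_eq] at hn'
  refine hn'.not_ge ((card_le_card fun M hM => ?_).trans (card_union_le _ _))
  rw [← filter_or, mem_filter]
  refine ⟨hM, ?_⟩
  by_contra! hlt
  have := abs_sub_le b ((cliqueSize P M : ℝ) / (n : ℝ) ^ ((1 : ℝ) / (r : ℝ))) b'
  rw [abs_sub_comm b (_ / _)] at this
  linarith [hlt.1, hlt.2]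

end Convergence
end RandomMatching

namespace RandomMatching
open Finset

section Collectable
variable {r n : ℕ}

theorem exists_sortedEdges (hr : 0 < r) {M : Finset (Finset ℕ)} (hM : IsOrderedMatching r n M) :
    ∃ X : Fin n → Fin r → ℕ, (∀ i, StrictMono (X i)) ∧ (∀ i j p q, X i p = X j q → i = j) ∧
      M = univ.image (fun i => univ.image (X i)) ∧ StrictMono fun i => X i ⟨0, hr⟩ := by
  obtain ⟨h1, h2, h3, -⟩ := hM
  let e : Fin n ≃ M := (M.equivFinOfCardEq h1).symm
  let Y : Fin n → Fin r → ℕ := fun i => (e i : Finset ℕ).orderEmbOfFin (h2 _ (e i).2)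
  have hY : ∀ i, univ.image (Y i) = e i := fun i => image_orderEmbOfFin_univ _ _
  have hne : ∀ i j p q, Y i p = Y j q → i = j := fun i j p q h => by
    by_contra hij
    have hd := h3 _ (e i).2 _ (e j).2 fun h => hij (e.injective (Subtype.ext h))
    rw [← hY, ← hY, disjoint_left] at hd
    exact hd (mem_image_of_mem _ (mem_univ p)) (h ▸ mem_image_of_mem _ (mem_univ q))
  let σ := Tuple.sort fun i => Y i ⟨0, hr⟩
  refine ⟨fun i => Y (σ i), fun i => OrderEmbedding.strictMono _,
    fun i j p q h => σ.injective (hne _ _ p q h), ?_, ?_⟩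
  · ext v
    simp only [hY, mem_image, mem_univ, true_and]
    constructor
    · intro hv
      exact ⟨σ.symm (e.symm ⟨v, hv⟩), by simp⟩
    · rintro ⟨i, rfl⟩
      exact (e _).2
  · intro i j hij
    refine lt_of_le_of_ne (Tuple.monotone_sort (fun i => Y i ⟨0, hr⟩) hij.le) fun h => hij.ne (σ.injective ?_)
    exact hne _ _ _ _ h

/-- The index `p` lies in a block strictly before that of `q`. -/
def BlockLt (T : Fin r → Fin r → Prop) (p q : Fin r) : Prop := T p q ∧ ¬ T q p

theorem exists_labels {T : Fin r → Fin r → Prop}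
    (hmono : ∀ p p' q q', p' ≤ p → q ≤ q' → T p q → T p' q')
    (h1 : ∀ p q t, T p q → T q t → T p t) (h2 : ∀ p q t, ¬ T p q → ¬ T q t → ¬ T p t) :
    ∃ (bl : Fin r → Fin (r + 1)) (s : Fin (r + 1) → Bool), Monotone bl ∧
      ∀ p q, T p q ↔ bl p < bl q ∨ bl p = bl q ∧ s (bl p) = true := by
  classical
  let f : Fin r → Finset (Fin r) := fun p => univ.filter fun q => BlockLt T q p
  have hf : ∀ p q, q ∈ f p ↔ BlockLt T q p := by simp [f]
  let bl : Fin r → Fin (r + 1) := fun p =>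
    ⟨#(f p), Nat.lt_succ_of_le ((card_le_univ _).trans_eq (Fintype.card_fin r))⟩
  have hlt : ∀ p q, BlockLt T p q → bl p < bl q := fun p q h => by
    have hss : f p ⊂ f q := by
      refine (ssubset_iff_of_subset fun t ht => ?_).2 ⟨p, (hf _ _).2 h, fun hp => ?_⟩
      · rw [hf] at ht ⊢
        exact ⟨h1 _ _ _ ht.1 h.1, h2 _ _ _ h.2 ht.2⟩
      · exact ((hf _ _).1 hp).2 ((hf _ _).1 hp).1
    exact card_lt_card hss
  have hneg : ∀ p q t, BlockLt T p t → BlockLt T p q ∨ BlockLt T q t := by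
    intro p q t h
    have hpt : p ≤ t := (le_total p t).resolve_right fun hle => h.2 (hmono _ _ _ _ hle hle h.1)
    by_contra! hcon
    simp only [BlockLt, not_and, not_not] at hcon h
    by_cases hpq : T p q
    · have hqt := hmono _ _ _ _ le_rfl hpt (hcon.1 hpq)
      exact h.2 (h1 _ _ _ (hcon.2 hqt) (hcon.1 hpq))
    · by_cases hqt : T q t
      · exact hpq (hmono _ _ _ _ hpt le_rfl (hcon.2 hqt))
      · exact h2 _ _ _ hpq hqt h.1
  have heq : ∀ p q, ¬ BlockLt T p q → ¬ BlockLt T q p → bl p = bl q := fun p q hp hq => by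
    have hpq : f p = f q := by
      ext x
      rw [hf, hf]
      exact ⟨fun h => (hneg _ q _ h).resolve_right hq, fun h => (hneg _ p _ h).resolve_right hp⟩
    exact Fin.ext (congrArg card hpq)
  have hlt' : ∀ p q, bl p < bl q → BlockLt T p q := fun p q h => by
    by_contra hp
    by_cases hq : BlockLt T q p
    · exact (hlt _ _ hq).not_gt h
    · exact h.ne (heq _ _ hp hq)
  have hsymm : ∀ p q, bl p = bl q → T p q → T q p := fun p q h hT => by
    by_contra hq
    exact (hlt p q ⟨hT, hq⟩).ne h
  have hdiag : ∀ p q, bl p = bl q → T p p → T p q := fun p q h hT => by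
    rcases le_total p q with hle | hle
    · exact hmono _ _ _ _ le_rfl hle hT
    · exact hsymm _ _ h.symm (hmono _ _ _ _ hle le_rfl hT)
  have hdiag' : ∀ p q, bl p = bl q → T p q → T p p := fun p q h hT => by
    rcases le_total p q with hle | hle
    · exact hmono _ _ _ _ hle le_rfl (hsymm _ _ h hT)
    · exact hmono _ _ _ _ le_rfl hle hT
  refine ⟨bl, fun b => decide (∃ p, bl p = b ∧ T p p), fun p q hpq => ?_, fun p q => ?_⟩
  · by_contra! h
    have h := hlt' _ _ h
    exact h.2 (hmono _ _ _ _ hpq hpq h.1)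
  · rw [decide_eq_true_iff]
    constructor
    · intro hT
      by_cases hq : T q p
      · have hbl := heq p q (fun h => h.2 hq) fun h => h.2 hT
        exact Or.inr ⟨hbl, p, rfl, hdiag' _ _ hbl hT⟩
      · exact Or.inl (hlt _ _ ⟨hT, hq⟩)
    · rintro (h | ⟨h, x, hx, hT⟩)
      · exact (hlt' _ _ h).1
      · have h3 := hsymm _ _ hx (hdiag _ _ hx hT)
        exact hdiag _ _ h (hdiag' _ _ hx.symm h3)

theorem exists_realizes (hr : 0 < r) {P : Finset (Finset ℕ)} (hP : IsPattern r P)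
    (hc : IsCollectable r P) :
    ∃ (bl : Fin r → Fin (r + 1)) (s : Fin (r + 1) → Bool), Monotone bl ∧ Realizes bl s P := by
  obtain ⟨A, hA, hAne, rfl, hA0⟩ := exists_sortedEdges hr hP
  have hAB : ∀ p q, A 0 p ≠ A 1 q := fun p q h => absurd (hAne _ _ _ _ h) (by decide)
  have hPair : (univ.image fun i => univ.image (A i)) = {univ.image (A 0), univ.image (A 1)} := by
    rw [show (univ : Finset (Fin 2)) = {0, 1} from rfl, image_insert, image_singleton]
  rw [hPair] at hc ⊢
  obtain ⟨M, hM, hclique⟩ := hc 3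
  obtain ⟨X, hX, hXne, rfl, hX0⟩ := exists_sortedEdges hr hM
  have hform : ∀ i j, i < j → ∀ p q, X i p < X j q ↔ A 0 p < A 1 q := by
    intro i j hij
    have hdis : ∀ p q, X i p ≠ X j q := fun p q h => hij.ne (hXne _ _ _ _ h)
    have hne : univ.image (X i) ≠ univ.image (X j) := fun h =>
      hdis ⟨0, hr⟩ ⟨0, hr⟩ (congrFun (eq_of_image_eq (hX i) (hX j) h) _)
    have h := hclique _ (mem_image_of_mem _ (mem_univ i)) _ (mem_image_of_mem _ (mem_univ j)) hne
    rw [formsPattern_iff (hA 0) (hA 1) hAB (hX i) (hX j) hdis] at h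
    refine h.resolve_right fun h => ?_
    exact (hX0 hij).not_gt ((h _ _).2 (hA0 (by decide)))
  have hform' : ∀ i j, i < j → ∀ p q, X j q < X i p ↔ ¬ A 0 p < A 1 q := by
    intro i j hij p q
    rw [← hform i j hij, not_lt, le_iff_lt_or_eq, or_iff_left]
    exact fun h => hij.ne' (hXne _ _ _ _ h)
  have h01 : (0 : Fin 3) < 1 := by decide
  have h12 : (1 : Fin 3) < 2 := by decide
  have h02 : (0 : Fin 3) < 2 := by decide
  obtain ⟨bl, s, hbl, h⟩ := exists_labels (T := fun p q => A 0 p < A 1 q)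
    (fun p p' q q' hp hq h =>
      ((hA 0).monotone hp).trans_lt (h.trans_le ((hA 1).monotone hq)))
    (fun p q t h1 h2 => by
      rw [← hform 0 1 h01] at h1
      rw [← hform 1 2 h12] at h2
      exact (hform 0 2 h02 _ _).1 (h1.trans h2))
    (fun p q t h1 h2 => by
      rw [← hform' 0 1 h01] at h1
      rw [← hform' 1 2 h12] at h2
      exact (hform' 0 2 h02 _ _).1 (h2.trans h1))
  exact ⟨bl, s, hbl, A 0, A 1, hA 0, hA 1, hAB, rfl, h⟩

end Collectable
end RandomMatching

namespace RandomMatching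
open Finset

section BlockPartition

theorem exists_equiv_of_card_fibre {α α' γ : Type*} [Fintype α] [Fintype α'] [DecidableEq γ]
    {f : α → γ} {g : α' → γ}
    (h : ∀ c, #(univ.filter fun a => f a = c) = #(univ.filter fun a => g a = c)) :
    ∃ e : α ≃ α', ∀ a, g (e a) = f a := by
  have hc : ∀ c, Nonempty ({a // f a = c} ≃ {a // g a = c}) := fun c => by
    rw [← Fintype.card_eq, Fintype.card_subtype, Fintype.card_subtype, h]
  let F : ∀ c, {a // f a = c} ≃ {a // g a = c} := fun c => (hc c).some
  refine ⟨(Equiv.sigmaFiberEquiv f).symm.trans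
    ((Equiv.sigmaCongrRight F).trans (Equiv.sigmaFiberEquiv g)), fun a => ?_⟩
  exact (F (f a) ⟨a, rfl⟩).2

variable {r ℓ : ℕ}

theorem cut_le_cut {D : ℕ → ℕ} (hlt : ∀ i < ℓ, D i < D (i + 1)) {i j : ℕ} (hij : i ≤ j)
    (hj : j ≤ ℓ) : D i ≤ D j := by
  induction j, hij using Nat.le_induction with
  | base => exact le_rfl
  | succ j _ ih => exact (ih (by omega)).trans (hlt j (by omega)).le

theorem exists_blockIndex {D : ℕ → ℕ} (h0 : D 0 = 0) (hℓ : D ℓ = r)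
    (hlt : ∀ i < ℓ, D i < D (i + 1)) : ∃ bl : Fin r → Fin ℓ, Monotone bl ∧
      (∀ p, D (bl p) ≤ p ∧ (p : ℕ) < D (bl p + 1)) ∧
      ∀ i : Fin ℓ, #(univ.filter fun p => bl p = i) = D (i + 1) - D i := by
  have hex : ∀ p : Fin r, ∃ i : Fin ℓ, D i ≤ p ∧ (p : ℕ) < D (i + 1) := fun p => by
    have hp : ∃ i, (p : ℕ) < D i := ⟨ℓ, hℓ ▸ p.2⟩
    have h1 := Nat.find_spec hp
    have h2 : Nat.find hp ≤ ℓ := Nat.find_min' hp (hℓ ▸ p.2)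
    have h3 : Nat.find hp ≠ 0 := fun h => by
      rw [h, h0] at h1
      omega
    refine ⟨⟨Nat.find hp - 1, by omega⟩, ?_, ?_⟩
    · exact not_lt.1 (Nat.find_min hp (by simp only; omega))
    · simpa only [Nat.sub_add_cancel (Nat.pos_of_ne_zero h3)] using h1
  choose bl hbl using hex
  have hmono : Monotone bl := fun p q hpq => by
    by_contra! h
    have h1 := cut_le_cut hlt (show (bl q : ℕ) + 1 ≤ bl p from h) (bl p).2.le
    have h2 := (hbl q).2.trans_le (h1.trans (hbl p).1)
    exact h2.not_ge hpq
  refine ⟨bl, hmono, hbl, fun i => ?_⟩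
  have himage : (univ.filter fun p => bl p = i).map Fin.valEmbedding = Ico (D i) (D (i + 1)) := by
    ext v
    simp only [mem_map, mem_filter, mem_univ, true_and, Fin.valEmbedding_apply, mem_Ico]
    constructor
    · rintro ⟨p, rfl, rfl⟩
      exact hbl p
    · rintro ⟨h1, h2⟩
      have hv : v < r := hℓ ▸ h2.trans_le (cut_le_cut hlt i.2 le_rfl)
      refine ⟨⟨v, hv⟩, ?_, rfl⟩
      obtain ⟨h3, h4⟩ := hbl ⟨v, hv⟩
      simp only at h3 h4
      rcases lt_trichotomy (bl ⟨v, hv⟩) i with h | h | h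
      · have := cut_le_cut hlt (show (bl ⟨v, hv⟩ : ℕ) + 1 ≤ i from h) i.2.le
        omega
      · exact h
      · have := cut_le_cut hlt (show (i : ℕ) + 1 ≤ bl ⟨v, hv⟩ from h) (bl _).2.le
        omega
  rw [← card_map, himage, Nat.card_Ico]

/-- A run inside each block, placed first in the block if `t` holds there. -/
def runVertex (D : ℕ → ℕ) (bl : Fin r → Fin ℓ) (t : Fin ℓ → Bool) (p : Fin r) : ℕ :=
  D (bl p) + p + 1 + if t (bl p) then 0 else D (bl p + 1) - D (bl p)

theorem runVertex_mem {D : ℕ → ℕ} {bl : Fin r → Fin ℓ}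
    (hbl : ∀ p, D (bl p) ≤ p ∧ (p : ℕ) < D (bl p + 1)) (t : Fin ℓ → Bool) (p : Fin r) :
    2 * D (bl p) < runVertex D bl t p ∧ runVertex D bl t p ≤ 2 * D (bl p + 1) := by
  have := hbl p
  unfold runVertex
  split_ifs <;> omega

theorem runVertex_lt {D : ℕ → ℕ} (hlt : ∀ i < ℓ, D i < D (i + 1)) {bl : Fin r → Fin ℓ}
    (hbl : ∀ p, D (bl p) ≤ p ∧ (p : ℕ) < D (bl p + 1)) (t t' : Fin ℓ → Bool) {p q : Fin r}
    (h : bl p < bl q) : runVertex D bl t p < runVertex D bl t' q := by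
  have h1 := (runVertex_mem hbl t p).2
  have h2 := (runVertex_mem hbl t' q).1
  have h3 := cut_le_cut hlt (show (bl p : ℕ) + 1 ≤ bl q from h) (bl q).2.le
  omega

theorem runVertex_strictMono {D : ℕ → ℕ} (hlt : ∀ i < ℓ, D i < D (i + 1)) {bl : Fin r → Fin ℓ}
    (hmono : Monotone bl) (hbl : ∀ p, D (bl p) ≤ p ∧ (p : ℕ) < D (bl p + 1)) (t : Fin ℓ → Bool) :
    StrictMono (runVertex D bl t) := by
  intro p q hpq
  rcases (hmono hpq.le).lt_or_eq with h | h
  · exact runVertex_lt hlt hbl t t h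
  · have : (p : ℕ) < q := hpq
    unfold runVertex
    rw [h]
    omega

theorem runVertex_lt_iff {D : ℕ → ℕ} (hlt : ∀ i < ℓ, D i < D (i + 1)) {bl : Fin r → Fin ℓ}
    (hbl : ∀ p, D (bl p) ≤ p ∧ (p : ℕ) < D (bl p + 1)) (t : Fin ℓ → Bool) :
    Interleaved bl t (runVertex D bl t) (runVertex D bl fun i => !t i) ∧
      ∀ p q, runVertex D bl t p ≠ runVertex D bl (fun i => !t i) q := by
  have key : ∀ p q, bl p = bl q → (t (bl p) = true →
      runVertex D bl t p < runVertex D bl (fun i => !t i) q) ∧ (¬ t (bl p) = true →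
      runVertex D bl (fun i => !t i) q < runVertex D bl t p) := fun p q h => by
    have h1 := hbl p
    have h2 := hbl q
    unfold runVertex
    rw [h] at h1 ⊢
    constructor <;> intro ht <;> simp only [ht] <;> simp <;> omega
  constructor
  · intro p q
    rcases lt_trichotomy (bl p) (bl q) with h | h | h
    · exact iff_of_true (runVertex_lt hlt hbl _ _ h) (Or.inl h)
    · by_cases ht : t (bl p) = true
      · exact iff_of_true ((key p q h).1 ht) (Or.inr ⟨h, ht⟩)
      · refine iff_of_false ((key p q h).2 ht).not_gt ?_
        rintro (h' | ⟨-, h'⟩)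
        · exact h'.ne h
        · exact ht h'
    · refine iff_of_false (runVertex_lt hlt hbl _ _ h).not_gt ?_
      rintro (h' | ⟨h', -⟩)
      · exact h'.not_gt h
      · exact h.ne' h'
  · intro p q
    rcases lt_trichotomy (bl p) (bl q) with h | h | h
    · exact (runVertex_lt hlt hbl _ _ h).ne
    · by_cases ht : t (bl p) = true
      · exact ((key p q h).1 ht).ne
      · exact ((key p q h).2 ht).ne'
    · exact (runVertex_lt hlt hbl _ _ h).ne'

theorem IsBlockPartition.exists_realizes {P : Finset (Finset ℕ)} (hP : IsPattern r P) {c : ℕ → ℕ}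
    (h : IsBlockPartition r P ℓ c) :
    ∃ (bl : Fin r → Fin ℓ) (s : Fin ℓ → Bool), Monotone bl ∧ Realizes bl s P ∧
      ∀ i : Fin ℓ, #(univ.filter fun p => bl p = i) = (c (i + 1) - c i) / 2 := by
  obtain ⟨-, h0, hℓ, -, A, B, -, rfl, hblk⟩ := h
  have heven : ∀ i ≤ ℓ, c i = 2 * (c i / 2) := fun i => by
    induction i with
    | zero => simp [h0]
    | succ i ih =>
      intro hi
      obtain ⟨d, -, hd, -⟩ := hblk i hi
      have := ih (by omega)
      omega
  have hlt : ∀ i < ℓ, c i / 2 < c (i + 1) / 2 := fun i hi => by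
    obtain ⟨d, hd0, hd, -⟩ := hblk i hi
    omega
  obtain ⟨bl, hmono, hbl, hcard⟩ := exists_blockIndex (D := fun i => c i / 2) (r := r)
    (by simp [h0]) (by simp [hℓ]) hlt
  have hsign : ∀ i : Fin ℓ, ∃ t : Bool,
      (∀ v, c i < v → v ≤ c (i + 1) → (t = true ↔ v ≤ (c i + c (i + 1)) / 2) → v ∈ A) ∧
      (∀ v, c i < v → v ≤ c (i + 1) → (t = false ↔ v ≤ (c i + c (i + 1)) / 2) → v ∈ B) := by
    intro i
    obtain ⟨d, -, hd, ⟨h1, h2⟩ | ⟨h1, h2⟩⟩ := hblk i i.2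
    · refine ⟨true, fun v hv hv' h => h1 v hv ?_, fun v hv hv' h => h2 v ?_ hv'⟩
      · have := h.1 rfl
        omega
      · have : ¬ v ≤ (c i + c (i + 1)) / 2 := fun hle => by simpa using h.2 hle
        omega
    · refine ⟨false, fun v hv hv' h => h2 v ?_ hv', fun v hv hv' h => h1 v hv ?_⟩
      · have : ¬ v ≤ (c i + c (i + 1)) / 2 := fun hle => by simpa using h.2 hle
        omega
      · have := h.1 rfl
        omega
  choose s hsA hsB using hsign
  have hmem : ∀ (t : Fin ℓ → Bool) p, c (bl p) < runVertex (fun i => c i / 2) bl t p ∧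
      runVertex (fun i => c i / 2) bl t p ≤ c (bl p + 1) ∧
      (t (bl p) = true ↔
        runVertex (fun i => c i / 2) bl t p ≤ (c (bl p) + c (bl p + 1)) / 2) := by
    intro t p
    have h1 := runVertex_mem (D := fun i => c i / 2) hbl t p
    have h2 := heven (bl p) (bl p).2.le
    have h3 := heven (bl p + 1) (bl p).2
    have h4 := hbl p
    refine ⟨by omega, by omega, ?_⟩
    unfold runVertex
    by_cases ht : t (bl p) = true
    · simp only [ht, if_true, true_iff]
      omega
    · simp only [ht]
      simp
      omega
  have himage : ∀ (t : Fin ℓ → Bool) (E : Finset ℕ), E ∈ ({A, B} : Finset (Finset ℕ)) →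
      (∀ p, runVertex (fun i => c i / 2) bl t p ∈ E) →
      E = univ.image (runVertex (fun i => c i / 2) bl t) := fun t E hE h => by
    symm
    refine eq_of_subset_of_card_le (image_subset_iff.2 fun p _ => h p) ?_
    rw [hP.2.1 E hE, card_image_of_injective _ (runVertex_strictMono hlt hmono hbl t).injective,
      card_univ, Fintype.card_fin]
  have hA := himage s A (by simp) fun p =>
    hsA _ _ (hmem s p).1 (hmem s p).2.1 (hmem s p).2.2
  have hB := himage (fun i => !s i) B (by simp) fun p =>
    hsB _ _ (hmem _ p).1 (hmem _ p).2.1 (by rw [← (hmem _ p).2.2, Bool.not_eq_true'])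
  have hI := runVertex_lt_iff hlt hbl s
  refine ⟨bl, s, hmono, ⟨_, _, runVertex_strictMono hlt hmono hbl s,
    runVertex_strictMono hlt hmono hbl _, hI.2, by rw [← hA, ← hB], hI.1⟩, fun i => ?_⟩
  rw [hcard]
  have h1 := heven i i.2.le
  have h2 := heven (i + 1) i.2
  omega

theorem exists_perm_of_multiset_eq {d d' : ℕ → ℕ}
    (h : (Multiset.range ℓ).map d = (Multiset.range ℓ).map d') :
    ∃ τ : Equiv.Perm (Fin ℓ), ∀ i, d' (τ i) = d i := by
  have hc : ∀ (d : ℕ → ℕ) v, ((Multiset.range ℓ).map d).count v =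
      #(univ.filter fun i : Fin ℓ => d i = v) := fun d v => by
    rw [Multiset.count_map, ← card_map Fin.valEmbedding]
    have : (univ.filter fun i : Fin ℓ => d i = v).map Fin.valEmbedding =
        (range ℓ).filter fun i => v = d i := by
      ext i
      simp only [mem_map, mem_filter, mem_univ, true_and, Fin.valEmbedding_apply, mem_range]
      constructor
      · rintro ⟨j, rfl, rfl⟩
        exact ⟨j.2, rfl⟩
      · rintro ⟨hi, rfl⟩
        exact ⟨⟨i, hi⟩, rfl, rfl⟩
    rw [this]
    rfl
  exact exists_equiv_of_card_fibre (f := fun i : Fin ℓ => d i) (g := fun i : Fin ℓ => d' i)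
    fun v => by rw [← hc, ← hc, h]

end BlockPartition

section Reindexing
variable {r : ℕ} {β : Type*}

theorem chain_comp_iff {bl bl' : Fin r → β} {τ : Equiv.Perm β} {σ : Equiv.Perm (Fin r)}
    (h : ∀ p, bl' (σ p) = τ (bl p)) {K : ℕ} {x y : Fin r → Fin K} :
    Chain bl (x ∘ σ) (y ∘ σ) ↔ Chain bl' x y := by
  have key : ∀ {x y : Fin r → Fin K}, (∀ a a', bl a = bl a' → x (σ a) < y (σ a')) ↔
      ∀ a a', bl' a = bl' a' → x a < y a' := by
    intro x y
    constructor
    · intro hx a a' ha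
      have := hx (σ.symm a) (σ.symm a') (τ.injective (by simp [← h, ha]))
      simpa using this
    · intro hx a a' ha
      exact hx _ _ (by rw [h, h, ha])
  exact or_congr key key

theorem chainMean_reindex {bl bl' : Fin r → β} {τ : Equiv.Perm β} {σ : Equiv.Perm (Fin r)}
    (h : ∀ p, bl' (σ p) = τ (bl p)) (K n : ℕ) : chainMean bl' K n = chainMean bl K n := by
  classical
  unfold chainMean
  symm
  rw [← Ex_map (μ := unif (Fin r → Fin K)) (fun x : Fin r → Fin K => x ∘ σ)]
  · refine congrArg (Ex _) (funext fun x => congrArg Nat.cast (le_antisymm ?_ ?_))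
    · exact cl_mono subset_rfl fun i _ j _ _ hij => (chain_comp_iff h).1 hij
    · exact cl_mono subset_rfl fun i _ j _ _ hij => (chain_comp_iff h).2 hij
  · intro y
    rw [sum_eq_single (y ∘ σ.symm)]
    · rfl
    · intro x hx hne
      refine absurd ?_ hne
      rw [← (mem_filter.1 hx).2, Function.comp_assoc, Equiv.self_comp_symm, Function.comp_id]
    · intro hne
      refine absurd (mem_filter.2 ⟨mem_univ _, ?_⟩) hne
      rw [Function.comp_assoc, Equiv.symm_comp_self, Function.comp_id]

theorem chainLim_reindex {bl bl' : Fin r → β} {τ : Equiv.Perm β} {σ : Equiv.Perm (Fin r)}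
    (h : ∀ p, bl' (σ p) = τ (bl p)) : chainLim bl' = chainLim bl := by
  funext n
  simp only [chainLim, chainMean_reindex h]

theorem goodProb_reindex [Fintype β] [DecidableEq β] {bl bl' : Fin r → β} {τ : Equiv.Perm β}
    {σ : Equiv.Perm (Fin r)} (h : ∀ p, bl' (σ p) = τ (bl p)) {g : ℕ} (κ : Fin g → Option β) :
    goodProb bl' (fun u => (κ u).map τ) = goodProb bl κ := by
  classical
  have hmap : ∀ (o : Option β) b, o.map τ = some (τ b) ↔ o = some b := fun o b => by
    rw [Option.map_eq_some_iff]
    constructor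
    · rintro ⟨a, rfl, ha⟩
      rw [τ.injective ha]
    · rintro rfl
      exact ⟨b, rfl, rfl⟩
  unfold goodProb
  congr 1
  · refine congrArg Nat.cast (card_equiv
      (Equiv.arrowCongr (Equiv.refl _) (Equiv.optionCongr τ)) fun v => ?_).symm
    simp only [mem_filter, mem_univ, true_and]
    constructor
    · rintro ⟨ρ, hρ⟩
      refine ⟨σ.symm.trans ρ, fun i => ?_⟩
      have := (hmap _ _).2 (hρ (σ.symm i))
      rw [← h, Equiv.apply_symm_apply] at this
      exact this
    · rintro ⟨ρ, hρ⟩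
      refine ⟨σ.trans ρ, fun i => (hmap _ _).1 ?_⟩
      rw [← h]
      exact hρ (σ i)
  · rw [← Equiv.prod_comp σ]
    refine prod_congr rfl fun i _ => ?_
    simp only [cellCount, h, hmap]

theorem bestProb_reindex [Fintype β] [LinearOrder β] {bl bl' : Fin r → β} {τ : Equiv.Perm β}
    {σ : Equiv.Perm (Fin r)} (h : ∀ p, bl' (σ p) = τ (bl p)) : bestProb bl' = bestProb bl := by
  have key : ∀ {bl bl' : Fin r → β} {τ : Equiv.Perm β} {σ : Equiv.Perm (Fin r)},
      (∀ p, bl' (σ p) = τ (bl p)) → bestProb bl ≤ bestProb bl' := by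
    intro bl bl' τ σ h
    have : Nonempty (Σ g : ℕ, Fin (g + 1) → Option β) := ⟨⟨0, fun _ => none⟩⟩
    refine ciSup_le fun κ => ?_
    rw [← goodProb_reindex h κ.2]
    exact goodProb_le_bestProb κ.1.succ_pos _
  refine le_antisymm (key (τ := τ.symm) (σ := σ.symm) fun p => ?_) (key h)
  rw [Equiv.eq_symm_apply, ← h, Equiv.apply_symm_apply]

end Reindexing
end RandomMatching

namespace RandomMatching
open Finset

theorem limit_eq_of_sameType {r : ℕ} (hr : r ≠ 0) {P Q : Finset (Finset ℕ)} (hP : IsPattern r P)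
    (hQ : IsPattern r Q) (h : SameType r Q P) {b : ℝ} (hb : CliqueSizeConvergesTo r P b) :
    CliqueSizeConvergesTo r Q b := by
  have : Nonempty (Fin r) := ⟨⟨0, Nat.pos_of_ne_zero hr⟩⟩
  obtain ⟨ℓ, c, c', hc, hc', htype⟩ := h
  obtain ⟨bl, s, hbl, hr1, hcard⟩ := IsBlockPartition.exists_realizes hQ hc
  obtain ⟨bl', s', hbl', hr2, hcard'⟩ := IsBlockPartition.exists_realizes hP hc'
  obtain ⟨τ, hτ⟩ := exists_perm_of_multiset_eq htype
  obtain ⟨σ, hσ⟩ := exists_equiv_of_card_fibre (f := fun p => τ (bl p)) (g := bl') fun i => by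
    have := hτ (τ.symm i)
    rw [Equiv.apply_symm_apply] at this
    rw [hcard', this, ← hcard]
    exact congrArg card (filter_congr fun p _ => by rw [Equiv.eq_symm_apply])
  obtain ⟨C, hC0, hC⟩ := exists_chainLim_tendsto bl
  have h1 := hr1.cliqueSizeConvergesTo hr hbl hC0.le hC
  rw [← chainLim_reindex hσ] at hC
  have h2 := hr2.cliqueSizeConvergesTo hr hbl' hC0.le hC
  rw [bestProb_reindex hσ] at h2
  rwa [limit_unique hr hb h2]

end RandomMatching

/-- **Theorem 1.7.** Fix `r ≥ 2` and a collectable `r`-pattern `P`. For a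
uniformly random ordered `r`-matching `M_n` of size `n`, the quantity
`L_P(M_n)/n^(1/r)` converges in probability to some constant `b_P > 0`, and
the constant depends only on the type of the pattern: any collectable
`r`-pattern `Q` of the same type has the same limit. -/
theorem random_matching_clique_limit (r : ℕ) (hr : 2 ≤ r)
    (P : Finset (Finset ℕ)) (hP : IsPattern r P) (hc : IsCollectable r P) :
    ∃ b : ℝ, 0 < b ∧ CliqueSizeConvergesTo r P b ∧
      ∀ Q : Finset (Finset ℕ), IsPattern r Q → IsCollectable r Q → SameType r Q P →
        CliqueSizeConvergesTo r Q b := by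
  have hr0 : 0 < r := by omega
  have : Nonempty (Fin r) := ⟨⟨0, hr0⟩⟩
  obtain ⟨bl, s, hbl, hreal⟩ := RandomMatching.exists_realizes hr0 hP hc
  obtain ⟨C, hC0, hC⟩ := RandomMatching.exists_chainLim_tendsto bl
  have hconv := hreal.cliqueSizeConvergesTo hr0.ne' hbl hC0.le hC
  refine ⟨_, mul_pos hC0 (Real.rpow_pos_of_pos (RandomMatching.bestProb_pos bl) _), hconv,
    fun Q hQ _ hQP => ?_⟩
  exact RandomMatching.limit_eq_of_sameType hr0.ne' hP hQ hQP hconv
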